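/- arXiv:1811.04410 — 4 statements merged into one kernel-verified Lean document; each statement's English description precedes it below -/
import Mathlib

section
/- Suppose condition (C2) holds. Then there exists a constant R_0 > 0 such that for all λ_2 > λ_1 > 0 the self-similar profiles satisfy f_{λ_1}(r) > f_{λ_2}(r) for every r ≥ R_0/λ_1; moreover the radial function x ↦ f_{λ_1}(|x|) − f_{λ_2}(|x|) is Lebesgue integrable on ℝ^n. -/
open Real Filter MeasureTheory Set Topology

noncomputable section

def Cstar (n : ℕ) (m : ℝ) : ℝ := 2 * m * ((n : ℝ) - 2 - n * m) / (1 - m)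

def beta1 (n : ℕ) (m : ℝ) : ℝ := 1 / ((n : ℝ) - 2 - n * m)

def betaE (n : ℕ) (m : ℝ) : ℝ := m / ((n : ℝ) - 2 - n * m)

def beta2 (n : ℕ) (m : ℝ) : ℝ :=
  Real.sqrt (2 * (1 - m) / ((n : ℝ) - 2 - n * m)) +
    (((n : ℝ) + 2) * m - ((n : ℝ) - 2)) / (2 * ((n : ℝ) - 2 - n * m))

def beta0 (n : ℕ) (m : ℝ) : ℝ := max (beta2 n m) (betaE n m)

def A0 (n : ℕ) (m β : ℝ) : ℝ :=
  (n : ℝ) - 2 - ((n : ℝ) + 2) * m + 2 * β * ((n : ℝ) - 2 - n * m)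

def gamma1 (n : ℕ) (m β : ℝ) : ℝ :=
  (A0 n m β - Real.sqrt ((A0 n m β) ^ 2 - 8 * ((n : ℝ) - 2 - n * m) * (1 - m))) / (2 * (1 - m))

def gamma2 (n : ℕ) (m β : ℝ) : ℝ :=
  (A0 n m β + Real.sqrt ((A0 n m β) ^ 2 - 8 * ((n : ℝ) - 2 - n * m) * (1 - m))) / (2 * (1 - m))

def Acoef1 (n : ℕ) (m β : ℝ) : ℝ := 1 / (1 - m) - β * gamma1 n m β

def Acoef2 (n : ℕ) (m β : ℝ) : ℝ := 1 / (1 - m) - β * gamma2 n m β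

/-- Condition (C1). -/
def CondC1 (n : ℕ) (m β : ℝ) : Prop :=
  beta1 n m < β ∨
    (4 < n ∧ 0 < m ∧ m < ((n : ℝ) - 4) / ((n : ℝ) - 2) ∧ beta0 n m < β ∧ β ≤ beta1 n m)

/-- Condition (C2). -/
def CondC2 (n : ℕ) (m β : ℝ) : Prop :=
  beta0 n m < β ∧ β < beta1 n m ∧
    (n ≤ 4 ∨ (4 < n ∧ ((n : ℝ) - 4) / ((n : ℝ) - 2) < m ∧ m < ((n : ℝ) - 2) / n))

/-- Condition (C3). -/
def CondC3 (n : ℕ) (m β : ℝ) : Prop :=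
  β = beta1 n m ∧
    (n ≤ 4 ∨ (4 < n ∧ ((n : ℝ) - 4) / ((n : ℝ) - 2) < m ∧ m < ((n : ℝ) - 2) / n))

/-- A self-similar profile `f = f_lam`. -/
structure IsProfile (n : ℕ) (m β α lam : ℝ) (f : ℝ → ℝ) : Prop where
  pos : ∀ r, 0 ≤ r → 0 < f r
  smooth : ContDiffOn ℝ 2 f (Set.Ici 0)
  ode : ∀ r, 0 < r →
    deriv (deriv (fun s => f s ^ m)) r + (((n : ℝ) - 1) / r) * deriv (fun s => f s ^ m) r +
      α * f r + β * r * deriv f r = 0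
  init : f 0 = lam ^ (2 / (1 - m))
  init' : deriv f 0 = 0
  asymp : Tendsto (fun r => r ^ 2 * f r ^ (1 - m)) atTop (nhds (Cstar n m))

/-- The Laplacian of `f : ℝ^n → ℝ`. -/
def lap (n : ℕ) (f : EuclideanSpace ℝ (Fin n) → ℝ) (x : EuclideanSpace ℝ (Fin n)) : ℝ :=
  ∑ i : Fin n,
    fderiv ℝ (fun y => fderiv ℝ f y (EuclideanSpace.single i (1 : ℝ))) x
      (EuclideanSpace.single i (1 : ℝ))

/-- The self-similar solution `U_lam(x,t) = (T-t)^α f_lam((T-t)^β |x|)`. -/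
def Uself (n : ℕ) (β α T : ℝ) (f : ℝ → ℝ) (x : EuclideanSpace ℝ (Fin n)) (t : ℝ) : ℝ :=
  (T - t) ^ α * f ((T - t) ^ β * ‖x‖)

/-- A (positive smooth) solution of the Cauchy problem `u_t = Δ(u^m)` on `ℝ^n × (0,T)` with
initial value `u0` taken in `L¹_loc`. -/
structure IsCauchySolution (n : ℕ) (m T : ℝ) (u0 : EuclideanSpace ℝ (Fin n) → ℝ)
    (u : EuclideanSpace ℝ (Fin n) → ℝ → ℝ) : Prop where
  pos : ∀ x, ∀ t ∈ Set.Ioo 0 T, 0 < u x t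
  smooth : ContDiffOn ℝ (⊤ : ℕ∞) (fun p : EuclideanSpace ℝ (Fin n) × ℝ => u p.1 p.2)
    ((Set.univ : Set (EuclideanSpace ℝ (Fin n))) ×ˢ Set.Ioo 0 T)
  pde : ∀ x, ∀ t ∈ Set.Ioo 0 T, deriv (u x) t = lap n (fun y => u y t ^ m) x
  init : ∀ K : Set (EuclideanSpace ℝ (Fin n)), IsCompact K →
    Tendsto (fun t => ∫ x in K, |u x t - u0 x|) (nhdsWithin 0 (Set.Ioi 0)) (nhds 0)

/-- The rescaled solution `ũ(y,τ)`. -/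
def resc (n : ℕ) (β α T : ℝ) (u : EuclideanSpace ℝ (Fin n) → ℝ → ℝ)
    (y : EuclideanSpace ℝ (Fin n)) (τ : ℝ) : ℝ :=
  (T * Real.exp (-τ)) ^ (-α) * u (((T * Real.exp (-τ)) ^ (-β)) • y) (T * (1 - Real.exp (-τ)))

/-- The singular profile `𝒞(y) = (C_*/|y|²)^{1/(1-m)}`. -/
def singC (n : ℕ) (m : ℝ) (y : EuclideanSpace ℝ (Fin n)) : ℝ :=
  (Cstar n m / ‖y‖ ^ 2) ^ (1 / (1 - m))

/-- The weight exponent `p₀`. -/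
def pZero (n : ℕ) (m β : ℝ) : ℝ := ((1 - m) / 2) * ((n : ℝ) - 2 / (1 - m) - gamma1 n m β)

/-- The constant `a_*`. -/
def aStar (n : ℕ) (m β : ℝ) : ℝ :=
  2 * m * pZero n m β / (Cstar n m * (1 - m)) * (gamma1 n m β + 2 * m / (1 - m))

/-- `Φ(s) = (1+w(s))^{1/m} − 1 − w(s)/m`. -/
def Phi (m : ℝ) (w : ℝ → ℝ) (s : ℝ) : ℝ := (1 + w s) ^ (1 / m) - 1 - w s / m

end

/-- Tangent line inequality for a convex power. -/
lemma rpow_tangent_le {q x z : ℝ} (hq : 1 ≤ q) (hx : 0 < x) (hz : 0 < z) :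
    z ^ q + q * z ^ (q - 1) * (x - z) ≤ x ^ q := by
  have h := one_add_mul_self_le_rpow_one_add (s := x / z - 1) (by linarith [div_pos hx hz]) hq
  have e1 : (1 : ℝ) + (x / z - 1) = x / z := by ring
  rw [e1, Real.div_rpow hx.le hz.le, le_div_iff₀ (Real.rpow_pos_of_pos hz q)] at h
  have e2 : z ^ (q - 1) = z ^ q / z := Real.rpow_sub_one hz.ne' q
  calc z ^ q + q * z ^ (q - 1) * (x - z) = (1 + q * (x / z - 1)) * z ^ q := by
        rw [e2]; field_simp
    _ ≤ x ^ q := h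

/-- A function reaching a value `≤ 0` after being positive has a first zero, where its derivative
is nonpositive. -/
lemma exists_first_zero {φ φ' : ℝ → ℝ} (hφ : ∀ s, HasDerivAt φ (φ' s) s) {a b : ℝ} (hab : a ≤ b)
    (ha : 0 < φ a) (hb : φ b ≤ 0) :
    ∃ c, a < c ∧ c ≤ b ∧ φ c = 0 ∧ φ' c ≤ 0 ∧ ∀ s, a ≤ s → s < c → 0 < φ s := by
  have hcont : Continuous φ := continuous_iff_continuousAt.2 fun s => (hφ s).continuousAt
  have hcl : IsClosed (Icc a b ∩ φ ⁻¹' Iic 0) := isClosed_Icc.inter (isClosed_Iic.preimage hcont)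
  obtain ⟨⟨⟨hac, hcb⟩, hc0⟩, hleast⟩ :=
    hcl.isLeast_csInf ⟨b, ⟨hab, le_rfl⟩, hb⟩ ⟨a, fun s hs => hs.1.1⟩
  set c := sInf (Icc a b ∩ φ ⁻¹' Iic 0)
  have hc0' : φ c ≤ 0 := hc0
  have hac' : a < c := lt_of_le_of_ne hac (by rintro h; rw [← h] at hc0'; linarith)
  have hpos : ∀ s, a ≤ s → s < c → 0 < φ s := by
    intro s hs hsc
    by_contra! hle
    exact absurd (hleast ⟨⟨hs, hsc.le.trans hcb⟩, hle⟩) (not_le.2 hsc)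
  have hev : ∀ᶠ s in 𝓝[<] c, 0 < φ s := by
    filter_upwards [Ioo_mem_nhdsLT hac'] with s hs using hpos s hs.1.le hs.2
  have hzero : φ c = 0 := by
    refine le_antisymm hc0' (ge_of_tendsto (x := 𝓝[<] c)
      (hcont.continuousAt.mono_left nhdsWithin_le_nhds) ?_)
    filter_upwards [hev] with s hs using hs.le
  refine ⟨c, hac', hcb, hzero, ?_, hpos⟩
  have hslope := ((hasDerivAt_iff_tendsto_slope.1 (hφ c)).mono_left
    (nhdsWithin_mono c (fun s (hs : s < c) => hs.ne)))
  refine le_of_tendsto (x := 𝓝[<] c) hslope ?_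
  filter_upwards [hev, self_mem_nhdsWithin] with s hs hsc
  rw [slope_def_field, hzero, sub_zero]
  exact (div_neg_of_pos_of_neg hs (sub_neg.2 hsc)).le

/-- A function with derivative eventually bounded above by a negative constant takes a negative
value. -/
lemma exists_neg_of_deriv_le {φ φ' : ℝ → ℝ} (hφ : ∀ s, HasDerivAt φ (φ' s) s) {a c : ℝ}
    (hc : 0 < c) (h : ∀ s, a ≤ s → φ' s ≤ -c) : ∃ s, a ≤ s ∧ φ s < 0 := by
  have hb : a ≤ a + (|φ a| + 1) / c := by
    have : 0 ≤ (|φ a| + 1) / c := by positivity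
    linarith
  refine ⟨_, hb, ?_⟩
  have := (convex_Ici a).image_sub_le_mul_sub_of_deriv_le (f := φ) (C := -c)
    (fun s _ => (hφ s).continuousAt.continuousWithinAt)
    (fun s _ => (hφ s).differentiableAt.differentiableWithinAt)
    (fun s hs => by
      rw [interior_Ici] at hs
      rw [(hφ s).deriv]; exact h s (le_of_lt hs)) a self_mem_Ici _ hb hb
  have e : -c * (a + (|φ a| + 1) / c - a) = -(|φ a| + 1) := by field_simp; ring
  rw [e] at this
  linarith [le_abs_self (φ a)]

/-- The autonomous system solved by `h = (r ^ (2 / (1 - m)) f) ^ m`, `q = 1 / m`, as a function of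
`s = log r`, together with the inequalities on the parameters valid under (C2) and the behaviour
of the profile near the origin and near infinity. -/
structure IsProfileFlow (q μ ν β z : ℝ) (h p : ℝ → ℝ) : Prop where
  hμ : 0 < μ
  hq : μ * (q - 1) = 2
  hν : 0 < ν
  hβ : 0 < β
  hδ : β * ν < μ * q / 2
  two_mul_lt : 2 * ν < ν - μ + 2 * β * ν
  disc_pos : 8 * ν < (ν - μ + 2 * β * ν) ^ 2
  le_mul : μ * q ≤ (ν - μ + 2 * β * ν) * β
  hz : 0 < z
  hzq : q * z ^ (q - 1) = 2 * ν
  pos : ∀ s, 0 < h s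
  deriv_h : ∀ s, HasDerivAt h (p s) s
  deriv_p : ∀ s, HasDerivAt p (-(ν - μ) * p s + μ * ν * h s - β * (q * h s ^ (q - 1) * p s)
    - μ * q / 2 * h s ^ q) s
  tendsto_h : Tendsto h atTop (𝓝 z)
  flux : Tendsto (fun s => exp (ν * s) * (p s - μ * h s + β * h s ^ q)) atBot (𝓝 0)
  mass : Tendsto (fun s => exp (ν * s) * h s ^ q) atBot (𝓝 0)
  pos_p : ∀ᶠ s in atBot, 0 < p s

namespace IsProfileFlow

variable {q μ ν β z : ℝ} {h p : ℝ → ℝ}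

/-- The weighted derivative of the flux `p - μ h + β h ^ q`. -/
noncomputable def weight (q μ ν β : ℝ) (h p : ℝ → ℝ) (s : ℝ) : ℝ :=
  exp (ν * s) * (-ν * (p s - μ * h s + β * h s ^ q) - (μ * q / 2 - β * ν) * h s ^ q)

lemma one_lt (F : IsProfileFlow q μ ν β z h p) : 1 < q := by
  have := F.hμ
  have := F.hq
  by_contra! hle
  nlinarith

lemma rpow_eq (F : IsProfileFlow q μ ν β z h p) (s : ℝ) : h s ^ q = h s * h s ^ (q - 1) := by
  rw [Real.rpow_sub_one (F.pos s).ne']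
  field_simp [(F.pos s).ne']

lemma hasDerivAt_rpow (F : IsProfileFlow q μ ν β z h p) (s : ℝ) :
    HasDerivAt (fun t => h t ^ q) (q * h s ^ (q - 1) * p s) s := by
  convert (F.deriv_h s).rpow_const (p := q) (Or.inl (F.pos s).ne') using 1
  ring

lemma hasDerivAt_exp_mul (c s : ℝ) : HasDerivAt (fun t => exp (c * t)) (c * exp (c * s)) s := by
  refine ((hasDerivAt_id s).const_mul c).exp.congr_deriv ?_
  simp [mul_comm]

lemma hasDerivAt_flux (F : IsProfileFlow q μ ν β z h p) (s : ℝ) :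
    HasDerivAt (fun t => p t - μ * h t + β * h t ^ q)
      (-ν * (p s - μ * h s + β * h s ^ q) - (μ * q / 2 - β * ν) * h s ^ q) s := by
  refine (((F.deriv_p s).sub ((F.deriv_h s).const_mul μ)).add
    ((F.hasDerivAt_rpow s).const_mul β)).congr_deriv ?_
  ring

lemma hasDerivAt_weight (F : IsProfileFlow q μ ν β z h p) (s : ℝ) :
    HasDerivAt (weight q μ ν β h p)
      (-(exp (ν * s) * (μ * q / 2 - β * ν) * (q * h s ^ (q - 1)) * p s)) s := by
  refine ((hasDerivAt_exp_mul ν s).mul (((F.hasDerivAt_flux s).const_mul (-ν)).sub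
    ((F.hasDerivAt_rpow s).const_mul (μ * q / 2 - β * ν)))).congr_deriv ?_
  simp only [Pi.sub_apply]
  ring

lemma weight_eq (q μ ν β : ℝ) (h p : ℝ → ℝ) (s : ℝ) :
    weight q μ ν β h p s = exp (ν * s) * ((-(ν - μ) * p s + μ * ν * h s
      - β * (q * h s ^ (q - 1) * p s) - μ * q / 2 * h s ^ q)
      + (β * (q * h s ^ (q - 1)) - μ) * p s) := by
  unfold weight
  ring

lemma tendsto_weight (F : IsProfileFlow q μ ν β z h p) :
    Tendsto (weight q μ ν β h p) atBot (𝓝 0) := by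
  have := (F.flux.const_mul (-ν)).sub (F.mass.const_mul (μ * q / 2 - β * ν))
  simp only [mul_zero, sub_zero] at this
  refine this.congr fun s => ?_
  unfold weight
  ring

lemma coef_pos (F : IsProfileFlow q μ ν β z h p) (s : ℝ) :
    0 < exp (ν * s) * (μ * q / 2 - β * ν) * (q * h s ^ (q - 1)) := by
  have h1 := F.hδ
  have h2 := F.one_lt
  have h3 := Real.rpow_pos_of_pos (F.pos s) (q - 1)
  have h4 : 0 < μ * q / 2 - β * ν := by linarith
  have h5 : 0 < q := by linarith
  positivity

/-- If `p > 0` up to time `b`, the weight is strictly negative there. -/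
lemma weight_neg (F : IsProfileFlow q μ ν β z h p) {b : ℝ} (hb : ∀ s, s < b → 0 < p s)
    {s : ℝ} (hs : s ≤ b) : weight q μ ν β h p s < 0 := by
  have hanti : StrictAntiOn (weight q μ ν β h p) (Iic b) := by
    refine strictAntiOn_of_deriv_neg (convex_Iic b)
      (fun t _ => (F.hasDerivAt_weight t).continuousAt.continuousWithinAt) fun t ht => ?_
    rw [interior_Iic] at ht
    rw [(F.hasDerivAt_weight t).deriv]
    exact neg_neg_of_pos (mul_pos (F.coef_pos t) (hb t ht))
  have h1 : weight q μ ν β h p s < weight q μ ν β h p (s - 1) :=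
    hanti (show s - 1 ≤ b by linarith) hs (by linarith)
  have h2 : weight q μ ν β h p (s - 1) ≤ 0 := by
    refine ge_of_tendsto F.tendsto_weight ?_
    filter_upwards [Iic_mem_atBot (s - 1)] with t ht
    exact hanti.antitoneOn (show t ≤ b by linarith [mem_Iic.1 ht])
      (show s - 1 ≤ b by linarith) ht
  linarith

lemma le_coef (F : IsProfileFlow q μ ν β z h p) {s : ℝ} (hs : z ≤ h s) :
    2 * ν ≤ q * h s ^ (q - 1) := by
  rw [← F.hzq]
  have := F.one_lt
  exact mul_le_mul_of_nonneg_left (Real.rpow_le_rpow F.hz.le hs (by linarith)) (by linarith)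

lemma coef_le (F : IsProfileFlow q μ ν β z h p) {s : ℝ} (hs : h s ≤ z) :
    q * h s ^ (q - 1) ≤ 2 * ν := by
  rw [← F.hzq]
  have := F.one_lt
  exact mul_le_mul_of_nonneg_left (Real.rpow_le_rpow (F.pos s).le hs (by linarith)) (by linarith)

lemma hasDerivAt_exp_mul_p (F : IsProfileFlow q μ ν β z h p) (s : ℝ) :
    HasDerivAt (fun t => exp (ν * t) * p t)
      (weight q μ ν β h p s - exp (ν * s) * ((β * (q * h s ^ (q - 1)) - μ - ν) * p s)) s := by
  refine ((hasDerivAt_exp_mul ν s).mul (F.deriv_p s)).congr_deriv ?_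
  rw [weight_eq]
  ring

/-- The orbit cannot be increasing for all times. -/
lemma exists_nonpos (F : IsProfileFlow q μ ν β z h p) : ∃ s, p s ≤ 0 := by
  by_contra! hpos
  have hneg : ∀ s, weight q μ ν β h p s < 0 := fun s => F.weight_neg (fun t _ => hpos t) le_rfl
  have hanti : Antitone (weight q μ ν β h p) :=
    antitone_of_deriv_nonpos (fun s => (F.hasDerivAt_weight s).differentiableAt) fun s => by
      rw [(F.hasDerivAt_weight s).deriv]
      exact neg_nonpos.2 (mul_pos (F.coef_pos s) (hpos s)).le
  have hlim : Tendsto (fun s => β * (q * h s ^ (q - 1)) - μ - ν) atTop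
      (𝓝 (β * (q * z ^ (q - 1)) - μ - ν)) :=
    ((((F.tendsto_h.rpow_const (Or.inl F.hz.ne')).const_mul q).const_mul β).sub_const μ).sub_const ν
  obtain ⟨a, ha⟩ := eventually_atTop.1 (hlim.eventually_const_lt (u := 0)
    (by rw [F.hzq]; linarith [F.two_mul_lt]))
  obtain ⟨s, -, hs⟩ := exists_neg_of_deriv_le (a := max a 0) F.hasDerivAt_exp_mul_p
    (neg_pos.2 (hneg 0)) fun s hs => by
      have h1 := hanti ((le_max_right a 0).trans hs)
      have h2 := mul_pos (Real.exp_pos (ν * s))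
        (mul_pos (ha s ((le_max_left a 0).trans hs)) (hpos s))
      linarith
  exact absurd hs (not_lt.2 (mul_pos (Real.exp_pos _) (hpos s)).le)

/-- The orbit turns around at a first time, above the equilibrium. -/
lemma exists_turning (F : IsProfileFlow q μ ν β z h p) :
    ∃ s₀, p s₀ = 0 ∧ z < h s₀ ∧ ∀ s, s < s₀ → 0 < p s := by
  obtain ⟨b, hb⟩ := F.exists_nonpos
  obtain ⟨a, ha⟩ := eventually_atBot.1 F.pos_p
  have hab : a ≤ b := by
    by_contra! hlt
    exact absurd hb (not_le.2 (ha b hlt.le))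
  obtain ⟨c, hac, -, hc, -, hpos⟩ := exists_first_zero F.deriv_p hab (ha a le_rfl) hb
  have hpos' : ∀ s, s < c → 0 < p s := fun s hs =>
    (le_total s a).elim (fun h => ha s h) fun h => hpos s h hs
  refine ⟨c, hc, ?_, hpos'⟩
  have hw := F.weight_neg hpos' le_rfl
  rw [weight_eq, hc, F.rpow_eq c] at hw
  have hw' := neg_of_mul_neg_right hw (Real.exp_pos _).le
  by_contra! hle
  have h1 := F.coef_le hle
  have h2 := mul_nonneg (mul_pos F.hμ (F.pos c)).le (sub_nonneg.2 h1)
  nlinarith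

/-- The slope of the barrier line through the equilibrium makes it impassable from above. -/
lemma barrier (F : IsProfileFlow q μ ν β z h p) {s : ℝ} (hs : z < h s)
    (hp : p s + (ν - μ + 2 * β * ν) / 2 * (h s - z) = 0) :
    0 < (-(ν - μ) * p s + μ * ν * h s - β * (q * h s ^ (q - 1) * p s) - μ * q / 2 * h s ^ q)
      + (ν - μ + 2 * β * ν) / 2 * p s := by
  set k := (ν - μ + 2 * β * ν) / 2 with hk
  have hA : ν - μ + 2 * β * ν = 2 * k := by rw [hk]; ring
  have hdisc := F.disc_pos
  have hle := F.le_mul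
  have hlt := F.two_mul_lt
  rw [hA] at hdisc hle hlt
  have hν := F.hν
  have hq1 := F.one_lt
  have t1 := rpow_tangent_le hq1.le (F.pos s) F.hz
  have t2 := rpow_tangent_le hq1.le F.hz (F.pos s)
  have hzpow : q * z ^ q = z * (2 * ν) := by
    rw [← F.hzq, Real.rpow_sub_one F.hz.ne']
    field_simp [F.hz.ne']
  rw [F.hzq] at t1
  set x := h s - z with hx
  have hx0 : 0 < x := sub_pos.2 hs
  set E := h s ^ q - z ^ q with hE
  have hp' : p s = -(k * x) := by linarith
  have e1 : 2 * ν * x ≤ E := by linarith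
  have e2 : E ≤ q * h s ^ (q - 1) * x := by
    have : z - h s = -x := by rw [hx]; ring
    rw [this] at t2
    linarith
  have hkβ : 0 < k * β := mul_pos (by linarith) F.hβ
  have e3 : k * β * E ≤ k * β * (q * h s ^ (q - 1) * x) := mul_le_mul_of_nonneg_left e2 hkβ.le
  have e4 : (k * β - μ * q / 2) * (2 * ν * x) ≤ (k * β - μ * q / 2) * E :=
    mul_le_mul_of_nonneg_left e1 (by linarith)
  have e5 : 0 < x * (k ^ 2 - 2 * ν) := mul_pos hx0 (by linarith)
  have e6 : h s ^ q = z ^ q + E := by rw [hE]; ring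
  have e7 : h s = z + x := by rw [hx]; ring
  have e8 : ν - μ = 2 * k - 2 * β * ν := by linarith
  have key : (-(ν - μ) * p s + μ * ν * h s - β * (q * h s ^ (q - 1) * p s) - μ * q / 2 * h s ^ q)
      + k * p s = x * (k ^ 2 - 2 * ν)
        + (k * β * (q * h s ^ (q - 1) * x) - k * β * E)
        + ((k * β - μ * q / 2) * E - (k * β - μ * q / 2) * (2 * ν * x)) := by
    rw [hp', e8]
    have m1 : μ * q / 2 * h s ^ q = μ * ν * z + μ * q / 2 * E := by
      rw [e6]; linear_combination μ / 2 * hzpow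
    have m2 : μ * ν * h s = μ * ν * z + μ * ν * x := by rw [e7]; ring
    rw [m1, m2]
    linear_combination (-ν * x) * F.hq
  rw [key]
  linarith

lemma above_of_turning (F : IsProfileFlow q μ ν β z h p) {s₀ : ℝ} (h0 : p s₀ = 0)
    (hz : z < h s₀) {s : ℝ} (hs : s₀ ≤ s) : z < h s := by
  set k := (ν - μ + 2 * β * ν) / 2 with hk
  have hkpos : 0 < k := by
    have := F.two_mul_lt
    have := F.hν
    rw [hk]; linarith
  have hy : ∀ t, HasDerivAt (fun t => p t + k * (h t - z))
      ((-(ν - μ) * p t + μ * ν * h t - β * (q * h t ^ (q - 1) * p t) - μ * q / 2 * h t ^ q)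
      + k * p t) t := fun t =>
    (F.deriv_p t).add (((F.deriv_h t).sub_const z).const_mul k)
  have above : ∀ b, s₀ ≤ b → (∀ t, s₀ ≤ t → t < b → 0 < p t + k * (h t - z)) → z < h b := by
    intro b hb hpos
    have hd : ∀ t, HasDerivAt (fun t => exp (k * t) * (h t - z))
        (exp (k * t) * (p t + k * (h t - z))) t := fun t => by
      refine ((hasDerivAt_exp_mul k t).mul ((F.deriv_h t).sub_const z)).congr_deriv ?_
      ring
    have hmono : MonotoneOn (fun t => exp (k * t) * (h t - z)) (Icc s₀ b) := by
      refine monotoneOn_of_deriv_nonneg (convex_Icc _ _)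
        (fun t _ => (hd t).continuousAt.continuousWithinAt)
        (fun t _ => (hd t).differentiableAt.differentiableWithinAt) fun t ht => ?_
      rw [interior_Icc] at ht
      rw [(hd t).deriv]
      exact (mul_pos (Real.exp_pos _) (hpos t ht.1.le ht.2)).le
    have h1 : exp (k * s₀) * (h s₀ - z) ≤ exp (k * b) * (h b - z) :=
      hmono (left_mem_Icc.2 hb) (right_mem_Icc.2 hb) hb
    have h2 := mul_pos (Real.exp_pos (k * s₀)) (sub_pos.2 hz)
    exact sub_pos.1 (pos_of_mul_pos_right (h2.trans_le h1) (Real.exp_pos _).le)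
  refine above s hs fun b hb _ => ?_
  by_contra! hle
  have hstart : 0 < p s₀ + k * (h s₀ - z) := by
    rw [h0, zero_add]; exact mul_pos hkpos (sub_pos.2 hz)
  obtain ⟨c, hc, -, hc0, hc', hbefore⟩ := exists_first_zero hy hb hstart hle
  exact absurd hc' (not_le.2 (F.barrier (above c hc.le hbefore) hc0))

lemma neg_of_turning (F : IsProfileFlow q μ ν β z h p) {s₀ : ℝ} (h0 : p s₀ = 0)
    (hz : z < h s₀) {s : ℝ} (hs : s₀ < s) : p s < 0 := by
  have hdneg : ∀ t, s₀ ≤ t → p t = 0 →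
      -(ν - μ) * p t + μ * ν * h t - β * (q * h t ^ (q - 1) * p t) - μ * q / 2 * h t ^ q < 0 := by
    intro t ht hpt
    have habove := F.above_of_turning h0 hz ht
    have hq1 := F.one_lt
    have h1 : 2 * ν < q * h t ^ (q - 1) := by
      rw [← F.hzq]
      exact mul_lt_mul_of_pos_left (Real.rpow_lt_rpow F.hz.le habove (by linarith)) (by linarith)
    have h2 := mul_pos (mul_pos F.hμ (F.pos t)) (sub_pos.2 h1)
    rw [hpt, F.rpow_eq t]
    nlinarith
  have hslope := ((hasDerivAt_iff_tendsto_slope.1 (F.deriv_p s₀)).mono_left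
    (nhdsWithin_mono s₀ (fun t (ht : s₀ < t) => ht.ne')))
  have hev : ∀ᶠ t in 𝓝[>] s₀, slope p s₀ t < 0 := hslope.eventually_lt_const (hdneg s₀ le_rfl h0)
  obtain ⟨t, hlt, htmem⟩ := (hev.and (Ioo_mem_nhdsGT hs)).exists
  have hpt : p t < 0 := by
    rw [slope_def_field, h0, sub_zero] at hlt
    by_contra! hge
    exact absurd hlt (not_lt.2 (div_nonneg hge (sub_pos.2 htmem.1).le))
  by_contra! hge
  obtain ⟨c, hc, -, hc0, hc', -⟩ := exists_first_zero (φ := fun t => -p t)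
    (fun t => (F.deriv_p t).neg) htmem.2.le (neg_pos.2 hpt) (neg_nonpos.2 hge)
  have := hdneg c (htmem.1.trans hc).le (neg_eq_zero.1 hc0)
  linarith

lemma weight_nonpos (F : IsProfileFlow q μ ν β z h p) (s : ℝ) : weight q μ ν β h p s ≤ 0 := by
  obtain ⟨s₀, h0, hz, hpos⟩ := F.exists_turning
  rcases le_total s s₀ with hs | hs
  · exact (F.weight_neg hpos hs).le
  have hneg : ∀ t, s₀ < t → p t < 0 := fun t ht => F.neg_of_turning h0 hz ht
  by_contra! hw
  have hmono : MonotoneOn (weight q μ ν β h p) (Ici s₀) := by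
    refine monotoneOn_of_deriv_nonneg (convex_Ici s₀)
      (fun t _ => (F.hasDerivAt_weight t).continuousAt.continuousWithinAt)
      (fun t _ => (F.hasDerivAt_weight t).differentiableAt.differentiableWithinAt) fun t ht => ?_
    rw [interior_Ici] at ht
    rw [(F.hasDerivAt_weight t).deriv, neg_nonneg]
    exact (mul_neg_of_pos_of_neg (F.coef_pos t) (hneg t ht)).le
  obtain ⟨t, hst, ht⟩ := exists_neg_of_deriv_le (φ := fun t => -(exp (ν * t) * p t)) (a := s + 1)
    (fun t => (F.hasDerivAt_exp_mul_p t).neg) hw fun t ht => by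
      have hs₀t : s₀ < t := by linarith
      have h1 := hmono hs hs₀t.le (by linarith : s ≤ t)
      have h2 := F.le_coef (F.above_of_turning h0 hz hs₀t.le).le
      have h3 : 0 < β * (q * h t ^ (q - 1)) - μ - ν := by
        nlinarith [F.two_mul_lt, mul_le_mul_of_nonneg_left h2 F.hβ.le]
      have h4 := mul_neg_of_pos_of_neg (Real.exp_pos (ν * t))
        (mul_neg_of_pos_of_neg h3 (hneg t hs₀t))
      linarith
  have := mul_neg_of_pos_of_neg (Real.exp_pos (ν * t)) (hneg t (by linarith))
  linarith

lemma antitone_flux (F : IsProfileFlow q μ ν β z h p) :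
    Antitone fun s => p s - μ * h s + β * h s ^ q := by
  refine antitone_of_deriv_nonpos (fun s => (F.hasDerivAt_flux s).differentiableAt) fun s => ?_
  rw [(F.hasDerivAt_flux s).deriv]
  exact nonpos_of_mul_nonpos_right (F.weight_nonpos s) (Real.exp_pos _)

lemma exists_strictAntiOn (F : IsProfileFlow q μ ν β z h p) : ∃ s₀, StrictAntiOn h (Ici s₀) := by
  obtain ⟨s₀, h0, hz, -⟩ := F.exists_turning
  refine ⟨s₀, strictAntiOn_of_deriv_neg (convex_Ici s₀)
    (fun t _ => (F.deriv_h t).continuousAt.continuousWithinAt) fun t ht => ?_⟩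
  rw [interior_Ici] at ht
  rw [(F.deriv_h t).deriv]
  exact F.neg_of_turning h0 hz ht

end IsProfileFlow

lemma tendsto_mul_deriv_rpow_nhdsGT_zero {f : ℝ → ℝ} (m : ℝ) (hpos : ∀ r, 0 ≤ r → 0 < f r)
    (hf : ContDiffOn ℝ 2 f (Ici 0)) :
    Tendsto (fun r => r * deriv (fun s => f s ^ m) r) (𝓝[>] 0) (𝓝 0) := by
  have hc : Tendsto f (𝓝[>] 0) (𝓝 (f 0)) :=
    (hf.continuousOn 0 self_mem_Ici).mono_left (nhdsWithin_mono 0 Ioi_subset_Ici_self)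
  have hd : Tendsto (derivWithin f (Ici 0)) (𝓝[>] 0) (𝓝 (derivWithin f (Ici 0) 0)) :=
    (hf.continuousOn_derivWithin (uniqueDiffOn_Ici 0) (by norm_num) 0 self_mem_Ici).mono_left
      (nhdsWithin_mono 0 Ioi_subset_Ici_self)
  have hid : Tendsto (fun r : ℝ => r) (𝓝[>] 0) (𝓝 0) := tendsto_id.mono_left nhdsWithin_le_nhds
  have hlim := hid.mul ((hd.mul_const m).mul
    (hc.rpow_const (p := m - 1) (Or.inl (hpos 0 le_rfl).ne')))
  rw [zero_mul] at hlim
  refine hlim.congr' ?_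
  filter_upwards [self_mem_nhdsWithin] with r hr
  have hr0 : (0 : ℝ) < r := hr
  have hdiff : DifferentiableAt ℝ f r :=
    (hf.differentiableOn (by norm_num)).differentiableAt (Ici_mem_nhds hr0)
  rw [(hdiff.hasDerivAt.rpow_const (p := m) (Or.inl (hpos r hr0.le).ne')).deriv,
    derivWithin_of_mem_nhds (Ici_mem_nhds hr0)]

namespace IsProfile

variable {n : ℕ} {m β α lam : ℝ} {f : ℝ → ℝ}

lemma contDiffAt (hf : IsProfile n m β α lam f) {r : ℝ} (hr : 0 < r) : ContDiffAt ℝ 2 f r :=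
  hf.smooth.contDiffAt (Ici_mem_nhds hr)

lemma hasDerivAt (hf : IsProfile n m β α lam f) {r : ℝ} (hr : 0 < r) :
    HasDerivAt f (deriv f r) r :=
  ((hf.contDiffAt hr).differentiableAt (by norm_num)).hasDerivAt

lemma hasDerivAt_rpow (hf : IsProfile n m β α lam f) {r : ℝ} (hr : 0 < r) :
    HasDerivAt (fun s => f s ^ m) (deriv (fun s => f s ^ m) r) r :=
  (((hf.contDiffAt hr).rpow_const_of_ne (hf.pos r hr.le).ne').differentiableAt
    (by norm_num)).hasDerivAt

lemma hasDerivAt_deriv_rpow (hf : IsProfile n m β α lam f) {r : ℝ} (hr : 0 < r) :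
    HasDerivAt (deriv fun s => f s ^ m) (deriv (deriv fun s => f s ^ m) r) r := by
  have h := (hf.contDiffAt hr).rpow_const_of_ne (p := m) (hf.pos r hr.le).ne'
  exact ((h.derivWithin (m := 1) (by norm_num)).differentiableAt (by norm_num)).hasDerivAt

/-- The profile `f ^ m` in logarithmic variables. -/
noncomputable def logPow (m μ : ℝ) (f : ℝ → ℝ) (s : ℝ) : ℝ := exp (μ * s) * f (exp s) ^ m

/-- The derivative of `logPow`. -/
noncomputable def logPowDeriv (m μ : ℝ) (f : ℝ → ℝ) (s : ℝ) : ℝ :=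
  exp (μ * s) * (exp s * deriv (fun r => f r ^ m) (exp s) + μ * f (exp s) ^ m)

lemma logPow_rpow (hf : IsProfile n m β α lam f) {μ : ℝ} (hm : m ≠ 0) (hμ : μ / m = μ + 2)
    (s : ℝ) : logPow m μ f s ^ (1 / m) = exp ((μ + 2) * s) * f (exp s) := by
  have hp := hf.pos _ (Real.exp_pos s).le
  unfold logPow
  rw [Real.mul_rpow (Real.exp_pos _).le (Real.rpow_nonneg hp.le m), ← Real.exp_mul,
    ← Real.rpow_mul hp.le, mul_one_div_cancel hm, Real.rpow_one, ← hμ]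
  congr 2
  ring

lemma hasDerivAt_logPow (hf : IsProfile n m β α lam f) (μ s : ℝ) :
    HasDerivAt (logPow m μ f) (logPowDeriv m μ f s) s := by
  refine ((IsProfileFlow.hasDerivAt_exp_mul μ s).mul
    ((hf.hasDerivAt_rpow (Real.exp_pos s)).comp s (Real.hasDerivAt_exp s))).congr_deriv ?_
  simp only [logPowDeriv, Function.comp]
  ring

lemma logPow_pos (hf : IsProfile n m β α lam f) (μ s : ℝ) : 0 < logPow m μ f s :=
  mul_pos (Real.exp_pos _) (Real.rpow_pos_of_pos (hf.pos _ (Real.exp_pos s).le) m)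

lemma coef_mul_logPowDeriv (hf : IsProfile n m β α lam f) {μ : ℝ} (hm : m ≠ 0)
    (hμ : μ / m = μ + 2) (s : ℝ) :
    1 / m * logPow m μ f s ^ (1 / m - 1) * logPowDeriv m μ f s =
      exp ((μ + 2) * s) * ((μ + 2) * f (exp s) + exp s * deriv f (exp s)) := by
  have h1 := (hf.hasDerivAt_logPow μ s).rpow_const (p := 1 / m) (Or.inl (hf.logPow_pos μ s).ne')
  have h2 := (IsProfileFlow.hasDerivAt_exp_mul (μ + 2) s).mul
    ((hf.hasDerivAt (Real.exp_pos s)).comp s (Real.hasDerivAt_exp s))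
  have h3 := h1.unique (h2.congr_of_eventuallyEq
    (Eventually.of_forall fun t => hf.logPow_rpow hm hμ t))
  simp only [Function.comp] at h3
  linear_combination h3

lemma hasDerivAt_logPowDeriv (hf : IsProfile n m β α lam f) {μ ν : ℝ} (hm : m ≠ 0)
    (hμ : μ / m = μ + 2) (hν : ν = n - 2 - μ) (hα : α = (2 * β + 1) * (μ + 2) / 2) (s : ℝ) :
    HasDerivAt (logPowDeriv m μ f) (-(ν - μ) * logPowDeriv m μ f s + μ * ν * logPow m μ f s
      - β * (1 / m * logPow m μ f s ^ (1 / m - 1) * logPowDeriv m μ f s)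
      - μ * (1 / m) / 2 * logPow m μ f s ^ (1 / m)) s := by
  have hr := Real.exp_pos s
  rw [hf.coef_mul_logPowDeriv hm hμ, hf.logPow_rpow hm hμ]
  refine ((IsProfileFlow.hasDerivAt_exp_mul μ s).mul
    (((Real.hasDerivAt_exp s).mul ((hf.hasDerivAt_deriv_rpow hr).comp s
      (Real.hasDerivAt_exp s))).add
    (((hf.hasDerivAt_rpow hr).comp s (Real.hasDerivAt_exp s)).const_mul μ))).congr_deriv ?_
  have hode := hf.ode _ hr
  have hμ' : μ * (1 / m) = μ + 2 := by rw [← hμ]; ring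
  have he : exp ((μ + 2) * s) = exp (μ * s) * exp s * exp s := by
    rw [← Real.exp_add, ← Real.exp_add]; congr 1; ring
  rw [hμ', he]
  simp only [logPow, logPowDeriv, Function.comp, Pi.mul_apply, Pi.add_apply]
  set r := exp s
  rw [hα] at hode
  rw [hν]
  have hode' : r * r * deriv (deriv fun s => f s ^ m) r =
      -((n - 1) * r * deriv (fun s => f s ^ m) r)
      - r * r * ((2 * β + 1) * (μ + 2) / 2 * f r + β * r * deriv f r) := by
    field_simp at hode
    linear_combination r / 2 * hode
  linear_combination exp (μ * s) * hode'

lemma tendsto_logPow (hf : IsProfile n m β α lam f) (hm1 : m < 1)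
    {μ : ℝ} (hμ : μ = 2 * m / (1 - m)) (hC : 0 < Cstar n m) :
    Tendsto (logPow m μ f) atTop (𝓝 (Cstar n m ^ (m / (1 - m)))) := by
  have h := (hf.asymp.rpow_const (p := m / (1 - m)) (Or.inl hC.ne')).comp Real.tendsto_exp_atTop
  refine h.congr fun s => ?_
  have hp := hf.pos _ (Real.exp_pos s).le
  have h1 : 1 - m ≠ 0 := by linarith
  simp only [Function.comp, logPow]
  rw [Real.mul_rpow (by positivity) (by positivity), ← Real.rpow_mul hp.le,
    mul_div_cancel₀ _ h1, ← Real.exp_nat_mul, ← Real.exp_mul, hμ]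
  congr 2
  push_cast
  ring

lemma tendsto_comp_exp (hf : IsProfile n m β α lam f) :
    Tendsto (fun s => f (exp s)) atBot (𝓝 (f 0)) :=
  ((hf.smooth.continuousOn 0 self_mem_Ici).mono_left
    (nhdsWithin_mono 0 Ioi_subset_Ici_self)).comp Real.tendsto_exp_atBot_nhdsGT

lemma tendsto_mul_deriv_comp_exp (hf : IsProfile n m β α lam f) :
    Tendsto (fun s => exp s * deriv (fun r => f r ^ m) (exp s)) atBot (𝓝 0) :=
  (tendsto_mul_deriv_rpow_nhdsGT_zero m hf.pos hf.smooth).comp Real.tendsto_exp_atBot_nhdsGT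

end IsProfile

lemma tendsto_exp_mul_atBot {c : ℝ} (hc : 0 < c) :
    Tendsto (fun s => exp (c * s)) atBot (𝓝 0) :=
  Real.tendsto_exp_atBot.comp (tendsto_id.const_mul_atBot hc)

namespace IsProfile

variable {n : ℕ} {m β α lam : ℝ} {f : ℝ → ℝ}

lemma tendsto_mass (hf : IsProfile n m β α lam f) {μ ν : ℝ} (hm : m ≠ 0)
    (hμ : μ / m = μ + 2) (hμν : 0 < ν + (μ + 2)) :
    Tendsto (fun s => exp (ν * s) * logPow m μ f s ^ (1 / m)) atBot (𝓝 0) := by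
  have h := (tendsto_exp_mul_atBot hμν).mul hf.tendsto_comp_exp
  rw [zero_mul] at h
  refine h.congr fun s => ?_
  rw [hf.logPow_rpow hm hμ, ← mul_assoc, ← Real.exp_add, ← add_mul]

lemma tendsto_flux (hf : IsProfile n m β α lam f) {μ ν : ℝ} (hm : m ≠ 0)
    (hμ : μ / m = μ + 2) (hμν : 0 < ν + μ) :
    Tendsto (fun s => exp (ν * s) *
      (logPowDeriv m μ f s - μ * logPow m μ f s + β * logPow m μ f s ^ (1 / m))) atBot (𝓝 0) := by
  have h := ((tendsto_exp_mul_atBot hμν).mul hf.tendsto_mul_deriv_comp_exp).add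
    ((hf.tendsto_mass (ν := ν) hm hμ (by linarith)).const_mul β)
  rw [zero_mul, mul_zero, add_zero] at h
  refine h.congr fun s => ?_
  rw [add_mul, Real.exp_add]
  simp only [logPow, logPowDeriv]
  ring

lemma eventually_logPowDeriv_pos (hf : IsProfile n m β α lam f) {μ : ℝ} (hμ : 0 < μ) :
    ∀ᶠ s in atBot, 0 < logPowDeriv m μ f s := by
  have h0 := hf.pos 0 le_rfl
  have h := hf.tendsto_mul_deriv_comp_exp.add
    ((hf.tendsto_comp_exp.rpow_const (p := m) (Or.inl h0.ne')).const_mul μ)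
  rw [zero_add] at h
  filter_upwards [h.eventually_const_lt (mul_pos hμ (Real.rpow_pos_of_pos h0 m))] with s hs
  exact mul_pos (Real.exp_pos _) hs

end IsProfile

/-- The inequalities on `β` that follow from (C2), in terms of `x = β (n - 2 - n m)` and the
square root `y` appearing in `β₂`. -/
lemma condC2_scalar {m N x y : ℝ} (hm0 : 0 < m) (hm1 : m < 1) (hN : 0 < N) (hN2 : N < 2 * (1 - m))
    (hy0 : 0 ≤ y) (hy : y ^ 2 * N = 2 * (1 - m))
    (h : 2 * N * y < N - 2 * m + 2 * x) :
    1 < y ∧ 1 ≤ x * y := by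
  have hy1 : 1 < y := by
    by_contra! hle
    nlinarith [mul_nonneg hy0 (sub_nonneg.2 hle),
      mul_nonneg hN.le (mul_nonneg hy0 (sub_nonneg.2 hle))]
  refine ⟨hy1, ?_⟩
  by_contra! hlt
  have h1 : y * (2 * N * y) < y * (N - 2 * m + 2 * x) := mul_lt_mul_of_pos_left h (by linarith)
  have h2 : 2 - 4 * m < (N - 2 * m) * y := by nlinarith
  have h3 : y * (2 - 4 * m) < y * ((N - 2 * m) * y) := mul_lt_mul_of_pos_left h2 (by linarith)
  have h4 : 0 < (1 - y) * (1 - m + m * y) := by nlinarith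
  have h5 : 0 < 1 - m + m * y := by nlinarith
  nlinarith

lemma condC2_params {n : ℕ} {m β : ℝ} (hn : 3 ≤ n) (hm0 : 0 < m) (hm1 : m < ((n : ℝ) - 2) / n)
    (hC2 : CondC2 n m β) :
    m < 1 ∧ 0 < (n : ℝ) - 2 - n * m ∧ 0 < β ∧ β * ((n : ℝ) - 2 - n * m) < 1 ∧
      2 * ((n : ℝ) - 2 - n * m) < A0 n m β ∧
      8 * ((n : ℝ) - 2 - n * m) * (1 - m) < A0 n m β ^ 2 ∧ 2 ≤ A0 n m β * β := by
  obtain ⟨h0, h1, hcase⟩ := hC2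
  have hn3 : (3 : ℝ) ≤ n := by exact_mod_cast hn
  rw [lt_div_iff₀ (by linarith)] at hm1
  have hm1' : m < 1 := by nlinarith
  have hA : A0 n m β = ((n : ℝ) - 2 - n * m) - 2 * m + 2 * (β * ((n : ℝ) - 2 - n * m)) := by
    unfold A0; ring
  have hN2 : (n : ℝ) - 2 - n * m < 2 * (1 - m) := by
    have : (n : ℝ) - 4 < m * (n - 2) := by
      rcases hcase with h4 | ⟨-, h4, -⟩
      · have h4' : (n : ℝ) ≤ 4 := by exact_mod_cast h4
        nlinarith
      · rwa [div_lt_iff₀ (by linarith)] at h4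
    linarith
  unfold beta1 at h1
  have h2 : beta2 n m < β := (le_max_left _ _).trans_lt h0
  have hE : betaE n m < β := (le_max_right _ _).trans_lt h0
  unfold beta2 at h2
  unfold betaE at hE
  have hN : 0 < (n : ℝ) - 2 - n * m := by linarith
  set N := (n : ℝ) - 2 - n * m with hNdef
  set y := Real.sqrt (2 * (1 - m) / N) with hydef
  have hβ : 0 < β := (div_pos hm0 hN).trans hE
  have hx1 : β * N < 1 := by rwa [lt_div_iff₀ hN] at h1
  have hy : y ^ 2 * N = 2 * (1 - m) := by
    rw [hydef, Real.sq_sqrt (div_nonneg (by linarith) hN.le)]; field_simp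
  have h3 : 2 * N * y < N - 2 * m + 2 * (β * N) := by
    have e : ((n : ℝ) + 2) * m - (n - 2) = 2 * m - N := by rw [hNdef]; ring
    rw [e] at h2
    have h4 := mul_lt_mul_of_pos_left h2 (by linarith : 0 < 2 * N)
    have e2 : 2 * N * (y + (2 * m - N) / (2 * N)) = 2 * N * y + (2 * m - N) := by field_simp
    rw [e2] at h4
    linarith
  obtain ⟨hy1, hxy⟩ := condC2_scalar hm0 hm1' hN hN2 (Real.sqrt_nonneg _) hy h3
  rw [← hA] at h3
  have hAN : 2 * N < A0 n m β := by nlinarith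
  refine ⟨hm1', hN, hβ, hx1, hAN, ?_, ?_⟩
  · have h5 : (2 * N * y) ^ 2 < A0 n m β ^ 2 := by
      apply pow_lt_pow_left₀ h3 (by positivity) two_ne_zero
    have e : (2 * N * y) ^ 2 = 8 * N * (1 - m) := by linear_combination 4 * N * hy
    linarith
  · have := mul_lt_mul_of_pos_right h3 hβ
    nlinarith

lemma IsProfile.isProfileFlow {n : ℕ} {m β α lam : ℝ} {f : ℝ → ℝ} (hn : 3 ≤ n) (hm0 : 0 < m)
    (hm1 : m < ((n : ℝ) - 2) / n) (hα : α = (2 * β + 1) / (1 - m)) (hC2 : CondC2 n m β)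
    (hf : IsProfile n m β α lam f) {μ ν : ℝ} (hμ : μ = 2 * m / (1 - m)) (hν : ν = n - 2 - μ) :
    IsProfileFlow (1 / m) μ ν β (Cstar n m ^ (m / (1 - m))) (logPow m μ f)
      (logPowDeriv m μ f) := by
  obtain ⟨hm, hN, hβ, hx, hA1, hA2, hA3⟩ := condC2_params hn hm0 hm1 hC2
  have h1m : 0 < 1 - m := by linarith
  have hC : 0 < Cstar n m := div_pos (mul_pos (by linarith) hN) h1m
  have hμ0 : 0 < μ := by rw [hμ]; positivity
  have hμ' : μ / m = μ + 2 := by rw [hμ]; field_simp; ring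
  have hμq : μ * (1 / m) = 2 / (1 - m) := by rw [hμ]; field_simp
  have hν' : ν = ((n : ℝ) - 2 - n * m) / (1 - m) := by rw [hν, hμ]; field_simp; ring
  have hA : ν - μ + 2 * β * ν = A0 n m β / (1 - m) := by
    rw [hν', hμ]; unfold A0; field_simp; ring
  have hn3 : (3 : ℝ) ≤ n := by exact_mod_cast hn
  have hν0 : 0 < ν := by rw [hν']; positivity
  refine ⟨hμ0, ?_, hν0, hβ, ?_, ?_, ?_, ?_, Real.rpow_pos_of_pos hC _, ?_, hf.logPow_pos μ,
    hf.hasDerivAt_logPow μ, hf.hasDerivAt_logPowDeriv hm0.ne' hμ' hν ?_,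
    hf.tendsto_logPow hm hμ hC, hf.tendsto_flux hm0.ne' hμ' (by linarith),
    hf.tendsto_mass hm0.ne' hμ' (by linarith), hf.eventually_logPowDeriv_pos hμ0⟩
  · rw [mul_sub, hμq, hμ]; field_simp
  · rw [hμq, hν', ← mul_div_assoc, div_lt_iff₀ h1m]
    field_simp
    linarith
  · rw [hA, hν', ← mul_div_assoc]
    exact div_lt_div_of_pos_right hA1 h1m
  · rw [hA, hν', div_pow, ← mul_div_assoc, div_lt_div_iff₀ h1m (by positivity)]
    nlinarith
  · rw [hA, hμq, div_mul_eq_mul_div]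
    exact div_le_div_of_nonneg_right hA3 h1m.le
  · rw [← Real.rpow_mul hC.le]
    have : m / (1 - m) * (1 / m - 1) = 1 := by field_simp
    rw [this, Real.rpow_one, hν']
    unfold Cstar
    field_simp
  · rw [hα, hμ]; field_simp; ring

/-- A function on a half-line that is bounded above and has nonnegative derivative has an
integrable derivative. -/
lemma integrableOn_Ioi_of_bddAbove {D D' : ℝ → ℝ} {a b : ℝ}
    (hD : ∀ r, a ≤ r → HasDerivAt D (D' r) r)
    (hD' : ∀ r, a ≤ r → 0 ≤ D' r) (hb : ∀ r, a ≤ r → D r ≤ b) : IntegrableOn D' (Ioi a) := by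
  have hmono : MonotoneOn D (Ici a) := by
    refine monotoneOn_of_deriv_nonneg (convex_Ici a)
      (fun r hr => (hD r hr).continuousAt.continuousWithinAt)
      (fun r hr => (hD r (interior_subset hr)).differentiableAt.differentiableWithinAt)
      fun r hr => ?_
    rw [(hD r (interior_subset hr)).deriv]
    exact hD' r (interior_subset hr)
  have hmono' : Monotone fun r => D (max a r) := fun r s hrs =>
    hmono (le_max_left a r) (le_max_left a s) (max_le_max le_rfl hrs)
  have hlim := tendsto_atTop_ciSup hmono' ⟨b, by rintro _ ⟨r, rfl⟩; exact hb _ (le_max_left a r)⟩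
  refine integrableOn_Ioi_deriv_of_nonneg (hD a le_rfl).continuousAt.continuousWithinAt
    (fun r hr => hD r (le_of_lt hr)) (fun r hr => hD' r (le_of_lt hr)) (hlim.congr' ?_)
  filter_upwards [Ici_mem_atTop a] with r hr
  rw [max_eq_right hr]

lemma IsProfile.mul_rpow_eq {n : ℕ} {m β α lam μ r : ℝ} {f : ℝ → ℝ → ℝ}
    (hf : IsProfile n m β α 1 (f 1)) (hm : m ≠ 0) (hμ : μ / m = μ + 2)
    (hμ2 : 2 / (1 - m) = μ + 2) (hlam : 0 < lam) (hr : 0 < r)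
    (hscale : f lam r = lam ^ (2 / (1 - m)) * f 1 (lam * r)) :
    f lam r * r ^ (μ + 2) = logPow m μ (f 1) (log (lam * r)) ^ (1 / m) := by
  have hlr : 0 < lam * r := mul_pos hlam hr
  rw [hf.logPow_rpow hm hμ, Real.exp_log hlr, hscale, hμ2, mul_comm (μ + 2),
    Real.exp_mul, Real.exp_log hlr, Real.mul_rpow hlam.le hr.le]
  ring

/-- Up to the factor `-1 / (α - n β)`, the mass in a ball of the difference of two profiles is the
difference of their fluxes. -/
lemma IsProfileFlow.hasDerivAt_flux_sub {q μ ν β z : ℝ} {h p : ℝ → ℝ}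
    (F : IsProfileFlow q μ ν β z h p) {lam1 lam2 r : ℝ} (h1 : 0 < lam1) (h2 : 0 < lam2)
    (hr : 0 < r) :
    let Q := fun s => p s - μ * h s + β * h s ^ q
    HasDerivAt (fun r => -(1 / (μ * q / 2 - β * ν)) * (r ^ ν *
        (Q (Real.log (lam1 * r)) - Q (Real.log (lam2 * r)))))
      (r ^ (ν - 1) * (h (Real.log (lam1 * r)) ^ q - h (Real.log (lam2 * r)) ^ q)) r := by
  intro Q
  have hQ : ∀ lam : ℝ, 0 < lam → HasDerivAt (fun r => Q (Real.log (lam * r)))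
      ((-ν * Q (Real.log (lam * r)) - (μ * q / 2 - β * ν) * h (Real.log (lam * r)) ^ q) * r⁻¹)
      r := by
    intro lam hlam
    have hlog : HasDerivAt (fun r => Real.log (lam * r)) r⁻¹ r := by
      refine (((hasDerivAt_id r).const_mul lam).log (mul_pos hlam hr).ne').congr_deriv ?_
      simp only [id]
      field_simp
    exact (F.hasDerivAt_flux (Real.log (lam * r))).comp r hlog
  have hδ : μ * q / 2 - β * ν ≠ 0 := by linarith [F.hδ]
  refine (((Real.hasDerivAt_rpow_const (Or.inl hr.ne')).mul
    ((hQ lam1 h1).sub (hQ lam2 h2))).const_mul _).congr_deriv ?_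
  simp only [Pi.sub_apply]
  rw [Real.rpow_sub_one hr.ne']
  generalize μ * q / 2 - β * ν = δ at hδ ⊢
  field_simp
  ring

/-- Case (C2): the profiles are eventually reversely ordered, and the difference of two
profiles is integrable on `ℝ^n`. -/
theorem profiles_reverse_monotone_integrable_C2 (n : ℕ) (m β α : ℝ) (hn : 3 ≤ n) (hm0 : 0 < m)
    (hm1 : m < ((n : ℝ) - 2) / n) (hα : α = (2 * β + 1) / (1 - m)) (hC2 : CondC2 n m β)
    (f : ℝ → ℝ → ℝ) (hf : ∀ lam, 0 < lam → IsProfile n m β α lam (f lam))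
    (hscale : ∀ lam, 0 < lam → ∀ r, 0 ≤ r → f lam r = lam ^ (2 / (1 - m)) * f 1 (lam * r)) :
    (∃ R0 : ℝ, 0 < R0 ∧ ∀ lam1 lam2 : ℝ, 0 < lam1 → lam1 < lam2 →
      ∀ r, R0 / lam1 ≤ r → f lam2 r < f lam1 r) ∧
    ∀ lam1 lam2 : ℝ, 0 < lam1 → lam1 < lam2 →
      Integrable (fun x : EuclideanSpace ℝ (Fin n) => f lam1 ‖x‖ - f lam2 ‖x‖) := by
  have hf1 := hf 1 one_pos
  obtain ⟨hm, -, -, -, -, -, -⟩ := condC2_params hn hm0 hm1 hC2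
  have h1m : 1 - m ≠ 0 := by linarith
  obtain ⟨μ, hμ⟩ : ∃ μ, μ = 2 * m / (1 - m) := ⟨_, rfl⟩
  obtain ⟨ν, hν⟩ : ∃ ν, ν = (n : ℝ) - 2 - μ := ⟨_, rfl⟩
  have hμ' : μ / m = μ + 2 := by rw [hμ]; field_simp; ring
  have hμ2 : 2 / (1 - m) = μ + 2 := by rw [hμ]; field_simp; ring
  have F := hf1.isProfileFlow hn hm0 hm1 hα hC2 hμ hν
  have hg : ∀ lam, 0 < lam → ∀ r, 0 < r → f lam r * r ^ (μ + 2) =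
      IsProfile.logPow m μ (f 1) (Real.log (lam * r)) ^ (1 / m) := fun lam hlam r hr =>
    hf1.mul_rpow_eq hm0.ne' hμ' hμ2 hlam hr (hscale lam hlam r hr.le)
  obtain ⟨s₀, hs₀⟩ := F.exists_strictAntiOn
  have horder : ∀ lam1 lam2 : ℝ, 0 < lam1 → lam1 < lam2 →
      ∀ r, Real.exp s₀ / lam1 ≤ r → f lam2 r < f lam1 r := by
    intro lam1 lam2 h1 h12 r hr
    have hr0 : 0 < r := (div_pos (Real.exp_pos s₀) h1).trans_le hr
    rw [div_le_iff₀ h1, mul_comm] at hr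
    have hl1 : s₀ ≤ Real.log (lam1 * r) := (Real.le_log_iff_exp_le (mul_pos h1 hr0)).2 hr
    have hl2 : Real.log (lam1 * r) < Real.log (lam2 * r) :=
      Real.log_lt_log (mul_pos h1 hr0) (mul_lt_mul_of_pos_right h12 hr0)
    refine lt_of_mul_lt_mul_right ?_ (Real.rpow_nonneg hr0.le (μ + 2))
    rw [hg lam1 h1 r hr0, hg lam2 (h1.trans h12) r hr0]
    exact Real.rpow_lt_rpow (F.pos _).le (hs₀ hl1 (hl1.trans hl2.le) hl2) (by positivity)
  refine ⟨⟨Real.exp s₀, Real.exp_pos s₀, horder⟩, fun lam1 lam2 h1 h12 => ?_⟩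
  have h2 := h1.trans h12
  have : NeZero n := ⟨by omega⟩
  refine (integrable_fun_norm_addHaar volume (f := fun r => f lam1 r - f lam2 r)).2 ?_
  rw [finrank_euclideanSpace_fin]
  set R := Real.exp s₀ / lam1
  have hR : 0 < R := div_pos (Real.exp_pos s₀) h1
  rw [← Ioc_union_Ioi_eq_Ioi hR.le]
  refine IntegrableOn.union ?_ ?_
  · refine (ContinuousOn.integrableOn_Icc ?_).mono_set Ioc_subset_Icc_self
    exact (continuousOn_pow _).smul ((((hf lam1 h1).smooth.continuousOn).sub
      ((hf lam2 h2).smooth.continuousOn)).mono Icc_subset_Ici_self)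
  · have hderiv : ∀ r, R ≤ r → r ^ (ν - 1) *
        (IsProfile.logPow m μ (f 1) (Real.log (lam1 * r)) ^ (1 / m) -
          IsProfile.logPow m μ (f 1) (Real.log (lam2 * r)) ^ (1 / m)) =
        r ^ (n - 1) • (f lam1 r - f lam2 r) := by
      intro r hr
      have hr0 := hR.trans_le hr
      rw [← hg lam1 h1 r hr0, ← hg lam2 h2 r hr0, ← sub_mul, mul_comm (f lam1 r - f lam2 r),
        ← mul_assoc, ← Real.rpow_add hr0, smul_eq_mul, ← Real.rpow_natCast, Nat.cast_pred (by omega)]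
      congr 2
      rw [hν]
      ring
    refine integrableOn_Ioi_of_bddAbove (b := 0) (fun r hr => (F.hasDerivAt_flux_sub h1 h2
      (hR.trans_le hr)).congr_deriv (hderiv r hr)) (fun r hr => ?_) fun r hr => ?_
    · exact mul_nonneg (pow_nonneg (hR.le.trans hr) _)
        (sub_nonneg.2 (horder lam1 lam2 h1 h12 r hr).le)
    · have hr0 := hR.trans_le hr
      have hδ := F.hδ
      refine mul_nonpos_of_nonpos_of_nonneg
        (neg_nonpos.2 (one_div_nonneg.2 (by linarith)))
        (mul_nonneg (Real.rpow_nonneg hr0.le ν) (sub_nonneg.2 (F.antitone_flux ?_)))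
      exact Real.log_le_log (mul_pos h1 hr0) (mul_le_mul_of_nonneg_right h12.le hr0.le)
end

section
/- Suppose condition (C3) holds. Then for all λ_2 > λ_1 > 0 the self-similar profiles satisfy f_{λ_1}(r) < f_{λ_2}(r) for every r ≥ 0, and the radial function x ↦ f_{λ_1}(|x|) − f_{λ_2}(|x|) is Lebesgue integrable on ℝ^n. -/
open Real Filter MeasureTheory Set Topology

/-- A function continuous on `[0, ∞)` with vanishing derivative on `(0, ∞)` is constant. -/
theorem eq_zero_value_of_hasDerivAt_zero {F : ℝ → ℝ} (hc : ContinuousOn F (Ici 0))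
    (hd : ∀ r, 0 < r → HasDerivAt F 0 r) {r : ℝ} (hr : 0 ≤ r) : F r = F 0 := by
  rcases hr.eq_or_lt with rfl | hr
  · rfl
  obtain ⟨c, -, hc'⟩ := exists_hasDerivAt_eq_slope F (fun _ => 0) hr
    (hc.mono Icc_subset_Ici_self) (fun x hx => hd x hx.1)
  have := (div_eq_zero_iff.mp hc'.symm).resolve_right (by linarith)
  linarith

theorem hasDerivAt_deriv_of_contDiffOn_Ici {g : ℝ → ℝ} (hg : ContDiffOn ℝ 2 g (Ici 0)) {r : ℝ}
    (hr : 0 < r) : HasDerivAt (deriv g) (deriv (deriv g) r) r := by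
  have h : ContDiffOn ℝ (1 + 1) g (Ioi 0) := by
    rw [one_add_one_eq_two]
    exact hg.mono Ioi_subset_Ici_self
  have h1 := ((contDiffOn_succ_iff_deriv_of_isOpen isOpen_Ioi).mp h).2.2
  exact ((h1.differentiableOn one_ne_zero).differentiableAt (Ioi_mem_nhds hr)).hasDerivAt

/-- In divergence form (`α = n β`) the profile equation integrates once. -/
theorem IsProfile.deriv_rpow_eq {n : ℕ} {m β lam : ℝ} {f : ℝ → ℝ} (hn : 2 ≤ n)
    (hf : IsProfile n m β (n * β) lam f) {r : ℝ} (hr : 0 < r) :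
    deriv (fun s => f s ^ m) r = -(β * r * f r) := by
  set g : ℝ → ℝ := fun s => f s ^ m with hg_def
  have hg : ContDiffOn ℝ 2 g (Ici 0) :=
    hf.smooth.rpow_const_of_ne fun x hx => (hf.pos x hx).ne'
  obtain ⟨k, rfl⟩ : ∃ k, n = k + 2 := ⟨n - 2, by omega⟩
  have heq : ∀ s, 0 < s → derivWithin g (Ici 0) s = deriv g s := fun s hs =>
    derivWithin_of_mem_nhds (Ici_mem_nhds hs)
  set F : ℝ → ℝ := fun s => s ^ (k + 1) * derivWithin g (Ici 0) s + β * s ^ (k + 2) * f s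
    with hF
  have hc : ContinuousOn F (Ici 0) := by
    have h1 := hg.continuousOn_derivWithin (uniqueDiffOn_Ici 0) (by norm_num)
    have h2 := hf.smooth.continuousOn
    fun_prop
  have hd : ∀ s, 0 < s → HasDerivAt F 0 s := by
    intro s hs
    have h1 : HasDerivAt (derivWithin g (Ici 0)) (deriv (deriv g) s) s :=
      (hasDerivAt_deriv_of_contDiffOn_Ici hg hs).congr_of_eventuallyEq
        ((eventually_gt_nhds hs).mono heq)
    have h2 : HasDerivAt f (deriv f s) s :=
      ((hf.smooth.differentiableOn two_ne_zero).differentiableAt (Ici_mem_nhds hs)).hasDerivAt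
    have h3 := ((hasDerivAt_pow (k + 1) s).mul h1).add
      (((hasDerivAt_pow (k + 2) s).const_mul β).mul h2)
    refine h3.congr_deriv ?_
    have ho := hf.ode s hs
    rw [heq s hs]
    have hs' := hs.ne'
    have : s ^ (k + 1) * (deriv (deriv g) s + ((((k + 2 : ℕ) : ℝ) - 1) / s) * deriv g s +
      ((k + 2 : ℕ) : ℝ) * β * f s + β * s * deriv f s) = 0 := by
      rw [ho, mul_zero]
    rw [← this]
    simp only [Nat.add_sub_cancel, Nat.add_succ_sub_one]
    push_cast
    field_simp
    ring
  have h0 := eq_zero_value_of_hasDerivAt_zero hc hd hr.le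
  have h00 : F 0 = 0 := by simp [hF]
  rw [h00, hF] at h0
  simp only [heq r hr] at h0
  have : r ^ (k + 1) * (deriv g r + β * r * f r) = 0 := by rw [← h0]; ring
  have := (mul_eq_zero.mp this).resolve_left (by positivity)
  linarith

/-- In divergence form the profile is the Barenblatt profile. -/
theorem IsProfile.eq_barenblatt {n : ℕ} {m β lam : ℝ} {f : ℝ → ℝ} (hn : 2 ≤ n) (hm0 : 0 < m)
    (hm1 : m < 1) (hlam : 0 < lam) (hf : IsProfile n m β (n * β) lam f) {r : ℝ} (hr : 0 ≤ r) :
    f r = (lam ^ (-2 : ℝ) + β * (1 - m) / (2 * m) * r ^ 2) ^ (-(1 / (1 - m))) := by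
  have hm : 1 - m ≠ 0 := by linarith
  set F : ℝ → ℝ := fun s => f s ^ (m - 1) - β * (1 - m) / (2 * m) * s ^ 2 with hF
  have hc : ContinuousOn F (Ici 0) := by
    have h1 : ContinuousOn (fun s => f s ^ (m - 1)) (Ici 0) :=
      hf.smooth.continuousOn.rpow_const fun x hx => Or.inl (hf.pos x hx).ne'
    fun_prop
  have hd : ∀ s, 0 < s → HasDerivAt F 0 s := by
    intro s hs
    have hp := hf.pos s hs.le
    have h2 : HasDerivAt f (deriv f s) s :=
      ((hf.smooth.differentiableOn two_ne_zero).differentiableAt (Ici_mem_nhds hs)).hasDerivAt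
    have h3 := (h2.rpow_const (p := m) (Or.inl hp.ne')).deriv
    rw [hf.deriv_rpow_eq hn hs] at h3
    refine ((h2.rpow_const (p := m - 1) (Or.inl hp.ne')).sub
      ((hasDerivAt_pow 2 s).const_mul (β * (1 - m) / (2 * m)))).congr_deriv ?_
    have e : f s ^ (m - 1) = f s ^ (m - 1 - 1) * f s := by
      rw [← Real.rpow_add_one hp.ne']; ring_nf
    rw [e] at h3
    have h4 : β * s = -(deriv f s * m * f s ^ (m - 1 - 1)) :=
      mul_right_cancel₀ hp.ne' (by linarith)
    have h5 : β * (1 - m) / (2 * m) * ((2 : ℕ) * s ^ (2 - 1)) = (1 - m) / m * (β * s) := by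
      field_simp
      push_cast
      ring
    rw [h5, h4]
    field_simp
    ring
  have h0 := eq_zero_value_of_hasDerivAt_zero hc hd hr
  have h00 : F 0 = lam ^ (-2 : ℝ) := by
    simp only [hF, hf.init]
    rw [← Real.rpow_mul hlam.le]
    have : 2 / (1 - m) * (m - 1) = -2 := by field_simp; ring
    rw [this]; ring
  have h1 : lam ^ (-2 : ℝ) + β * (1 - m) / (2 * m) * r ^ 2 = f r ^ (m - 1) := by
    rw [← h00, ← h0]; simp [hF]
  rw [h1, ← Real.rpow_mul (hf.pos r hr).le]
  have : (m - 1) * -(1 / (1 - m)) = 1 := by field_simp; ring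
  rw [this, Real.rpow_one]

theorem rpow_neg_sub_rpow_neg_le {x y p : ℝ} (hx : 0 < x) (hy : 0 < y) (hp : 0 ≤ p) :
    x ^ (-p) - y ^ (-p) ≤ p * (y - x) * x ^ (-(p + 1)) := by
  have h1 : y ^ (-p) = x ^ (-p) * (y / x) ^ (-p) := by
    rw [← Real.mul_rpow hx.le (by positivity), mul_div_cancel₀ _ hx.ne']
  have h2 : 1 - p * (y / x - 1) ≤ (y / x) ^ (-p) := by
    rw [Real.rpow_def_of_pos (by positivity)]
    have h3 := Real.add_one_le_exp (Real.log (y / x) * -p)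
    have h4 := mul_le_mul_of_nonneg_left
      (Real.log_le_sub_one_of_pos (show 0 < y / x by positivity)) hp
    linarith
  have h5 : x ^ (-(p + 1)) = x ^ (-p) / x := by
    rw [neg_add', Real.rpow_sub_one hx.ne']
  have h6 := mul_le_mul_of_nonneg_left h2 (Real.rpow_nonneg hx.le (-p))
  have h7 : p * (y - x) * x ^ (-(p + 1)) = x ^ (-p) - x ^ (-p) * (1 - p * (y / x - 1)) := by
    rw [h5]; field_simp; ring
  rw [h1, h7]
  linarith

/-- The difference of two Barenblatt-type profiles is integrable once its decay exponent
`2 (p + 1)` exceeds the dimension. -/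
theorem integrable_barenblatt_sub {E : Type*} [NormedAddCommGroup E] [NormedSpace ℝ E]
    [FiniteDimensional ℝ E] [MeasurableSpace E] [BorelSpace E] (μ : Measure E)
    [μ.IsAddHaarMeasure] {a b c p : ℝ} (hb : 0 < b) (hba : b ≤ a) (hc : 0 < c) (hp : 0 ≤ p)
    (hdim : (Module.finrank ℝ E : ℝ) < 2 * (p + 1)) :
    Integrable (fun x : E => (a + c * ‖x‖ ^ 2) ^ (-p) - (b + c * ‖x‖ ^ 2) ^ (-p)) μ := by
  have ha : 0 < a := hb.trans_le hba
  have hcont : ∀ e, 0 < e → Continuous fun x : E => (e + c * ‖x‖ ^ 2) ^ (-p) := fun e he =>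
    Continuous.rpow_const (by fun_prop) fun x => Or.inl (by positivity)
  set d := min b c with hd_def
  have hd : 0 < d := lt_min hb hc
  have hI := (integrable_rpow_neg_one_add_norm_sq (μ := μ) hdim).const_mul
    (p * (a - b) * d ^ (-(p + 1)))
  refine hI.mono' ((hcont a ha).sub (hcont b hb)).aestronglyMeasurable (.of_forall fun x => ?_)
  have hX : 0 < b + c * ‖x‖ ^ 2 := by positivity
  have hle : b + c * ‖x‖ ^ 2 ≤ a + c * ‖x‖ ^ 2 := by linarith
  have h1 := Real.rpow_le_rpow_of_nonpos hX hle (neg_nonpos.mpr hp)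
  have h2 := rpow_neg_sub_rpow_neg_le hX (hX.trans_le hle) hp
  have h3 : d * (1 + ‖x‖ ^ 2) ≤ b + c * ‖x‖ ^ 2 := by
    nlinarith [min_le_left b c, min_le_right b c, sq_nonneg ‖x‖]
  have h4 := Real.rpow_le_rpow_of_nonpos (by positivity) h3 (show -(p + 1) ≤ 0 by linarith)
  rw [Real.mul_rpow hd.le (by positivity)] at h4
  have h5 : -(2 * (p + 1)) / 2 = -(p + 1) := by ring
  rw [Real.norm_eq_abs, abs_of_nonpos (by linarith), h5, neg_sub]
  have h6 := mul_le_mul_of_nonneg_left h4 (mul_nonneg hp (sub_nonneg.mpr hba))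
  have h7 : a + c * ‖x‖ ^ 2 - (b + c * ‖x‖ ^ 2) = a - b := by ring
  rw [h7] at h2
  linarith

/-- Case (C3): the profiles are monotone increasing in `λ` and the difference of two
profiles is integrable on `ℝ^n`. -/
theorem profiles_monotone_integrable_C3 (n : ℕ) (m β α : ℝ) (hn : 3 ≤ n) (hm0 : 0 < m)
    (hm1 : m < ((n : ℝ) - 2) / n) (hα : α = (2 * β + 1) / (1 - m)) (hC3 : CondC3 n m β)
    (f : ℝ → ℝ → ℝ) (hf : ∀ lam, 0 < lam → IsProfile n m β α lam (f lam))
    (hscale : ∀ lam, 0 < lam → ∀ r, 0 ≤ r → f lam r = lam ^ (2 / (1 - m)) * f 1 (lam * r)) :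
    ∀ lam1 lam2 : ℝ, 0 < lam1 → lam1 < lam2 →
      (∀ r, 0 ≤ r → f lam1 r < f lam2 r) ∧
      Integrable (fun x : EuclideanSpace ℝ (Fin n) => f lam1 ‖x‖ - f lam2 ‖x‖) := by
  intro lam1 lam2 h1 h12
  have h2 : 0 < lam2 := h1.trans h12
  have hn' : (3 : ℝ) ≤ n := by exact_mod_cast hn
  have hnm : 0 < (n : ℝ) - 2 - n * m := by
    rw [lt_div_iff₀ (by linarith)] at hm1
    linarith
  have hm : m < 1 := by nlinarith
  have hm' : 0 < 1 - m := by linarith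
  obtain ⟨hβ, hcase⟩ := hC3
  have hβ0 : 0 < β := by rw [hβ, beta1]; positivity
  have hαβ : α = n * β := by
    rw [hα, hβ, beta1]
    field_simp
    ring
  subst hαβ
  set c := β * (1 - m) / (2 * m) with hc_def
  have hc : 0 < c := by positivity
  have hp : 0 < 1 / (1 - m) := by positivity
  have hdim : (n : ℝ) < 2 * (1 / (1 - m) + 1) := by
    suffices ((n : ℝ) - 2) * (1 - m) < 2 by
      have := (lt_div_iff₀ hm').mpr this
      have e : 2 / (1 - m) = 2 * (1 / (1 - m)) := by ring
      linarith
    rcases hcase with h4 | ⟨h4, h5, -⟩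
    · have : (n : ℝ) ≤ 4 := by exact_mod_cast h4
      nlinarith
    · rw [div_lt_iff₀ (by linarith)] at h5
      linarith
  have hf1 : ∀ r, 0 ≤ r → f lam1 r = (lam1 ^ (-2 : ℝ) + c * r ^ 2) ^ (-(1 / (1 - m))) :=
    fun r hr => (hf lam1 h1).eq_barenblatt (by omega) hm0 hm h1 hr
  have hf2 : ∀ r, 0 ≤ r → f lam2 r = (lam2 ^ (-2 : ℝ) + c * r ^ 2) ^ (-(1 / (1 - m))) :=
    fun r hr => (hf lam2 h2).eq_barenblatt (by omega) hm0 hm h2 hr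
  have hlt : lam2 ^ (-2 : ℝ) < lam1 ^ (-2 : ℝ) :=
    Real.rpow_lt_rpow_of_neg h1 h12 (by norm_num)
  have hb : 0 < lam2 ^ (-2 : ℝ) := by positivity
  refine ⟨fun r hr => ?_, ?_⟩
  · rw [hf1 r hr, hf2 r hr]
    exact Real.rpow_lt_rpow_of_neg (by positivity) (by linarith) (by linarith)
  · simp only [hf1 _ (norm_nonneg _), hf2 _ (norm_nonneg _)]
    exact integrable_barenblatt_sub volume hb hlt.le hc hp.le
      (by rwa [finrank_euclideanSpace_fin])
end

section
/- Suppose condition (C2) holds, λ_2 > λ_1 > 0, λ_0 > 0, and u_0 satisfies 0 ≤ u_0 ≤ min(U_{λ_1}(·,0), U_{λ_2}(·,0)) on ℝ^n and u_0 − U_{λ_0}(·,0) ∈ L¹(ℝ^n). Let u be the solution of the Cauchy problem u_t = Δ(u^m) in ℝ^n × (0,T) with initial value u_0 satisfying the Aronson–Bénilan inequality u_t ≤ u/((1−m)t) and 0 < u ≤ min(U_{λ_1}, U_{λ_2}) on ℝ^n × (0,T). Then the rescaled solution ũ(·,τ) converges to zero uniformly on every compact subset of ℝ^n as τ → ∞.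 -/
open Real Filter MeasureTheory Set Topology

lemma params_discriminant {d k β : ℝ} (hd : 0 < d) (hd2 : d < 2) (hk : 0 < k) (hβ : 0 < β)
    (hB : 2 * d * √(2 / d) < d - k + 2 * d * β) :
    8 * d < (d - k + 2 * d * β) ^ 2 ∧ 2 + k ≤ β * (d - k + 2 * d * β) := by
  set w := √(2 / d) with hw
  have hw2 : w ^ 2 = 2 / d := Real.sq_sqrt (by positivity)
  have hdw : d * w ^ 2 = 2 := by rw [hw2]; field_simp
  have hw0 : 0 < w := Real.sqrt_pos.2 (by positivity)
  have hw1 : 1 < w := by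
    by_contra! h
    nlinarith [mul_pos hd hw0]
  set B := d - k + 2 * d * β with hBdef
  have hB0 : 0 < 2 * d * w := by positivity
  constructor
  · nlinarith [mul_pos hd hw0]
  · by_contra! h
    have h1 : β * (2 * d * w) < 2 + k := lt_of_le_of_lt (by gcongr) h
    have h2 : 2 * d * w * w ^ 2 < (d - k) * w ^ 2 + w * (2 + k) := by nlinarith [mul_pos hw0 hw0]
    nlinarith [mul_pos (sub_pos.2 hw1) (by positivity : (0 : ℝ) < 2 + k * w)]

/-- At the first time a function reaches zero from positive values its derivative is
nonpositive. -/
lemma deriv_nonpos_of_pos_left {g : ℝ → ℝ} {g' s : ℝ} (hg : HasDerivAt g g' s) (h0 : g s ≤ 0)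
    (hpos : ∀ᶠ σ in 𝓝[<] s, 0 < g σ) : g' ≤ 0 := by
  have h1 := hasDerivWithinAt_iff_tendsto_slope' (self_notMem_Iio (a := s)) |>.1
    (hg.hasDerivWithinAt (s := Iio s))
  refine le_of_tendsto h1 ?_
  filter_upwards [hpos, self_mem_nhdsWithin] with σ hσ hσs
  rw [slope_def_field]
  exact div_nonpos_of_nonneg_of_nonpos (by linarith) (by linarith [mem_Iio.1 hσs])

/-- A continuous function that is nonpositive somewhere to the right of a point where it is
positive has a first point of nonpositivity. -/
lemma exists_first_nonpos {g : ℝ → ℝ} (hg : Continuous g) {a s : ℝ} (has : a ≤ s) (ha : 0 < g a)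
    (hs : g s ≤ 0) : ∃ c, a < c ∧ c ≤ s ∧ g c ≤ 0 ∧ ∀ σ, a ≤ σ → σ < c → 0 < g σ := by
  have hcl : IsCompact (Icc a s ∩ {σ | g σ ≤ 0}) :=
    isCompact_Icc.inter_right (isClosed_le hg continuous_const)
  obtain ⟨c, ⟨⟨hac, hcs⟩, hgc⟩, hmin⟩ := hcl.exists_isLeast ⟨s, ⟨has, le_rfl⟩, hs⟩
  refine ⟨c, lt_of_le_of_ne hac ?_, hcs, hgc, fun σ h1 h2 => ?_⟩
  · rintro rfl
    exact absurd hgc (not_le.2 ha)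
  · by_contra! h
    exact absurd (hmin ⟨⟨h1, h2.le.trans hcs⟩, h⟩) (not_le.2 h2)

/-- Tangent line inequality for powers. -/
lemma rpow_sub_rpow_le {Q x y : ℝ} (hQ : 1 ≤ Q) (hx : 0 < x) (hy : 0 < y) :
    x ^ Q - y ^ Q ≤ Q * x ^ (Q - 1) * (x - y) := by
  have h := one_add_mul_self_le_rpow_one_add (s := y / x - 1) (by
    have : 0 < y / x := by positivity
    linarith) hQ
  rw [add_sub_cancel, Real.div_rpow hy.le hx.le, le_div_iff₀ (by positivity)] at h
  have h2 : x ^ Q = x ^ (Q - 1) * x := by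
    rw [← Real.rpow_add_one hx.ne']; congr 1; ring
  have h3 : (1 + Q * (y / x - 1)) * x ^ Q = x ^ Q + Q * x ^ (Q - 1) * (y - x) := by
    rw [h2]; field_simp
  linarith

set_option maxHeartbeats 1000000 in
/-- Trajectories of the Emden–Fowler type equation satisfied by `s ↦ e^{ks} f(e^s)^m`. They leave
the origin, overshoot the positive equilibrium `xs`, and come back to it monotonically. -/
lemma trajectory_eventually_strictAnti {d k β xs Q : ℝ} (hd : 0 < d) (hd2 : d < 2) (hk : 0 < k)
    (hQ : Q = 1 + 2 / k) (hβ1 : β < (1 + k / 2) / d)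
    (hdisc : 8 * d < (d - k + 2 * d * β) ^ 2) (hprod : 2 + k ≤ β * (d - k + 2 * d * β))
    (hxs0 : 0 < xs) (hxs : (1 + k / 2) * xs ^ (Q - 1) = k * d)
    {x p : ℝ → ℝ} (hxpos : ∀ s, 0 < x s) (hx : ∀ s, HasDerivAt x (p s) s)
    (hp : ∀ s, HasDerivAt p (-(d - k) * p s + k * d * x s - (1 + k / 2) * x s ^ Q
      - β * (Q * x s ^ (Q - 1) * p s)) s)
    (hp0 : ∀ᶠ s in atBot, 0 < p s) (hx0 : Tendsto x atBot (𝓝 0))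
    (hN0 : Tendsto (fun s => exp (d * s) * (p s - k * x s + (1 + k / 2) / d * x s ^ Q)) atBot (𝓝 0))
    (hxlim : Tendsto x atTop (𝓝 xs)) : ∃ S, StrictAntiOn x (Ici S) := by
  have hxc : Continuous x := continuous_iff_continuousAt.2 fun s => (hx s).continuousAt
  have hpc : Continuous p := continuous_iff_continuousAt.2 fun s => (hp s).continuousAt
  have h2k : 0 < 2 / k := by positivity
  have hQ1 : 1 < Q := by linarith
  have hQ0 : 0 < Q := by linarith
  have hsplit : ∀ y : ℝ, 0 < y → y ^ Q = y ^ (Q - 1) * y := fun y hy => by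
    rw [← Real.rpow_add_one hy.ne']; congr 1; ring
  have hQk : Q * k = k + 2 := by rw [hQ]; field_simp
  set β1 := (1 + k / 2) / d with hβ1def
  have hβ1d : β1 * d = 1 + k / 2 := by rw [hβ1def]; field_simp
  have hβ1xs : β1 * xs ^ (Q - 1) = k := by
    have : β1 * xs ^ (Q - 1) * d = k * d := by rw [← hxs, ← hβ1d]; ring
    exact mul_right_cancel₀ hd.ne' this
  have hβ1pos : 0 < β1 := by positivity
  set N : ℝ → ℝ := fun s => exp (d * s) * (p s - k * x s + β1 * x s ^ Q) with hN
  have hNder : ∀ s, HasDerivAt N ((β1 - β) * exp (d * s) * (Q * x s ^ (Q - 1) * p s)) s := by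
    intro s
    have h1 : HasDerivAt (fun s => exp (d * s)) (exp (d * s) * d) s := by
      simpa using ((hasDerivAt_id s).const_mul d).exp
    have h2 := (hx s).rpow_const (p := Q) (Or.inl (hxpos s).ne')
    have h3 := h1.mul (((hp s).sub ((hx s).const_mul k)).add (h2.const_mul β1))
    refine h3.congr_deriv ?_
    simp only [Pi.sub_apply, Pi.add_apply]
    linear_combination exp (d * s) * x s ^ Q * hβ1d
  have hF : ∀ y, 0 < y → y ≤ xs → 0 ≤ k * y - β1 * y ^ Q := by
    intro y hy hyx
    have h1 : y ^ (Q - 1) ≤ xs ^ (Q - 1) := Real.rpow_le_rpow hy.le hyx (by linarith)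
    rw [hsplit y hy]
    have h2 : β1 * y ^ (Q - 1) ≤ k := by rw [← hβ1xs]; gcongr
    nlinarith
  have hpN : ∀ s, p s = exp (-(d * s)) * N s + (k * x s - β1 * x s ^ Q) := by
    intro s
    have : exp (-(d * s)) * N s = p s - k * x s + β1 * x s ^ Q := by
      rw [hN]; simp only; rw [← mul_assoc, ← Real.exp_add]; simp
    linarith
  -- positivity of `N` as long as `p` stays positive
  have hNpos : ∀ s, (∀ σ < s, 0 < p σ) → 0 < N s := by
    intro s hs
    have hmono : StrictMonoOn N (Iic s) := by
      refine strictMonoOn_of_hasDerivWithinAt_pos (convex_Iic s)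
        (fun σ _ => (hNder σ).continuousAt.continuousWithinAt)
        (fun σ _ => (hNder σ).hasDerivWithinAt) ?_
      intro σ hσ
      rw [interior_Iic] at hσ
      have := hs σ hσ
      have := hxpos σ
      have := sub_pos.2 hβ1
      positivity
    have h1 : 0 ≤ N (s - 1) := by
      refine le_of_tendsto hN0 ?_
      filter_upwards [eventually_le_atBot (s - 1)] with t ht
      exact hmono.monotoneOn (mem_Iic.2 (by linarith)) (mem_Iic.2 (by linarith)) ht
    exact h1.trans_lt (hmono (by simp) (by simp) (by linarith))
  -- below the equilibrium the trajectory increases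
  have hinc : ∀ s, (∀ σ ≤ s, x σ ≤ xs) → ∀ σ ≤ s, 0 < p σ := by
    intro s hs σ hσ
    by_contra! hneg
    obtain ⟨a, ha⟩ := (eventually_atBot.1 hp0)
    have haσ : a ≤ σ := by
      by_contra! h
      exact absurd (ha σ h.le) (not_lt.2 hneg)
    obtain ⟨c, hac, hcσ, hpc0, hc⟩ := exists_first_nonpos hpc haσ (ha a le_rfl) hneg
    have h1 := hNpos c fun t ht => by
      rcases le_total a t with h | h
      · exact hc t h ht
      · exact ha t h
    have h2 := hF (x c) (hxpos c) (hs c (hcσ.trans hσ))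
    have h3 := hpN c
    have : 0 < exp (-(d * c)) * N c := by positivity
    linarith
  -- the trajectory reaches the equilibrium
  have hreach : ∃ s, xs ≤ x s := by
    by_contra! hlt
    have hppos : ∀ s, 0 < p s := fun s => hinc s (fun σ _ => (hlt σ).le) s le_rfl
    have hNmono : StrictMono N := strictMono_of_hasDerivAt_pos hNder fun s => by
      have := hppos s
      have := hxpos s
      have := sub_pos.2 hβ1
      positivity
    have hc0 : 0 < N 0 := hNpos 0 fun σ _ => hppos σ
    set e := (2 + d) / 2 with he
    have hFd : HasDerivAt (fun y => k * y - β1 * y ^ Q) (-2) xs := by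
      have h1 := ((hasDerivAt_id xs).const_mul k).sub
        (((hasDerivAt_id xs).rpow_const (p := Q) (Or.inl hxs0.ne')).const_mul β1)
      refine h1.congr_deriv ?_
      simp only [id]
      linear_combination -Q * hβ1xs - hQk
    have hFxs : k * xs - β1 * xs ^ Q = 0 := by
      rw [hsplit xs hxs0]; linear_combination -xs * hβ1xs
    have hFlow : ∀ᶠ y in 𝓝 xs, y < xs → e * (xs - y) ≤ k * y - β1 * y ^ Q := by
      have h1 := (hasDerivAt_iff_isLittleO.1 hFd).def (c := 2 - e) (by rw [he]; linarith)
      filter_upwards [h1] with y hy hyx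
      rw [hFxs, Real.norm_eq_abs, Real.norm_eq_abs, abs_of_neg (a := y - xs) (by linarith)] at hy
      have := (abs_le.1 hy).1
      simp only [smul_eq_mul] at this
      linarith
    obtain ⟨S0, hS0⟩ := eventually_atTop.1 (hxlim.eventually hFlow)
    set S1 := max S0 0 with hS1
    have hanti : AntitoneOn (fun s => exp (e * s) * (xs - x s) + N 0 * s) (Ici S1) := by
      have hder : ∀ s, HasDerivAt (fun s => exp (e * s) * (xs - x s) + N 0 * s)
          (exp (e * s) * (e * (xs - x s) - p s) + N 0) s := by
        intro s
        have h1 : HasDerivAt (fun s => exp (e * s)) (exp (e * s) * e) s := by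
          simpa using ((hasDerivAt_id s).const_mul e).exp
        have h2 := (h1.mul ((hx s).const_sub xs)).add ((hasDerivAt_id s).const_mul (N 0))
        refine h2.congr_deriv ?_
        ring
      refine antitoneOn_of_hasDerivWithinAt_nonpos (convex_Ici S1)
        (fun σ _ => (hder σ).continuousAt.continuousWithinAt)
        (fun σ _ => (hder σ).hasDerivWithinAt) ?_
      intro s hs
      rw [interior_Ici] at hs
      have hs0 : S0 ≤ s := (le_max_left _ _).trans (mem_Ioi.1 hs).le
      have hs1 : 0 ≤ s := (le_max_right _ _).trans (mem_Ioi.1 hs).le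
      have h1 := hS0 s hs0 (hlt s)
      have h2 : N 0 ≤ N s := hNmono.monotone hs1
      have h3 := hpN s
      have h4 : 1 ≤ exp (e * s) * exp (-(d * s)) := by
        rw [← Real.exp_add, Real.one_le_exp_iff]
        have : (e - d) * s = e * s + -(d * s) := by ring
        rw [← this]
        exact mul_nonneg (by rw [he]; linarith) hs1
      have h5 : N 0 ≤ exp (e * s) * (exp (-(d * s)) * N s) := by
        rw [← mul_assoc]
        nlinarith
      have h6 : exp (e * s) * (e * (xs - x s) - p s) ≤
          exp (e * s) * (-(exp (-(d * s)) * N s)) := by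
        gcongr
        linarith
      linarith
    set S2 := S1 + exp (e * S1) * xs / N 0 with hS2
    have hS12 : S1 ≤ S2 := by rw [hS2]; have : 0 ≤ exp (e * S1) * xs / N 0 := by positivity
                              linarith
    have h1 := hanti (mem_Ici.2 le_rfl) (mem_Ici.2 hS12) hS12
    simp only at h1
    have h2 : 0 < exp (e * S2) * (xs - x S2) := mul_pos (exp_pos _) (sub_pos.2 (hlt S2))
    have h3 : N 0 * S2 = N 0 * S1 + exp (e * S1) * xs := by rw [hS2]; field_simp
    have h4 : 0 < exp (e * S1) * x S1 := mul_pos (exp_pos _) (hxpos S1)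
    linarith
  -- first crossing of the equilibrium
  obtain ⟨s0, hs0x, hs0p⟩ : ∃ s0, x s0 = xs ∧ 0 < p s0 := by
    obtain ⟨s, hs⟩ := hreach
    obtain ⟨a, ha⟩ := eventually_atBot.1 (hx0.eventually (gt_mem_nhds hxs0))
    have has : a ≤ s := by
      by_contra! h
      exact absurd (ha s h.le) (not_lt.2 hs)
    obtain ⟨c, hac, -, hc0, hc⟩ := exists_first_nonpos (continuous_const.sub hxc)
      (g := fun s => xs - x s) has (sub_pos.2 (ha a le_rfl)) (by linarith)
    have hbelow : ∀ σ < c, x σ < xs := fun σ hσ => by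
      rcases le_total a σ with h | h
      · have := hc σ h hσ
        linarith
      · exact ha σ h
    have hceq : x c = xs := by
      refine le_antisymm ?_ (by linarith)
      refine le_of_tendsto (hxc.continuousAt.mono_left (nhdsWithin_le_nhds (s := Iio c))) ?_
      filter_upwards [self_mem_nhdsWithin] with σ hσ using (hbelow σ hσ).le
    refine ⟨c, hceq, hinc c (fun σ hσ => ?_) c le_rfl⟩
    rcases hσ.lt_or_eq with h | h
    · exact (hbelow σ h).le
    · rw [h, hceq]
  -- after the crossing the trajectory stays above the equilibrium
  set γ := (d - k + 2 * d * β) / 2 with hγ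
  have hexpder : ∀ s, HasDerivAt (fun s => exp (γ * s) * (x s - xs))
      (exp (γ * s) * (p s + γ * (x s - xs))) s := by
    intro s
    have h1 : HasDerivAt (fun s => exp (γ * s)) (exp (γ * s) * γ) s := by
      simpa using ((hasDerivAt_id s).const_mul γ).exp
    refine (h1.mul ((hx s).sub_const xs)).congr_deriv ?_
    ring
  have habove : ∀ c, s0 < c → (∀ σ, s0 ≤ σ → σ < c → 0 < p σ + γ * (x σ - xs)) → xs < x c := by
    intro c hc hpos
    have hmono : StrictMonoOn (fun s => exp (γ * s) * (x s - xs)) (Icc s0 c) := by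
      refine strictMonoOn_of_hasDerivWithinAt_pos (convex_Icc s0 c)
        (fun σ _ => (hexpder σ).continuousAt.continuousWithinAt)
        (fun σ _ => (hexpder σ).hasDerivWithinAt) ?_
      intro σ hσ
      rw [interior_Icc] at hσ
      have := hpos σ hσ.1.le hσ.2
      positivity
    have h1 := hmono (left_mem_Icc.2 hc.le) (right_mem_Icc.2 hc.le) hc
    simp only [hs0x, sub_self, mul_zero] at h1
    have := pos_of_mul_pos_right h1 (exp_pos _).le
    linarith
  have htrap : ∀ s, s0 ≤ s → 0 < p s + γ * (x s - xs) := by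
    intro s hs
    by_contra! hneg
    obtain ⟨c, hc0, -, hc1, hc⟩ := exists_first_nonpos (g := fun s => p s + γ * (x s - xs))
      (by fun_prop) hs (by rw [hs0x]; simpa using hs0p) hneg
    have hy : xs < x c := habove c hc0 hc
    have hqc : p c = -γ * (x c - xs) := by
      have : 0 ≤ p c + γ * (x c - xs) := by
        have hcont : Continuous fun s => p s + γ * (x s - xs) := by fun_prop
        refine ge_of_tendsto (hcont.continuousAt.mono_left (nhdsWithin_le_nhds (s := Iio c))) ?_
        filter_upwards [self_mem_nhdsWithin, mem_nhdsWithin_of_mem_nhds (lt_mem_nhds hc0)]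
          with σ h1 h2 using (hc σ (mem_Ioi.1 h2).le h1).le
      linarith
    have hder := (hp c).add (((hx c).sub_const xs).const_mul γ)
    have hle := deriv_nonpos_of_pos_left hder hc1 (by
      filter_upwards [self_mem_nhdsWithin, mem_nhdsWithin_of_mem_nhds (lt_mem_nhds hc0)]
          with σ h1 h2 using hc σ (mem_Ioi.1 h2).le h1)
    have hconv := rpow_sub_rpow_le hQ1.le (hxpos c) hxs0
    have hXx : 2 * d ≤ Q * x c ^ (Q - 1) := by
      have h1 : xs ^ (Q - 1) ≤ x c ^ (Q - 1) := Real.rpow_le_rpow hxs0.le hy.le (by linarith)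
      have h2 : Q * xs ^ (Q - 1) = 2 * d := by
        have : (1 + k / 2) * (Q * xs ^ (Q - 1)) = (1 + k / 2) * (2 * d) := by
          linear_combination Q * hxs + d * hQk
        exact mul_left_cancel₀ (by positivity) this
      rw [← h2]; gcongr
    have hxsQ : (1 + k / 2) * xs ^ Q = k * d * xs := by
      rw [hsplit xs hxs0]; linear_combination xs * hxs
    set A := Q * x c ^ (Q - 1) with hA
    set y := x c - xs with hydef
    have hy0 : 0 < y := sub_pos.2 hy
    have hG : (1 + k / 2) * x c ^ Q - k * d * x c ≤ y * ((1 + k / 2) * A - k * d) := by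
      have : (1 + k / 2) * (x c ^ Q - xs ^ Q) ≤ (1 + k / 2) * (A * y) := by gcongr
      nlinarith
    have hkey : (1 + k / 2) * A - k * d < γ * (d - k + β * A) - γ ^ 2 := by
      have h1 : 0 ≤ (γ * β - (1 + k / 2)) * (A - 2 * d) :=
        mul_nonneg (by rw [hγ]; linarith) (by linarith)
      have h2 : 0 < γ * (d - k + 2 * d * β) - γ ^ 2 - 2 * d := by rw [hγ]; linarith
      nlinarith
    have hkey2 := mul_lt_mul_of_pos_left hkey hy0
    rw [hqc] at hle
    nlinarith
  have hgt : ∀ s, s0 < s → xs < x s := fun s hs =>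
    habove s hs fun σ h _ => htrap σ h
  -- the trajectory turns back
  obtain ⟨s1, hs01, hs1⟩ : ∃ s1, s0 < s1 ∧ p s1 < 0 := by
    by_contra! h
    have hmono : MonotoneOn x (Ici (s0 + 1)) := by
      refine monotoneOn_of_hasDerivWithinAt_nonneg (convex_Ici _) hxc.continuousOn
        (fun σ _ => (hx σ).hasDerivWithinAt) ?_
      intro σ hσ
      rw [interior_Ici] at hσ
      exact h σ (by linarith [mem_Ioi.1 hσ])
    have : x (s0 + 1) ≤ xs := by
      refine ge_of_tendsto hxlim ?_
      filter_upwards [eventually_ge_atTop (s0 + 1)] with t ht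
      exact hmono (mem_Ici.2 le_rfl) (mem_Ici.2 ht) ht
    linarith [hgt (s0 + 1) (by linarith)]
  have hdec : ∀ s, s1 ≤ s → p s < 0 := by
    intro s hs
    by_contra! hneg
    obtain ⟨c, hc0, -, hc1, hc⟩ := exists_first_nonpos (g := fun s => - p s)
      (by fun_prop) hs (by linarith) (by linarith)
    have hpc0 : p c = 0 := by
      refine le_antisymm ?_ (by linarith)
      refine le_of_tendsto (hpc.continuousAt.mono_left (nhdsWithin_le_nhds (s := Iio c))) ?_
      filter_upwards [self_mem_nhdsWithin, mem_nhdsWithin_of_mem_nhds (lt_mem_nhds hc0)]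
          with σ h1 h2
      linarith [hc σ (mem_Ioi.1 h2).le h1]
    have hle := deriv_nonpos_of_pos_left (hp c).neg hc1 (by
      filter_upwards [self_mem_nhdsWithin, mem_nhdsWithin_of_mem_nhds (lt_mem_nhds hc0)]
          with σ h1 h2 using hc σ (mem_Ioi.1 h2).le h1)
    rw [hpc0] at hle
    have hy : xs < x c := hgt c (hs01.trans hc0)
    have h1 : xs ^ (Q - 1) < x c ^ (Q - 1) := Real.rpow_lt_rpow hxs0.le hy (by linarith)
    have h2 : k * d < (1 + k / 2) * x c ^ (Q - 1) := by rw [← hxs]; gcongr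
    have h3 := mul_lt_mul_of_pos_right h2 (hxpos c)
    rw [hsplit _ (hxpos c)] at hle
    linarith
  refine ⟨s1, strictAntiOn_of_hasDerivWithinAt_neg (convex_Ici _) hxc.continuousOn
        (fun σ _ => (hx σ).hasDerivWithinAt) ?_⟩
  intro σ hσ
  rw [interior_Ici] at hσ
  exact hdec σ (mem_Ioi.1 hσ).le

/-- A `C²` profile is, in the variable `σ = r²`, a function that is `C¹` up to `σ = 0`. -/
lemma IsProfile.exists_radial {n : ℕ} {m β α lam : ℝ} {f : ℝ → ℝ} (hn : 2 ≤ n) (hm : 0 < m)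
    (hf : IsProfile n m β α lam f) : ∃ Z Z1 Z2 : ℝ → ℝ,
      (∀ r, 0 ≤ r → Z (r ^ 2) = f r ^ m) ∧ (∀ σ, 0 ≤ σ → HasDerivAt Z (Z1 σ) σ) ∧
      Continuous Z1 ∧ (∀ σ, 0 < σ → HasDerivAt Z1 (Z2 σ) σ) ∧
      ∀ σ, 0 ≤ σ → 4 * σ * Z2 σ + 2 * n * Z1 σ + α * Z σ ^ (1 / m)
        + 2 * β * σ * (1 / m * Z σ ^ (1 / m - 1) * Z1 σ) = 0 := by
  set p : ℝ → ℝ := fun r => f r ^ m with hp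
  have hpos := hf.pos
  have hp2 : ContDiffOn ℝ 2 p (Ici 0) :=
    hf.smooth.rpow_const_of_ne fun r hr => (hpos r hr).ne'
  have hu : UniqueDiffOn ℝ (Ici (0 : ℝ)) := uniqueDiffOn_Ici 0
  set G := derivWithin p (Ici 0) with hG
  have hG1 : ContDiffOn ℝ 1 G (Ici 0) := hp2.derivWithin hu (by norm_num)
  set G' := derivWithin G (Ici 0) with hG'
  have hG'c : ContinuousOn G' (Ici 0) := hG1.continuousOn_derivWithin hu (by norm_num)
  set fd := derivWithin f (Ici 0) with hfd
  have hfdc : ContinuousOn fd (Ici 0) := hf.smooth.continuousOn_derivWithin hu (by norm_num)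
  have hnhds : ∀ r : ℝ, 0 < r → Ici 0 ∈ 𝓝 r := fun r hr => Ici_mem_nhds hr
  have hpd : ∀ r, 0 < r → HasDerivAt p (G r) r := fun r hr =>
    ((hp2.differentiableOn (by norm_num)) r hr.le).hasDerivWithinAt.hasDerivAt (hnhds r hr)
  have hGd : ∀ r, 0 < r → HasDerivAt G (G' r) r := fun r hr =>
    ((hG1.differentiableOn (by norm_num)) r hr.le).hasDerivWithinAt.hasDerivAt (hnhds r hr)
  have hfder : ∀ r, 0 < r → HasDerivAt f (fd r) r := fun r hr =>
    ((hf.smooth.differentiableOn (by norm_num)) r hr.le).hasDerivWithinAt.hasDerivAt (hnhds r hr)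
  have hGf : ∀ r, 0 < r → G r = m * f r ^ (m - 1) * fd r := fun r hr =>
    (hpd r hr).unique (((hfder r hr).rpow_const (Or.inl (hpos r hr.le).ne')).congr_deriv
      (by ring))
  have hode : ∀ r, 0 < r → G' r + (n - 1) / r * G r + α * f r + β * r * fd r = 0 := by
    intro r hr
    have h := hf.ode r hr
    have h1 : deriv p =ᶠ[𝓝 r] G := by
      filter_upwards [lt_mem_nhds hr] with s hs using (hpd s hs).deriv
    rw [show (fun s => f s ^ m) = p from rfl, h1.deriv_eq, h1.eq_of_nhds, (hGd r hr).deriv,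
      (hfder r hr).deriv] at h
    exact h
  have h0 : (0 : ℝ) ∈ Ici (0 : ℝ) := mem_Ici.2 le_rfl
  have hright : ∀ {h : ℝ → ℝ}, ContinuousOn h (Ici 0) → Tendsto h (𝓝[>] 0) (𝓝 (h 0)) :=
    fun hc => (hc 0 h0).mono_left (nhdsWithin_mono _ Ioi_subset_Ici_self)
  have hid : Tendsto (fun r : ℝ => r) (𝓝[>] 0) (𝓝 0) := nhdsWithin_le_nhds
  have hn' : (2 : ℝ) ≤ n := by exact_mod_cast hn
  have hG0 : G 0 = 0 := by
    have h1 : Tendsto (fun r => r * G' r + (n - 1) * G r + r * (α * f r + β * r * fd r)) (𝓝[>] 0)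
        (𝓝 (0 * G' 0 + (n - 1) * G 0 + 0 * (α * f 0 + β * 0 * fd 0))) :=
      ((hid.mul (hright hG'c)).add ((hright hG1.continuousOn).const_mul _)).add
        (hid.mul (((hright hf.smooth.continuousOn).const_mul _).add
          ((hid.const_mul β).mul (hright hfdc))))
    have h2 : Tendsto (fun r => r * G' r + (n - 1) * G r + r * (α * f r + β * r * fd r)) (𝓝[>] 0)
        (𝓝 0) := by
      refine tendsto_const_nhds.congr' ?_
      filter_upwards [self_mem_nhdsWithin] with r hr
      have hr0 : r ≠ 0 := (mem_Ioi.1 hr).ne'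
      have := hode r hr
      field_simp at this
      linear_combination -this
    have h3 := tendsto_nhds_unique h1 h2
    have h4 : ((n : ℝ) - 1) * G 0 = 0 := by linarith
    rcases mul_eq_zero.1 h4 with h | h
    · linarith
    · exact h
  have hGr : Tendsto (fun r => G r / r) (𝓝[>] 0) (𝓝 (G' 0)) := by
    have h1 : HasDerivWithinAt G (G' 0) (Ioi 0) 0 :=
      (((hG1.differentiableOn (by norm_num)) 0 h0).hasDerivWithinAt).mono Ioi_subset_Ici_self
    have h2 := hasDerivWithinAt_iff_tendsto_slope' (self_notMem_Ioi (a := (0 : ℝ))) |>.1 h1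
    refine h2.congr fun r => ?_
    rw [slope_def_field, hG0, sub_zero, sub_zero]
  have hA : n * G' 0 + α * f 0 = 0 := by
    have h1 : Tendsto (fun r => G' r + (n - 1) * (G r / r) + α * f r + β * r * fd r) (𝓝[>] 0)
        (𝓝 (G' 0 + (n - 1) * G' 0 + α * f 0 + β * 0 * fd 0)) :=
      (((hright hG'c).add (hGr.const_mul _)).add
        ((hright hf.smooth.continuousOn).const_mul _)).add ((hid.const_mul β).mul (hright hfdc))
    have h2 : Tendsto (fun r => G' r + (n - 1) * (G r / r) + α * f r + β * r * fd r) (𝓝[>] 0)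
        (𝓝 0) := by
      refine tendsto_const_nhds.congr' ?_
      filter_upwards [self_mem_nhdsWithin] with r hr
      have := hode r hr
      rw [← this]; ring
    have h3 := tendsto_nhds_unique h1 h2
    linarith
  set A := G' 0 / 2 with hAdef
  set Z : ℝ → ℝ := fun σ => if 0 ≤ σ then p (√σ) else p 0 + σ * A with hZ
  set Z1 : ℝ → ℝ := fun σ => if 0 < σ then G (√σ) / (2 * √σ) else A with hZ1
  set Z2 : ℝ → ℝ := fun σ => (G' (√σ) - G (√σ) / √σ) / (4 * σ) with hZ2
  have hZ1pos : ∀ σ, 0 < σ → Z1 =ᶠ[𝓝 σ] fun t => G (√t) / (2 * √t) := fun σ hσ => by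
    filter_upwards [lt_mem_nhds hσ] with t ht
    rw [hZ1]; simp [ht]
  have hsq : ∀ σ : ℝ, 0 < σ → HasDerivAt (fun t => √t) (1 / (2 * √σ)) σ := fun σ hσ =>
    Real.hasDerivAt_sqrt hσ.ne'
  have hdpos : ∀ σ, 0 < σ → HasDerivAt Z (Z1 σ) σ := fun σ hσ => by
    have hs := Real.sqrt_pos.2 hσ
    have h1 := (hpd _ hs).comp σ (hsq σ hσ)
    have h2 : Z =ᶠ[𝓝 σ] p ∘ fun t => √t := by
      filter_upwards [lt_mem_nhds hσ] with t ht
      rw [hZ]; simp [ht.le]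
    refine (h1.congr_of_eventuallyEq h2).congr_deriv ?_
    rw [hZ1]; simp only [hσ, if_true]; ring
  have hZ1right : Tendsto Z1 (𝓝[>] 0) (𝓝 A) := by
    have hs : Tendsto (fun σ : ℝ => √σ) (𝓝[>] 0) (𝓝[>] 0) := by
      refine tendsto_nhdsWithin_iff.2 ⟨?_, ?_⟩
      · have := (Real.continuous_sqrt.tendsto 0).mono_left (nhdsWithin_le_nhds (s := Ioi 0))
        simpa using this
      · filter_upwards [self_mem_nhdsWithin] with σ hσ using Real.sqrt_pos.2 hσ
    refine ((hGr.comp hs).div_const 2).congr' ?_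
    filter_upwards [self_mem_nhdsWithin] with σ hσ
    rw [hZ1]; simp only [mem_Ioi.1 hσ, if_true, Function.comp]
    field_simp
  have hZcont : Continuous Z := by
    have h1 : Continuous fun σ : ℝ => p (√σ) :=
      hp2.continuousOn.comp_continuous Real.continuous_sqrt fun σ => Real.sqrt_nonneg σ
    refine Continuous.if_le h1 (by fun_prop) continuous_const continuous_id ?_
    rintro x rfl
    simp
  have hd0 : HasDerivAt Z A 0 := by
    have hr : HasDerivWithinAt Z A (Ici 0) 0 := by
      refine hasDerivWithinAt_Ici_of_tendsto_deriv (s := Ioi 0)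
        (fun σ hσ => (hdpos σ hσ).differentiableAt.differentiableWithinAt)
        hZcont.continuousWithinAt self_mem_nhdsWithin ?_
      refine hZ1right.congr' ?_
      filter_upwards [self_mem_nhdsWithin] with σ hσ using (hdpos σ hσ).deriv.symm
    have hl : HasDerivWithinAt Z A (Iic 0) 0 := by
      have h1 : HasDerivAt (fun σ : ℝ => p 0 + σ * A) A 0 := by
        simpa using ((hasDerivAt_id (0 : ℝ)).mul_const A).const_add (p 0)
      refine h1.hasDerivWithinAt.congr (fun σ hσ => ?_) (by simp [hZ])
      rcases (mem_Iic.1 hσ).lt_or_eq with h | h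
      · simp [hZ, not_le.2 h]
      · simp [hZ, h]
    have := hl.union hr
    rwa [Iic_union_Ici, hasDerivWithinAt_univ] at this
  have hd2 : ∀ σ, 0 < σ → HasDerivAt Z1 (Z2 σ) σ := fun σ hσ => by
    have hs := Real.sqrt_pos.2 hσ
    have h1 := ((hGd _ hs).comp σ (hsq σ hσ)).div ((hsq σ hσ).const_mul 2) (by positivity)
    refine (h1.congr_of_eventuallyEq (hZ1pos σ hσ)).congr_deriv ?_
    have hσ2 : √σ ^ 2 = σ := Real.sq_sqrt hσ.le
    simp only [hZ2, Function.comp]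
    rw [← hσ2]
    rw [Real.sqrt_sq hs.le]
    field_simp
    ring
  have hZval : ∀ r, 0 ≤ r → Z (r ^ 2) = f r ^ m := fun r hr => by
    simp [hZ, hp, sq_nonneg, Real.sqrt_sq hr]
  refine ⟨Z, Z1, Z2, hZval, ?_, ?_, hd2, ?_⟩
  · intro σ hσ
    rcases hσ.lt_or_eq with h | h
    · exact hdpos σ h
    · rw [← h]; simpa [hZ1] using hd0
  · refine continuous_iff_continuousAt.2 fun σ => ?_
    rcases lt_trichotomy σ 0 with h | h | h
    · refine (continuousAt_const (y := A)).congr ?_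
      filter_upwards [gt_mem_nhds h] with t ht
      simp [hZ1, not_lt.2 ht.le]
    · rw [h, continuousAt_iff_continuous_left'_right']
      have hv : Z1 0 = A := by simp [hZ1]
      refine ⟨?_, ?_⟩
      · unfold ContinuousWithinAt
        rw [hv]
        refine (tendsto_const_nhds (x := A)).congr' ?_
        filter_upwards [self_mem_nhdsWithin] with t ht
        simp [hZ1, not_lt.2 (mem_Iio.1 ht).le]
      · unfold ContinuousWithinAt
        rw [hv]; exact hZ1right
    · exact (hd2 σ h).continuousAt
  · intro σ hσ
    have hs := Real.sqrt_nonneg σ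
    have hZs : Z σ = f (√σ) ^ m := by rw [← hZval _ hs, Real.sq_sqrt hσ]
    have hfz : Z σ ^ (1 / m) = f (√σ) := by
      rw [hZs, ← Real.rpow_mul (hpos _ hs).le]
      rw [mul_one_div_cancel hm.ne', Real.rpow_one]
    rcases hσ.lt_or_eq with h | h
    · have hs' := Real.sqrt_pos.2 h
      have h1 := hode _ hs'
      have hZm : Z σ ^ (1 / m - 1) * f (√σ) ^ (m - 1) = 1 := by
        rw [hZs, ← Real.rpow_mul (hpos _ hs).le, ← Real.rpow_add (hpos _ hs)]
        have : m * (1 / m - 1) + (m - 1) = 0 := by field_simp; ring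
        rw [this, Real.rpow_zero]
      have hσ2 : √σ ^ 2 = σ := Real.sq_sqrt hσ
      rw [hfz]
      have hz1 : Z1 σ = G (√σ) / (2 * √σ) := by simp [hZ1, h]
      have hz2 : 4 * σ * Z2 σ = G' (√σ) - G (√σ) / √σ := by
        simp only [hZ2]; field_simp
      have hz3 : 2 * β * σ * (1 / m * Z σ ^ (1 / m - 1) * Z1 σ) = β * √σ * fd (√σ) := by
        rw [hz1, hGf _ hs']
        generalize Z σ ^ (1 / m - 1) = E at hZm
        nth_rewrite 1 [← hσ2]
        field_simp
        linear_combination fd (√σ) * β * hZm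
      rw [hz2, hz3, hz1, ← h1]
      field_simp
      ring
    · rw [hfz, ← h]
      simp only [Real.sqrt_zero, hZ1, lt_irrefl, if_false]
      linear_combination hA

/-- The rescaled profile `r ↦ r^k f(r)^m` is eventually strictly decreasing. -/
lemma radial_eventually_strictAnti {d k β α xs Q N : ℝ} (hd : 0 < d) (hd2 : d < 2) (hk : 0 < k)
    (hQ : Q = 1 + 2 / k) (hβ1 : β < (1 + k / 2) / d) (hN : N = d + k + 2)
    (hα : α = (2 * β + 1) * (1 + k / 2))
    (hdisc : 8 * d < (d - k + 2 * d * β) ^ 2) (hprod : 2 + k ≤ β * (d - k + 2 * d * β))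
    (hxs0 : 0 < xs) (hxs : (1 + k / 2) * xs ^ (Q - 1) = k * d)
    {Z Z1 Z2 : ℝ → ℝ} (hZpos : ∀ σ, 0 ≤ σ → 0 < Z σ)
    (hZ : ∀ σ, 0 ≤ σ → HasDerivAt Z (Z1 σ) σ) (hZ1c : Continuous Z1)
    (hZ1 : ∀ σ, 0 < σ → HasDerivAt Z1 (Z2 σ) σ)
    (hode : ∀ σ, 0 ≤ σ → 4 * σ * Z2 σ + 2 * N * Z1 σ + α * Z σ ^ Q
        + 2 * β * σ * (Q * Z σ ^ (Q - 1) * Z1 σ) = 0)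
    (hlim : Tendsto (fun r : ℝ => r ^ k * Z (r ^ 2)) atTop (𝓝 xs)) :
    ∃ S, 0 < S ∧ StrictAntiOn (fun r : ℝ => r ^ k * Z (r ^ 2)) (Ici S) := by
  set x : ℝ → ℝ := fun s => exp (k * s) * Z (exp (2 * s)) with hx
  set p : ℝ → ℝ := fun s => exp (k * s) * (k * Z (exp (2 * s))
    + 2 * exp (2 * s) * Z1 (exp (2 * s))) with hp
  have hexp : ∀ (a s : ℝ), HasDerivAt (fun s => exp (a * s)) (a * exp (a * s)) s := fun a s => by
    have := ((hasDerivAt_id s).const_mul a).exp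
    simpa [mul_comm] using this
  have hQk : Q * k = k + 2 := by rw [hQ]; field_simp
  have hE : ∀ s, exp (k * s) ^ (Q - 1) = exp (2 * s) := fun s => by
    rw [← Real.exp_mul]; congr 1; linear_combination s * hQk
  have hE' : ∀ s, exp (k * s) ^ Q = exp (k * s) * exp (2 * s) := fun s => by
    rw [← Real.exp_mul, ← Real.exp_add]; congr 1; linear_combination s * hQk
  have hxQ : ∀ s, x s ^ Q = exp (k * s) * exp (2 * s) * Z (exp (2 * s)) ^ Q := fun s => by
    rw [hx]; simp only
    rw [Real.mul_rpow (exp_pos _).le (hZpos _ (exp_pos _).le).le, hE']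
  have hsplit : ∀ y : ℝ, 0 < y → y ^ Q = y ^ (Q - 1) * y := fun y hy => by
    rw [← Real.rpow_add_one hy.ne']; congr 1; ring
  have hxd : ∀ s, HasDerivAt x (p s) s := fun s => by
    have h1 := (hZ _ (exp_pos (2 * s)).le).comp s (hexp 2 s)
    refine ((hexp k s).mul h1).congr_deriv ?_
    simp only [hp, Function.comp]
    ring
  have hpd : ∀ s, HasDerivAt p (-(d - k) * p s + k * d * x s - (1 + k / 2) * x s ^ Q
      - β * (Q * x s ^ (Q - 1) * p s)) s := fun s => by
    have h1 := (hZ _ (exp_pos (2 * s)).le).comp s (hexp 2 s)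
    have h2 := (hZ1 _ (exp_pos (2 * s))).comp s (hexp 2 s)
    have h3 := (hexp k s).mul ((h1.const_mul k).add (((hexp 2 s).const_mul 2).mul h2))
    refine h3.congr_deriv ?_
    have ho := hode _ (exp_pos (2 * s)).le
    have hx1 : x s ^ (Q - 1) = exp (2 * s) * Z (exp (2 * s)) ^ (Q - 1) := by
      rw [hx]; simp only
      rw [Real.mul_rpow (exp_pos _).le (hZpos _ (exp_pos _).le).le, hE]
    have hs := hsplit _ (hZpos _ (exp_pos (2 * s)).le)
    rw [hx1, hxQ, hs]
    rw [hs] at ho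
    simp only [hp, hx, Function.comp, Pi.add_apply, Pi.mul_apply]
    generalize Z (exp (2 * s)) ^ (Q - 1) = Y at *
    generalize Z (exp (2 * s)) = z at *
    generalize Z1 (exp (2 * s)) = z1 at *
    generalize Z2 (exp (2 * s)) = z2 at *
    generalize exp (2 * s) = w at *
    generalize exp (k * s) = e at *
    subst hN hα
    linear_combination e * w * ho + β * Y * e * w * z * hQk
  have hw0 : Tendsto (fun s : ℝ => exp (2 * s)) atBot (𝓝 0) :=
    Real.tendsto_exp_atBot.comp (tendsto_id.const_mul_atBot (by norm_num))
  have he0 : ∀ a : ℝ, 0 < a → Tendsto (fun s : ℝ => exp (a * s)) atBot (𝓝 0) := fun a ha =>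
    Real.tendsto_exp_atBot.comp (tendsto_id.const_mul_atBot ha)
  have hZ0 : Tendsto (fun s : ℝ => Z (exp (2 * s))) atBot (𝓝 (Z 0)) :=
    (hZ 0 le_rfl).continuousAt.tendsto.comp hw0
  have hZ10 : Tendsto (fun s : ℝ => Z1 (exp (2 * s))) atBot (𝓝 (Z1 0)) :=
    (hZ1c.tendsto 0).comp hw0
  have hQ0 : 0 ≤ Q := by rw [hQ]; positivity
  have hp0 : ∀ᶠ s in atBot, 0 < p s := by
    have h1 := (hZ0.const_mul k).add ((hw0.const_mul 2).mul hZ10)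
    have h2 : 0 < k * Z 0 + 2 * 0 * Z1 0 := by
      have := hZpos 0 le_rfl
      simp only [mul_zero, zero_mul, add_zero]
      positivity
    filter_upwards [h1.eventually (lt_mem_nhds h2)] with s hs
    exact mul_pos (exp_pos _) hs
  have hx0 : Tendsto x atBot (𝓝 0) := by
    simpa using (he0 k hk).mul hZ0
  have hN0 : Tendsto (fun s => exp (d * s) * (p s - k * x s + (1 + k / 2) / d * x s ^ Q)) atBot
      (𝓝 0) := by
    have h1 := (he0 d hd).mul (((he0 k hk).mul hw0).mul ((hZ10.const_mul 2).add
      ((hZ0.rpow_const (p := Q) (Or.inr hQ0)).const_mul ((1 + k / 2) / d))))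
    rw [zero_mul] at h1
    refine h1.congr fun s => ?_
    rw [hxQ]
    simp only [hp, hx]
    ring
  have hJ : ∀ r : ℝ, 0 < r → r ^ k * Z (r ^ 2) = x (log r) := fun r hr => by
    simp only [hx]
    rw [Real.rpow_def_of_pos hr, mul_comm k, mul_comm 2, Real.exp_mul (log r) 2, Real.exp_log hr]
    norm_cast
  have hxlim : Tendsto x atTop (𝓝 xs) := by
    refine (hlim.comp Real.tendsto_exp_atTop).congr fun s => ?_
    simp only [Function.comp]
    rw [hJ _ (exp_pos s), Real.log_exp]
  obtain ⟨S, hS⟩ := trajectory_eventually_strictAnti hd hd2 hk hQ hβ1 hdisc hprod hxs0 hxs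
    (fun s => mul_pos (exp_pos _) (hZpos _ (exp_pos _).le)) hxd hpd hp0 hx0 hN0 hxlim
  refine ⟨exp S, exp_pos S, fun a ha b hb hab => ?_⟩
  have ha0 : 0 < a := (exp_pos S).trans_le ha
  have hb0 : 0 < b := (exp_pos S).trans_le hb
  simp only
  rw [hJ a ha0, hJ b hb0]
  exact hS (mem_Ici.2 ((Real.le_log_iff_exp_le ha0).2 ha))
    (mem_Ici.2 ((Real.le_log_iff_exp_le hb0).2 hb)) (Real.log_lt_log ha0 hab)

/-- Second derivative test at a local maximum. -/
lemma second_deriv_nonpos_of_isLocalMax {φ φ1 : ℝ → ℝ} {a L : ℝ} (hmax : IsLocalMax φ a)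
    (hφ : ∀ᶠ s in 𝓝 a, HasDerivAt φ (φ1 s) s) (hφ1 : HasDerivAt φ1 L a) : L ≤ 0 := by
  by_contra! hL
  have h0 : φ1 a = 0 := hmax.hasDerivAt_eq_zero hφ.self_of_nhds
  have h1 := (hasDerivWithinAt_iff_tendsto_slope' (self_notMem_Ioi (a := a)) |>.1
    (hφ1.hasDerivWithinAt (s := Ioi a))).eventually (lt_mem_nhds hL)
  obtain ⟨δ, hδ, hball⟩ := Metric.eventually_nhds_iff.1 (hφ.and hmax)
  obtain ⟨b, hb, hab⟩ := (mem_nhdsGT_iff_exists_Ioo_subset.1 h1)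
  set c := min (a + δ / 2) ((a + b) / 2) with hc
  have hb' : a < b := hb
  have hac : a < c := lt_min (by linarith) (by linarith)
  have hcb : c < b := (min_le_right _ _).trans_lt (by linarith)
  have hcδ : c ≤ a + δ / 2 := min_le_left _ _
  have hin : ∀ s ∈ Icc a c, HasDerivAt φ (φ1 s) s ∧ φ s ≤ φ a := fun s hs => by
    refine hball ?_
    rw [Real.dist_eq, abs_of_nonneg (by linarith [hs.1])]
    linarith [hs.2]
  have hmono : StrictMonoOn φ (Icc a c) := by
    refine strictMonoOn_of_hasDerivWithinAt_pos (convex_Icc a c)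
      (fun s hs => (hin s hs).1.continuousAt.continuousWithinAt)
      (fun s hs => (hin s (interior_subset hs)).1.hasDerivWithinAt) ?_
    intro s hs
    rw [interior_Icc] at hs
    have h2 : 0 < slope φ1 a s := hab ⟨hs.1, hs.2.trans hcb⟩
    rw [slope_def_field, h0, sub_zero] at h2
    have := sub_pos.2 hs.1
    exact (div_pos_iff_of_pos_right this).1 h2
  have := hmono (left_mem_Icc.2 hac.le) (right_mem_Icc.2 hac.le) hac
  linarith [(hin c (right_mem_Icc.2 hac.le)).2]

/-- If `h` touches from below the radial function `x ↦ C P(B|x|²)` at `x0`, the Laplacian of `h`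
is bounded by that of the radial function. -/
lemma lap_le_of_contact {n : ℕ} {h : EuclideanSpace ℝ (Fin n) → ℝ} {x0 : EuclideanSpace ℝ (Fin n)}
    (hh : ContDiffAt ℝ 2 h x0) {P P1 : ℝ → ℝ} {P2 B C : ℝ} (hB : 0 < B)
    (hP : ∀ σ, 0 ≤ σ → HasDerivAt P (P1 σ) σ) (hP1c : ContinuousAt P1 0)
    (hP2 : x0 ≠ 0 → HasDerivAt P1 P2 (B * ‖x0‖ ^ 2))
    (hle : ∀ᶠ x in 𝓝 x0, h x ≤ C * P (B * ‖x‖ ^ 2)) (heq : h x0 = C * P (B * ‖x0‖ ^ 2)) :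
    lap n h x0 ≤ C * B * (4 * (B * ‖x0‖ ^ 2) * P2 + 2 * n * P1 (B * ‖x0‖ ^ 2)) := by
  have key : ∀ i : Fin n, fderiv ℝ (fun y => fderiv ℝ h y (EuclideanSpace.single i (1 : ℝ))) x0
      (EuclideanSpace.single i (1 : ℝ)) ≤
      C * (P2 * (4 * B ^ 2 * x0 i ^ 2) + P1 (B * ‖x0‖ ^ 2) * (2 * B)) := by
    intro i
    set e : EuclideanSpace ℝ (Fin n) := EuclideanSpace.single i (1 : ℝ) with he
    have hnorm : ∀ s : ℝ, ‖x0 + s • e‖ ^ 2 = ‖x0‖ ^ 2 + 2 * x0 i * s + s ^ 2 := fun s => by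
      rw [norm_add_sq_real, inner_smul_right, norm_smul, he, EuclideanSpace.inner_single_right]
      simp
      ring
    have hline : ∀ s : ℝ, HasDerivAt (fun s : ℝ => x0 + s • e) e s := fun s => by
      simpa using ((hasDerivAt_id s).smul_const e).const_add x0
    have hlc : Tendsto (fun s : ℝ => x0 + s • e) (𝓝 0) (𝓝 x0) := by
      have := (hline 0).continuousAt.tendsto
      simpa using this
    set φ : ℝ → ℝ := fun s => h (x0 + s • e) - C * P (B * (‖x0‖ ^ 2 + 2 * x0 i * s + s ^ 2))
      with hφ
    set φ1 : ℝ → ℝ := fun s => fderiv ℝ h (x0 + s • e) e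
      - C * (P1 (B * (‖x0‖ ^ 2 + 2 * x0 i * s + s ^ 2)) * (B * (2 * x0 i + 2 * s))) with hφ1
    have hmax : IsLocalMax φ 0 := by
      filter_upwards [hlc.eventually hle] with s hs
      have h1 : φ 0 = 0 := by simp [hφ, heq]
      rw [h1]
      simp only [hφ]
      rw [← hnorm]
      linarith
    have hq : ∀ s : ℝ, HasDerivAt (fun s : ℝ => B * (‖x0‖ ^ 2 + 2 * x0 i * s + s ^ 2))
        (B * (2 * x0 i + 2 * s)) s := fun s => by
      have h1 := (((hasDerivAt_id s).const_mul (2 * x0 i)).const_add (‖x0‖ ^ 2)).add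
        (hasDerivAt_pow 2 s)
      refine (h1.const_mul B).congr_deriv ?_
      simp
    have hd1 : ∀ᶠ s in 𝓝 (0 : ℝ), HasDerivAt φ (φ1 s) s := by
      have hev : ∀ᶠ y in 𝓝 x0, DifferentiableAt ℝ h y := by
        filter_upwards [hh.eventually (by norm_num)] with y hy
        exact hy.differentiableAt (by norm_num)
      filter_upwards [hlc.eventually hev] with s hs
      have h1 := hs.hasFDerivAt.comp_hasDerivAt s (hline s)
      have h2 : 0 ≤ B * (‖x0‖ ^ 2 + 2 * x0 i * s + s ^ 2) := by rw [← hnorm]; positivity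
      exact h1.sub (((hP _ h2).comp s (hq s)).const_mul C)
    have hfd : DifferentiableAt ℝ (fun y => fderiv ℝ h y e) x0 := by
      have h1 : ContDiffAt ℝ 1 (fderiv ℝ h) x0 := hh.fderiv_right (by norm_num)
      exact (h1.differentiableAt (by norm_num)).clm_apply (differentiableAt_const e)
    have hd2 : HasDerivAt φ1 (fderiv ℝ (fun y => fderiv ℝ h y e) x0 e
        - C * (P2 * (4 * B ^ 2 * x0 i ^ 2) + P1 (B * ‖x0‖ ^ 2) * (2 * B))) 0 := by
      have h1 : HasDerivAt (fun s : ℝ => fderiv ℝ h (x0 + s • e) e)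
          (fderiv ℝ (fun y => fderiv ℝ h y e) x0 e) 0 := by
        have h0 : HasFDerivAt (fun y => fderiv ℝ h y e) (fderiv ℝ (fun y => fderiv ℝ h y e) x0)
          (x0 + (0 : ℝ) • e) := by simpa using hfd.hasFDerivAt
        exact h0.comp_hasDerivAt (0 : ℝ) (hline 0)
      refine h1.sub (HasDerivAt.const_mul C ?_)
      by_cases hx : x0 = 0
      · have hx' : x0 i = 0 := by simp [hx]
        have h2 : ContinuousAt (fun s : ℝ => P1 (B * (‖x0‖ ^ 2 + 2 * x0 i * s + s ^ 2))) 0 := by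
          refine ContinuousAt.comp (g := P1) ?_ (hq 0).continuousAt
          simpa [hx] using hP1c
        rw [hasDerivAt_iff_tendsto_slope]
        have h3 := (h2.tendsto.mul_const (2 * B)).mono_left (nhdsWithin_le_nhds (s := {0}ᶜ))
        simp only [hx, norm_zero, PiLp.zero_apply] at h3 ⊢
        simp only [ne_eq, OfNat.ofNat_ne_zero, not_false_eq_true, zero_pow, mul_zero, zero_mul,
          zero_add, add_zero] at h3 ⊢
        refine h3.congr' ?_
        filter_upwards [self_mem_nhdsWithin] with s hs
        have hs' : s ≠ 0 := hs
        rw [slope_def_field]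
        field_simp
        ring
      · have h2 : HasDerivAt (fun s : ℝ => P1 (B * (‖x0‖ ^ 2 + 2 * x0 i * s + s ^ 2)))
            (P2 * (B * (2 * x0 i + 2 * 0))) 0 := by
          refine HasDerivAt.comp (h₂ := P1) (0 : ℝ) ?_ (hq 0)
          simpa using hP2 hx
        have h3 : HasDerivAt (fun s : ℝ => B * (2 * x0 i + 2 * s)) (B * 2) 0 := by
          simpa using (((hasDerivAt_id (0 : ℝ)).const_mul 2).const_add (2 * x0 i)).const_mul B
        refine (h2.mul h3).congr_deriv ?_
        simp only [mul_zero, add_zero, ne_eq, OfNat.ofNat_ne_zero, not_false_eq_true, zero_pow]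
        ring
    linarith [second_deriv_nonpos_of_isLocalMax hmax hd1 hd2]
  unfold lap
  refine (Finset.sum_le_sum fun i _ => key i).trans (le_of_eq ?_)
  rw [← Finset.mul_sum, Finset.sum_add_distrib, ← Finset.mul_sum, ← Finset.mul_sum,
    ← EuclideanSpace.real_norm_sq_eq]
  simp
  ring

lemma rpow_sub_rpow_le_mul_sub {q z P : ℝ} (hq : 0 < q) (hP : 0 < P) (hPz : P ≤ z) :
    z ^ q - P ^ q ≤ max q 1 * z ^ (q - 1) * (z - P) := by
  have hz : 0 < z := hP.trans_le hPz
  have h1 : 1 - max q 1 * (1 - P / z) ≤ (P / z) ^ max q 1 := by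
    have := one_add_mul_self_le_rpow_one_add (s := P / z - 1) (by linarith [div_pos hP hz])
      (le_max_right q 1)
    rw [add_sub_cancel] at this
    linarith
  have h2 : (P / z) ^ max q 1 ≤ (P / z) ^ q :=
    Real.rpow_le_rpow_of_exponent_ge (div_pos hP hz) ((div_le_one hz).2 hPz) (le_max_left q 1)
  have h3 : P ^ q = z ^ q * (P / z) ^ q := by
    rw [← Real.mul_rpow hz.le (div_pos hP hz).le, mul_div_cancel₀ _ hz.ne']
  have h4 : z ^ q = z ^ (q - 1) * z := by
    rw [← Real.rpow_add_one hz.ne']; congr 1; ring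
  have h5 : max q 1 * z ^ (q - 1) * (z - P) = z ^ q * (max q 1 * (1 - P / z)) := by
    rw [h4]; field_simp
  rw [h5, h3]
  nlinarith [Real.rpow_pos_of_pos hz q]

/-- The perturbed profile `z - ε (E - h)` is a strict supersolution of the profile equation. -/
lemma perturbed_profile_strict {a ε E h α β σ q N z z1 z2 P : ℝ} (hq : 0 < q) (ha : 0 < a)
    (hε : 0 < ε) (hE : 0 < E) (h0 : 0 ≤ h) (hhE : h ≤ E) (hα : 0 ≤ α) (hβ : 0 ≤ β) (hσ : 0 ≤ σ)
    (hP : 0 < P) (hPdef : P = z - ε * (E - h))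
    (hode : 4 * σ * z2 + 2 * N * z1 + α * z ^ (q + 1) + 2 * β * σ * ((q + 1) * z ^ q * z1) = 0)
    (hbig : (q + 1) * z ^ q + 2 * β * (q + 1) * max q 1 * |σ * z1| * z ^ (q - 1) < 2 * N * a) :
    4 * σ * (z2 - ε * a ^ 2 * E) + 2 * N * (z1 - ε * a * E) <
      -(α * P ^ (q + 1) + (q + 1) * P ^ q * (2 * β * σ * (z1 - ε * a * E) + ε * h)) := by
  have hPz : P ≤ z := by rw [hPdef]; nlinarith
  have hz : 0 < z := hP.trans_le hPz
  have k1 : P ^ (q + 1) ≤ z ^ (q + 1) := Real.rpow_le_rpow hP.le hPz (by linarith)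
  have k2 : P ^ q ≤ z ^ q := Real.rpow_le_rpow hP.le hPz hq.le
  have k3 := rpow_sub_rpow_le_mul_sub hq hP hPz
  have hPq : 0 < P ^ q := Real.rpow_pos_of_pos hP q
  have hzq : 0 < z ^ (q - 1) := Real.rpow_pos_of_pos hz _
  have hzP : z - P ≤ ε * E := by rw [hPdef]; nlinarith
  have hm : 0 < max q 1 := lt_max_of_lt_left hq
  have k4 : z ^ q - P ^ q ≤ max q 1 * z ^ (q - 1) * (ε * E) :=
    k3.trans (mul_le_mul_of_nonneg_left hzP (by positivity))
  have k5 : (σ * z1) * (P ^ q - z ^ q) ≤ |σ * z1| * (max q 1 * z ^ (q - 1) * (ε * E)) := by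
    calc (σ * z1) * (P ^ q - z ^ q) ≤ |(σ * z1) * (P ^ q - z ^ q)| := le_abs_self _
      _ = |σ * z1| * (z ^ q - P ^ q) := by
        rw [abs_mul, abs_sub_comm, abs_of_nonneg (sub_nonneg.2 k2)]
      _ ≤ _ := mul_le_mul_of_nonneg_left k4 (abs_nonneg _)
  have k6 : h * P ^ q ≤ E * z ^ q := mul_le_mul hhE k2 hPq.le hE.le
  have k7 : α * (P ^ (q + 1) - z ^ (q + 1)) ≤ 0 :=
    mul_nonpos_of_nonneg_of_nonpos hα (by linarith)
  have k8 := mul_le_mul_of_nonneg_left k5 (show 0 ≤ 2 * β * (q + 1) by positivity)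
  have k9 := mul_le_mul_of_nonneg_left k6 (show 0 ≤ ε * (q + 1) by positivity)
  have k10 := mul_lt_mul_of_pos_left hbig (show 0 < ε * E by positivity)
  have k11 : 0 ≤ 2 * β * σ * (ε * a * E) * ((q + 1) * P ^ q) := by positivity
  have k12 : 0 ≤ 4 * σ * (ε * a ^ 2 * E) := by positivity
  nlinarith

set_option maxHeartbeats 1000000 in
/-- At a first contact from below, a solution cannot touch the perturbed self-similar barrier. -/
lemma no_contact {n : ℕ} {m β α T A a ε h : ℝ} (hm0 : 0 < m) (hm1 : m < 1)
    (hα : α * (1 - m) = 2 * β + 1) (hβ : 0 < β) (hA : 0 < A) (ha : 0 < a) (hε : 0 < ε)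
    {Z Z1 Z2 : ℝ → ℝ} (hZ : ∀ σ, 0 ≤ σ → HasDerivAt Z (Z1 σ) σ) (hZ1c : Continuous Z1)
    (hZ1 : ∀ σ, 0 < σ → HasDerivAt Z1 (Z2 σ) σ)
    (hode : ∀ σ, 0 ≤ σ → 4 * σ * Z2 σ + 2 * n * Z1 σ + α * Z σ ^ (1 / m)
        + 2 * β * σ * (1 / m * Z σ ^ (1 / m - 1) * Z1 σ) = 0)
    {u : EuclideanSpace ℝ (Fin n) → ℝ → ℝ} {x0 : EuclideanSpace ℝ (Fin n)} {t0 : ℝ}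
    (ht0 : t0 < T) (hupos : 0 < u x0 t0)
    (hsm : ContDiffAt ℝ 2 (fun p : EuclideanSpace ℝ (Fin n) × ℝ => u p.1 p.2) (x0, t0))
    (hpde : deriv (u x0) t0 = lap n (fun y => u y t0 ^ m) x0)
    {s : ℝ} (hs : s = A ^ (1 - m) * (T - t0) ^ (2 * β) * ‖x0‖ ^ 2)
    {H : ℝ} (hh : h = H * (T - t0)) (hH : 0 ≤ H) (hhE : h ≤ exp (a * s))
    (hbig : 1 / m * Z s ^ (1 / m - 1) + 2 * β * (1 / m) * max (1 / m - 1) 1 * |s * Z1 s|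
      * Z s ^ (1 / m - 1 - 1) < 2 * n * a)
    (heq : u x0 t0 ^ m = (A * (T - t0) ^ α) ^ m * (Z s - ε * (exp (a * s) - h)))
    (hle : ∀ᶠ x in 𝓝 x0, u x t0 ^ m ≤ (A * (T - t0) ^ α) ^ m *
      (Z (A ^ (1 - m) * (T - t0) ^ (2 * β) * ‖x‖ ^ 2)
        - ε * (exp (a * (A ^ (1 - m) * (T - t0) ^ (2 * β) * ‖x‖ ^ 2)) - h)))
    (htime : ∀ᶠ t in 𝓝[<] t0, u x0 t ^ m < (A * (T - t) ^ α) ^ m *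
      (Z (A ^ (1 - m) * (T - t) ^ (2 * β) * ‖x0‖ ^ 2)
        - ε * (exp (a * (A ^ (1 - m) * (T - t) ^ (2 * β) * ‖x0‖ ^ 2)) - H * (T - t)))) :
    False := by
  have hρ : 0 < T - t0 := sub_pos.2 ht0
  have hq : 0 < 1 / m - 1 := by
    rw [sub_pos, lt_div_iff₀ hm0]; linarith
  have hα0 : 0 ≤ α := by
    by_contra! hneg
    nlinarith
  set c := A * (T - t0) ^ α with hc
  have hc0 : 0 < c := mul_pos hA (Real.rpow_pos_of_pos hρ _)
  set b := A ^ (1 - m) * (T - t0) ^ (2 * β) with hb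
  have hb0 : 0 < b := mul_pos (Real.rpow_pos_of_pos hA _) (Real.rpow_pos_of_pos hρ _)
  have hs0 : 0 ≤ s := by rw [hs]; positivity
  have hcb : c ^ m * b = c / (T - t0) := by
    rw [eq_div_iff hρ.ne']
    have h1 : c ^ (1 - m) = b * (T - t0) := by
      rw [hc, hb, Real.mul_rpow hA.le (Real.rpow_pos_of_pos hρ _).le, ← Real.rpow_mul hρ.le, hα,
        Real.rpow_add_one hρ.ne', mul_assoc]
    rw [mul_assoc, ← h1, ← Real.rpow_add hc0]
    simp
  set E := exp (a * s) with hE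
  have hE0 : 0 < E := exp_pos _
  set P := Z s - ε * (E - h) with hP
  have hcm : 0 < c ^ m := Real.rpow_pos_of_pos hc0 m
  have hP0 : 0 < P := by
    have h1 : 0 < c ^ m * P := heq ▸ Real.rpow_pos_of_pos hupos m
    exact (pos_iff_pos_of_mul_pos h1).1 hcm
  have hu : u x0 t0 = c * P ^ (1 / m) := by
    have h1 : (u x0 t0 ^ m) ^ (1 / m) = u x0 t0 := by
      rw [← Real.rpow_mul hupos.le, mul_one_div_cancel hm0.ne', Real.rpow_one]
    rw [← h1, heq, Real.mul_rpow hcm.le hP0.le, ← Real.rpow_mul hc0.le,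
      mul_one_div_cancel hm0.ne', Real.rpow_one]
  have hh0 : 0 ≤ h := by rw [hh]; positivity
  have hexpd : ∀ σ : ℝ, HasDerivAt (fun σ => exp (a * σ)) (a * exp (a * σ)) σ := fun σ => by
    simpa [mul_comm] using ((hasDerivAt_id σ).const_mul a).exp
  have hstrict := perturbed_profile_strict (N := n) (z2 := Z2 s) hq ha hε hE0 hh0 hhE hα0 hβ.le hs0
    hP0 hP (by rw [sub_add_cancel]; exact hode s hs0) (by rw [sub_add_cancel]; exact hbig)
  rw [sub_add_cancel] at hstrict
  -- the Laplacian
  have hlap : lap n (fun y => u y t0 ^ m) x0 ≤ c / (T - t0) *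
      (4 * s * (Z2 s - ε * a ^ 2 * E) + 2 * n * (Z1 s - ε * a * E)) := by
    have hsx : ContDiffAt ℝ 2 (fun y => u y t0 ^ m) x0 := by
      have h1 : ContDiffAt ℝ 2 (fun y : EuclideanSpace ℝ (Fin n) => (y, t0)) x0 :=
        contDiffAt_id.prodMk contDiffAt_const
      have h2 : ContDiffAt ℝ 2 (fun y => u y t0) x0 :=
        ContDiffAt.comp (g := fun p : EuclideanSpace ℝ (Fin n) × ℝ => u p.1 p.2) x0 hsm h1
      exact h2.rpow_const_of_ne hupos.ne'
    have h2 := lap_le_of_contact (P := fun σ => Z σ - ε * (exp (a * σ) - h))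
      (P1 := fun σ => Z1 σ - ε * (a * exp (a * σ))) (P2 := Z2 s - ε * (a * (a * E)))
      (B := b) (C := c ^ m) hsx hb0
      (fun σ hσ => (hZ σ hσ).sub (((hexpd σ).sub_const h).const_mul ε))
      (by fun_prop)
      (fun hx => by
        rw [← hs]
        refine (hZ1 s ?_).sub (((hexpd s).const_mul a).const_mul ε)
        have := norm_pos_iff.2 hx
        rw [hs]; positivity)
      hle (by rw [← hs]; exact heq)
    rw [hcb, ← hs] at h2
    refine h2.trans (le_of_eq ?_)
    ring
  -- the time derivative
  have hut : HasDerivAt (u x0) (deriv (u x0) t0) t0 := by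
    have h1 : ContDiffAt ℝ 2 (fun t : ℝ => (x0, t)) t0 := contDiffAt_const.prodMk contDiffAt_id
    have h2 : ContDiffAt ℝ 2 (u x0) t0 :=
      ContDiffAt.comp (g := fun p : EuclideanSpace ℝ (Fin n) × ℝ => u p.1 p.2) t0 hsm h1
    exact (h2.differentiableAt (by norm_num)).hasDerivAt
  have hTt : HasDerivAt (fun t : ℝ => T - t) (-1) t0 := by
    simpa using (hasDerivAt_id t0).const_sub T
  have hsd : HasDerivAt (fun t => A ^ (1 - m) * (T - t) ^ (2 * β) * ‖x0‖ ^ 2)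
      (-(2 * β * s / (T - t0))) t0 := by
    refine (((hTt.rpow_const (p := 2 * β) (Or.inl hρ.ne')).const_mul (A ^ (1 - m))).mul_const
      (‖x0‖ ^ 2)).congr_deriv ?_
    rw [hs, hb, Real.rpow_sub_one hρ.ne']
    field_simp
  have hcd : HasDerivAt (fun t => (A * (T - t) ^ α) ^ m) (-(m * α * c ^ m / (T - t0))) t0 := by
    refine (((hTt.rpow_const (p := α) (Or.inl hρ.ne')).const_mul A).rpow_const (p := m)
      (Or.inl hc0.ne')).congr_deriv ?_
    rw [Real.rpow_sub_one hρ.ne', Real.rpow_sub_one (by rw [← hc]; exact hc0.ne'), ← hc]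
    have : c ≠ 0 := hc0.ne'
    have h3 : A * (T - t0) ^ α = c := hc.symm
    field_simp
    linear_combination -(m * α * c ^ m) * h3
  have hPd : HasDerivAt (fun t => Z (A ^ (1 - m) * (T - t) ^ (2 * β) * ‖x0‖ ^ 2)
        - ε * (exp (a * (A ^ (1 - m) * (T - t) ^ (2 * β) * ‖x0‖ ^ 2)) - H * (T - t)))
      (-((2 * β * s * (Z1 s - ε * a * E) + ε * h) / (T - t0))) t0 := by
    have h1 : HasDerivAt Z (Z1 s) (A ^ (1 - m) * (T - t0) ^ (2 * β) * ‖x0‖ ^ 2) := by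
      have := hZ s hs0
      rw [hs] at this ⊢
      exact this
    have h2 : HasDerivAt (fun σ => exp (a * σ)) (a * E)
        (A ^ (1 - m) * (T - t0) ^ (2 * β) * ‖x0‖ ^ 2) := by
      have := hexpd s
      rw [hs] at this
      rw [hE, hs]
      exact this
    refine ((h1.comp t0 hsd).sub ((((h2.comp t0 hsd).sub (hTt.const_mul H))).const_mul
      ε)).congr_deriv ?_
    rw [hh]
    field_simp
    ring
  have hgd := (hcd.mul hPd).sub (hut.rpow_const (p := m) (Or.inl hupos.ne'))
  have hg := deriv_nonpos_of_pos_left hgd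
    (by
      simp only [Pi.mul_apply, Pi.sub_apply]
      rw [← hb, ← hs, ← hc, ← hh, heq, sub_self])
    (htime.mono fun t ht => sub_pos.2 ht)
  rw [← hb, ← hs, ← hc, ← hh, ← hE, ← hP] at hg
  rw [hpde] at hg
  have hPP : P ^ (1 / m) = P ^ (1 / m - 1) * P := by
    rw [← Real.rpow_add_one hP0.ne']; congr 1; ring
  have hum : u x0 t0 ^ (m - 1) * c * P ^ (1 / m - 1) = c ^ m := by
    have h1 : u x0 t0 ^ (m - 1) * u x0 t0 = c ^ m * P := by
      rw [← Real.rpow_add_one hupos.ne', ← heq]; congr 1; ring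
    have h2 : u x0 t0 ^ (m - 1) * c * P ^ (1 / m - 1) * P = c ^ m * P := by
      rw [← h1]
      nth_rewrite 3 [hu]
      rw [hPP]; ring
    exact mul_right_cancel₀ hP0.ne' h2
  have hU : 0 < u x0 t0 ^ (m - 1) := Real.rpow_pos_of_pos hupos _
  have hfin := mul_le_mul_of_nonneg_left hlap (show 0 ≤ m * u x0 t0 ^ (m - 1) by positivity)
  have hst := mul_lt_mul_of_pos_left hstrict
    (show 0 < m * u x0 t0 ^ (m - 1) * (c / (T - t0)) by positivity)
  have hmm : m * (1 / m) = 1 := mul_one_div_cancel hm0.ne'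
  set W := 2 * β * s * (Z1 s - ε * a * E) + ε * h with hW
  have hkey : m * u x0 t0 ^ (m - 1) * (c / (T - t0)) *
      -(α * P ^ (1 / m) + 1 / m * P ^ (1 / m - 1) * W)
      = -(m * α * c ^ m / (T - t0)) * P + c ^ m * -(W / (T - t0)) := by
    rw [hPP, ← hum]
    field_simp
    ring
  rw [hkey] at hst
  linarith

/-- Comparison with the perturbed self-similar barrier. -/
lemma le_perturbed_barrier {n : ℕ} {m β α T A a ε s₁ s₂ K ρ₀ : ℝ} (hm0 : 0 < m) (hm1 : m < 1)
    (hα : α * (1 - m) = 2 * β + 1) (hβ : 0 < β) (hA : 0 < A) (ha : 0 < a) (hε : 0 < ε)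
    {Z Z1 Z2 : ℝ → ℝ} (hZ : ∀ σ, 0 ≤ σ → HasDerivAt Z (Z1 σ) σ) (hZ1c : Continuous Z1)
    (hZ1 : ∀ σ, 0 < σ → HasDerivAt Z1 (Z2 σ) σ)
    (hode : ∀ σ, 0 ≤ σ → 4 * σ * Z2 σ + 2 * n * Z1 σ + α * Z σ ^ (1 / m)
        + 2 * β * σ * (1 / m * Z σ ^ (1 / m - 1) * Z1 σ) = 0)
    (hs : s₁ < s₂) (hK : K = exp (a * s₁)) (hρ0 : 0 < ρ₀) (hρT : ρ₀ < T)
    (hbig : ∀ s ∈ Icc 0 s₂, 1 / m * Z s ^ (1 / m - 1)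
      + 2 * β * (1 / m) * max (1 / m - 1) 1 * |s * Z1 s| * Z s ^ (1 / m - 1 - 1) < 2 * n * a)
    {u0 : EuclideanSpace ℝ (Fin n) → ℝ} {u : EuclideanSpace ℝ (Fin n) → ℝ → ℝ}
    (hu : IsCauchySolution n m T u0 u)
    (hle : ∀ x, ∀ t ∈ Ico (T - ρ₀) T, u x t ^ m ≤ (A * (T - t) ^ α) ^ m *
      Z (A ^ (1 - m) * (T - t) ^ (2 * β) * ‖x‖ ^ 2))
    (hgap : ∀ x, ∀ t ∈ Ico (T - ρ₀) T, A ^ (1 - m) * (T - t) ^ (2 * β) * ‖x‖ ^ 2 ∈ Icc s₁ s₂ →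
      u x t ^ m < (A * (T - t) ^ α) ^ m *
        (Z (A ^ (1 - m) * (T - t) ^ (2 * β) * ‖x‖ ^ 2)
          - ε * exp (a * (A ^ (1 - m) * (T - t) ^ (2 * β) * ‖x‖ ^ 2))))
    (x : EuclideanSpace ℝ (Fin n)) {t : ℝ} (ht : t ∈ Ico (T - ρ₀) T)
    (hx : A ^ (1 - m) * (T - t) ^ (2 * β) * ‖x‖ ^ 2 ≤ s₂) :
    u x t ^ m ≤ (A * (T - t) ^ α) ^ m *
      (Z (A ^ (1 - m) * (T - t) ^ (2 * β) * ‖x‖ ^ 2)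
        - ε * (exp (a * (A ^ (1 - m) * (T - t) ^ (2 * β) * ‖x‖ ^ 2)) - K / ρ₀ * (T - t))) := by
  set sg : EuclideanSpace ℝ (Fin n) × ℝ → ℝ :=
    fun p => A ^ (1 - m) * (T - p.2) ^ (2 * β) * ‖p.1‖ ^ 2 with hsg
  set D : EuclideanSpace ℝ (Fin n) × ℝ → ℝ := fun p => (A * (T - p.2) ^ α) ^ m *
      (Z (sg p) - ε * (exp (a * sg p) - K / ρ₀ * (T - p.2))) - u p.1 p.2 ^ m with hD
  suffices hmain : 0 ≤ D (x, t) from sub_nonneg.1 hmain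
  by_contra! hneg
  have hA' : 0 < A ^ (1 - m) := Real.rpow_pos_of_pos hA _
  have hK0 : 0 < K := hK ▸ exp_pos _
  have hsg0 : ∀ p : EuclideanSpace ℝ (Fin n) × ℝ, p.2 < T → 0 ≤ sg p := fun p hp => by
    have : 0 < (T - p.2) ^ (2 * β) := Real.rpow_pos_of_pos (sub_pos.2 hp) _
    positivity
  have hcpos : ∀ t, t < T → 0 < (A * (T - t) ^ α) ^ m := fun t ht =>
    Real.rpow_pos_of_pos (mul_pos hA (Real.rpow_pos_of_pos (sub_pos.2 ht) _)) _
  have hΩ : IsOpen ((univ : Set (EuclideanSpace ℝ (Fin n))) ×ˢ Ioo 0 T) :=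
    isOpen_univ.prod isOpen_Ioo
  have hmem : ∀ p : EuclideanSpace ℝ (Fin n) × ℝ, p.2 ∈ Ico (T - ρ₀) T →
      p ∈ (univ : Set (EuclideanSpace ℝ (Fin n))) ×ˢ Ioo 0 T := fun p hp =>
    ⟨mem_univ _, by linarith [hp.1], hp.2⟩
  have hsmooth : ∀ p : EuclideanSpace ℝ (Fin n) × ℝ, p.2 ∈ Ico (T - ρ₀) T →
      ContDiffAt ℝ 2 (fun p : EuclideanSpace ℝ (Fin n) × ℝ => u p.1 p.2) p := fun p hp =>
    (hu.smooth.contDiffAt (hΩ.mem_nhds (hmem p hp))).of_le ENat.LEInfty.out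
  have hsgc : ∀ p : EuclideanSpace ℝ (Fin n) × ℝ, p.2 < T → ContinuousAt sg p := fun p hp => by
    have h1 : ContinuousAt (fun p : EuclideanSpace ℝ (Fin n) × ℝ => (T - p.2) ^ (2 * β)) p :=
      ContinuousAt.rpow_const (by fun_prop) (Or.inl (sub_pos.2 hp).ne')
    exact (h1.const_mul _).mul (by fun_prop)
  have hDc : ∀ p : EuclideanSpace ℝ (Fin n) × ℝ, p.2 ∈ Ico (T - ρ₀) T → ContinuousAt D p := by
    intro p hp
    have h1 : ContinuousAt (fun p : EuclideanSpace ℝ (Fin n) × ℝ => (T - p.2) ^ α) p :=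
      ContinuousAt.rpow_const (by fun_prop) (Or.inl (sub_pos.2 hp.2).ne')
    have h2 : ContinuousAt (fun p : EuclideanSpace ℝ (Fin n) × ℝ => (A * (T - p.2) ^ α) ^ m) p :=
      (h1.const_mul A).rpow_const (Or.inr hm0.le)
    have h3 : ContinuousAt (fun p : EuclideanSpace ℝ (Fin n) × ℝ => u p.1 p.2 ^ m) p :=
      (hsmooth p hp).continuousAt.rpow_const (Or.inr hm0.le)
    have h4 : ContinuousAt (fun p => Z (sg p)) p :=
      ContinuousAt.comp (g := Z) (hZ _ (hsg0 p hp.2)).continuousAt (hsgc p hp.2)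
    have h5 : ContinuousAt (fun p => exp (a * sg p)) p := ((hsgc p hp.2).const_mul a).rexp
    have h6 : ContinuousAt (fun p : EuclideanSpace ℝ (Fin n) × ℝ => K / ρ₀ * (T - p.2)) p := by
      fun_prop
    exact (h2.mul (h4.sub ((h5.sub h6).const_mul ε))).sub h3
  -- the set where the barrier is not strictly above
  set R := s₂ / (A ^ (1 - m) * (T - t) ^ (2 * β)) with hR
  have hTt : 0 < T - t := sub_pos.2 ht.2
  have hbt : 0 < A ^ (1 - m) * (T - t) ^ (2 * β) := mul_pos hA' (Real.rpow_pos_of_pos hTt _)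
  set B : Set (EuclideanSpace ℝ (Fin n) × ℝ) :=
    Metric.closedBall 0 √R ×ˢ Icc (T - ρ₀) t with hB
  have hBc : IsCompact B := (isCompact_closedBall _ _).prod isCompact_Icc
  have hBI : ∀ p ∈ B, p.2 ∈ Ico (T - ρ₀) T := fun p hp => ⟨hp.2.1, hp.2.2.trans_lt ht.2⟩
  have hpair : ContinuousOn (fun p => (sg p, D p)) B := fun p hp =>
    ((hsgc p (hBI p hp).2).prodMk (hDc p (hBI p hp))).continuousWithinAt
  set F := B ∩ (fun p => (sg p, D p)) ⁻¹' (Iic s₂ ×ˢ Iic 0) with hF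
  have hFc : IsCompact F :=
    hBc.of_isClosed_subset (hpair.preimage_isClosed_of_isClosed hBc.isClosed
      (isClosed_Iic.prod isClosed_Iic)) inter_subset_left
  have hin : ∀ p : EuclideanSpace ℝ (Fin n) × ℝ, p.2 ∈ Icc (T - ρ₀) t → sg p ≤ s₂ → D p ≤ 0 →
      p ∈ F := by
    intro p hp h1 h2
    refine ⟨⟨?_, hp⟩, h1, h2⟩
    rw [mem_closedBall_zero_iff]
    refine Real.le_sqrt_of_sq_le ?_
    rw [hR, le_div_iff₀ hbt]
    refine le_trans ?_ h1
    have h3 : (T - t) ^ (2 * β) ≤ (T - p.2) ^ (2 * β) :=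
      Real.rpow_le_rpow hTt.le (by linarith [hp.2]) (by linarith)
    have h4 : A ^ (1 - m) * (T - t) ^ (2 * β) ≤ A ^ (1 - m) * (T - p.2) ^ (2 * β) :=
      mul_le_mul_of_nonneg_left h3 hA'.le
    calc ‖p.1‖ ^ 2 * (A ^ (1 - m) * (T - t) ^ (2 * β))
        ≤ ‖p.1‖ ^ 2 * (A ^ (1 - m) * (T - p.2) ^ (2 * β)) :=
          mul_le_mul_of_nonneg_left h4 (sq_nonneg _)
      _ = sg p := by rw [hsg]; ring
  have hFne : F.Nonempty := ⟨(x, t), hin (x, t) ⟨ht.1, le_rfl⟩ hx hneg.le⟩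
  obtain ⟨⟨x0, t0⟩, hpF, hmin⟩ := hFc.exists_isMinOn hFne (f := Prod.snd)
    continuous_snd.continuousOn
  have hs0 : sg (x0, t0) ≤ s₂ := hpF.2.1
  have hD0 : D (x0, t0) ≤ 0 := hpF.2.2
  have ht0 : t0 ∈ Icc (T - ρ₀) t := hpF.1.2
  have ht0I : t0 ∈ Ico (T - ρ₀) T := hBI _ hpF.1
  have hρ : 0 < T - t0 := sub_pos.2 ht0I.2
  have hH0 : 0 ≤ K / ρ₀ * (T - t0) := by positivity
  have hζ : K / ρ₀ * (T - t0) ≤ exp (a * sg (x0, t0)) := by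
    by_contra! hlt
    have h1 := hle x0 t0 ht0I
    have h2 : Z (sg (x0, t0)) < Z (sg (x0, t0))
        - ε * (exp (a * sg (x0, t0)) - K / ρ₀ * (T - t0)) := by nlinarith
    have h3 := mul_lt_mul_of_pos_left h2 (hcpos t0 ht0I.2)
    have h4 : u x0 t0 ^ m < (A * (T - t0) ^ α) ^ m * (Z (sg (x0, t0))
        - ε * (exp (a * sg (x0, t0)) - K / ρ₀ * (T - t0))) := h1.trans_lt h3
    exact hD0.not_gt (sub_pos.2 h4)
  have hs1 : sg (x0, t0) < s₁ := by
    by_contra! hge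
    have h1 := hgap x0 t0 ht0I ⟨hge, hs0⟩
    have h2 : Z (sg (x0, t0)) - ε * exp (a * sg (x0, t0)) ≤ Z (sg (x0, t0))
        - ε * (exp (a * sg (x0, t0)) - K / ρ₀ * (T - t0)) := by nlinarith
    have h3 := mul_le_mul_of_nonneg_left h2 (hcpos t0 ht0I.2).le
    have h4 : u x0 t0 ^ m < (A * (T - t0) ^ α) ^ m * (Z (sg (x0, t0))
        - ε * (exp (a * sg (x0, t0)) - K / ρ₀ * (T - t0))) := h1.trans_le h3
    exact hD0.not_gt (sub_pos.2 h4)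
  have ht0' : T - ρ₀ < t0 := by
    refine lt_of_le_of_ne ht0.1 fun h => ?_
    rw [show T - t0 = ρ₀ by rw [← h]; ring, div_mul_cancel₀ _ hρ0.ne', hK, Real.exp_le_exp] at hζ
    exact hs1.not_ge (le_of_mul_le_mul_left hζ ha)
  have hearlier : ∀ y : EuclideanSpace ℝ (Fin n), sg (y, t0) < s₂ →
      ∀ᶠ t' in 𝓝[<] t0, 0 < D (y, t') := by
    intro y hy
    have h1 : ContinuousAt (fun t' : ℝ => sg (y, t')) t0 :=
      ContinuousAt.comp (g := sg) (hsgc (y, t0) ht0I.2) (by fun_prop)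
    filter_upwards [(h1.eventually (gt_mem_nhds hy)).filter_mono nhdsWithin_le_nhds,
      Ioo_mem_nhdsLT ht0'] with t' h2 h3
    by_contra! h4
    have := hmin (hin (y, t') ⟨h3.1.le, h3.2.le.trans ht0.2⟩ h2.le h4)
    exact h3.2.not_ge this
  have hnonneg : ∀ y : EuclideanSpace ℝ (Fin n), sg (y, t0) < s₂ → 0 ≤ D (y, t0) := by
    intro y hy
    have h1 : ContinuousAt (fun t' : ℝ => D (y, t')) t0 :=
      ContinuousAt.comp (g := D) (hDc (y, t0) ht0I) (by fun_prop)
    exact ge_of_tendsto (h1.tendsto.mono_left nhdsWithin_le_nhds)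
      ((hearlier y hy).mono fun _ h => h.le)
  have hs12 := hs1.trans hs
  refine no_contact (h := K / ρ₀ * (T - t0)) (H := K / ρ₀) hm0 hm1 hα hβ hA ha hε hZ hZ1c hZ1
    hode ht0I.2 (hu.pos x0 t0 (hmem (x0, t0) ht0I).2) (hsmooth (x0, t0) ht0I)
    (hu.pde x0 t0 (hmem (x0, t0) ht0I).2) (s := sg (x0, t0)) rfl rfl (by positivity) hζ
    (hbig _ ⟨hsg0 (x0, t0) ht0I.2, hs0⟩)
    (sub_eq_zero.1 (hD0.antisymm (hnonneg x0 hs12))).symm ?_ ?_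
  · have h1 : ContinuousAt (fun y => sg (y, t0)) x0 :=
      ContinuousAt.comp (g := sg) (hsgc (x0, t0) ht0I.2) (by fun_prop)
    filter_upwards [h1.eventually (gt_mem_nhds hs12)] with y hy
    exact sub_nonneg.1 (hnonneg y hy)
  · filter_upwards [hearlier x0 hs12] with t' h
    exact sub_pos.1 h

/-- Rescaling of a radial function in terms of `r ↦ r ^ k * Z (r ^ 2)`. -/
lemma scaling_le_of_strictAntiOn {k S : ℝ} {Z : ℝ → ℝ}
    (hJ : StrictAntiOn (fun r : ℝ => r ^ k * Z (r ^ 2)) (Ici S)) (hS : 0 < S) {a b r : ℝ}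
    (hr : 0 < r) (hab : a ≤ b) (haS : S ≤ a * r) :
    b ^ k * Z (b ^ 2 * r ^ 2) ≤ a ^ k * Z (a ^ 2 * r ^ 2) := by
  have ha : 0 < a := (pos_iff_pos_of_mul_pos (hS.trans_le haS)).2 hr
  have hbr : a * r ≤ b * r := mul_le_mul_of_nonneg_right hab hr.le
  have h := hJ.antitoneOn (mem_Ici.2 haS) (mem_Ici.2 (haS.trans hbr)) hbr
  simp only [mul_pow] at h
  rw [Real.mul_rpow ha.le hr.le, Real.mul_rpow (ha.le.trans hab) hr.le] at h
  refine le_of_mul_le_mul_right ?_ (Real.rpow_pos_of_pos hr k)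
  linarith

lemma scaling_lt_of_strictAntiOn {k S : ℝ} {Z : ℝ → ℝ}
    (hJ : StrictAntiOn (fun r : ℝ => r ^ k * Z (r ^ 2)) (Ici S)) (hS : 0 < S) {b r : ℝ}
    (hb : 1 < b) (hr : S ≤ r) : b ^ k * Z (b ^ 2 * r ^ 2) < Z (r ^ 2) := by
  have hr0 : 0 < r := hS.trans_le hr
  have hbr : r < b * r := by nlinarith
  have h := hJ (mem_Ici.2 hr) (mem_Ici.2 (hr.trans hbr.le)) hbr
  simp only [mul_pow] at h
  rw [Real.mul_rpow (by linarith) hr0.le] at h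
  refine lt_of_mul_lt_mul_right ?_ (Real.rpow_pos_of_pos hr0 k).le
  linarith

/-- Choice of the parameters of the barrier. -/
lemma exists_barrier_constants {n : ℕ} {k q β S κ : ℝ} (hn : 0 < n) (hS : 0 < S) (hκ : 1 < κ)
    {Z Z1 : ℝ → ℝ} (hZpos : ∀ σ, 0 ≤ σ → 0 < Z σ)
    (hZ : ∀ σ, 0 ≤ σ → HasDerivAt Z (Z1 σ) σ) (hZ1c : Continuous Z1)
    (hJ : StrictAntiOn (fun r : ℝ => r ^ k * Z (r ^ 2)) (Ici S)) :
    ∃ a ε θ : ℝ, 0 < a ∧ 0 < ε ∧ 1 / 2 < θ ∧ θ < 1 ∧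
      (∀ s ∈ Icc 0 (4 * S ^ 2), (q + 1) * Z s ^ q
        + 2 * β * (q + 1) * max q 1 * |s * Z1 s| * Z s ^ (q - 1) < 2 * n * a) ∧
      (∀ s ∈ Icc (S ^ 2) (4 * S ^ 2), κ ^ k * Z (κ ^ 2 * s) < Z s - ε * exp (a * s)) ∧
      ∀ s ∈ Icc 0 (4 * S ^ 2), Z s - ε / 2 ≤ θ ^ k * Z (θ ^ 2 * s) := by
  have hZc : ∀ s, 0 ≤ s → ContinuousAt Z s := fun s hs => (hZ s hs).continuousAt
  have hZcI : ContinuousOn Z (Icc 0 (4 * S ^ 2)) := fun s hs => (hZc s hs.1).continuousWithinAt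
  obtain ⟨C, hC⟩ := (isCompact_Icc (a := (0 : ℝ)) (b := 4 * S ^ 2)).bddAbove_image
    (f := fun s => (q + 1) * Z s ^ q
        + 2 * β * (q + 1) * max q 1 * |s * Z1 s| * Z s ^ (q - 1)) (by
      have hne : ∀ s ∈ Icc 0 (4 * S ^ 2), Z s ≠ 0 := fun s hs => (hZpos s hs.1).ne'
      have h1 := hZcI.rpow_const (p := q) fun s hs => Or.inl (hne s hs)
      have h2 := hZcI.rpow_const (p := q - 1) fun s hs => Or.inl (hne s hs)
      have h3 : Continuous fun s => 2 * β * (q + 1) * max q 1 * |s * Z1 s| := by fun_prop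
      exact (h1.const_mul _).add (h3.continuousOn.mul h2))
  have hn' : (1 : ℝ) ≤ n := by exact_mod_cast hn
  set a := max C 1 with ha
  have ha1 : 1 ≤ a := le_max_right _ _
  have hS2 : 0 < S ^ 2 := by positivity
  -- the gap to the outer solution
  obtain ⟨s₀, hs₀, hmin⟩ := (isCompact_Icc (a := S ^ 2) (b := 4 * S ^ 2)).exists_isMinOn
    (nonempty_Icc.2 (by linarith)) (f := fun s => (Z s - κ ^ k * Z (κ ^ 2 * s)) / exp (a * s)) (by
      intro s hs
      have hs0 : 0 ≤ s := hS2.le.trans hs.1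
      have h1 : ContinuousAt (fun s => Z (κ ^ 2 * s)) s :=
        ContinuousAt.comp (g := Z) (hZc _ (by positivity)) (by fun_prop)
      have h2 : ContinuousAt (fun s => exp (a * s)) s := by fun_prop
      exact (((hZc s hs0).sub (h1.const_mul (κ ^ k))).div h2 (exp_pos _).ne').continuousWithinAt)
  set δ := (Z s₀ - κ ^ k * Z (κ ^ 2 * s₀)) / exp (a * s₀) with hδ
  have hδ0 : 0 < δ := by
    have h1 := scaling_lt_of_strictAntiOn hJ hS hκ (Real.le_sqrt_of_sq_le hs₀.1)
    rw [Real.sq_sqrt (hS2.le.trans hs₀.1)] at h1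
    exact div_pos (sub_pos.2 h1) (exp_pos _)
  -- the shrinking factor
  have hθ : ∀ᶠ θ in 𝓝 (1 : ℝ), ∀ s ∈ Icc 0 (4 * S ^ 2),
      Z s - δ / 2 / 2 < θ ^ k * Z (θ ^ 2 * s) := by
    refine isCompact_Icc.eventually_forall_of_forall_eventually fun s hs => ?_
    have h1 : ContinuousAt (fun z : ℝ × ℝ => z.1 ^ k * Z (z.1 ^ 2 * z.2)) (1, s) := by
      have h2 : ContinuousAt (fun z : ℝ × ℝ => z.1 ^ k) (1, s) :=
        continuousAt_fst.rpow_const (Or.inl one_ne_zero)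
      refine h2.mul (ContinuousAt.comp (g := Z) (hZc _ ?_) (by fun_prop))
      simpa using hs.1
    have h3 : ContinuousAt (fun z : ℝ × ℝ => Z z.2 - δ / 2 / 2) (1, s) :=
      (ContinuousAt.comp (g := Z) (hZc _ hs.1) continuousAt_snd).sub continuousAt_const
    exact h3.eventually_lt h1 (by simp; linarith)
  obtain ⟨θ, ⟨hθ1, hθ2⟩, hθ3⟩ := (Filter.Eventually.and
    (Ioo_mem_nhdsLT (show (1 / 2 : ℝ) < 1 by norm_num) : ∀ᶠ θ in 𝓝[<] 1, θ ∈ Ioo (1 / 2 : ℝ) 1)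
    (hθ.filter_mono nhdsWithin_le_nhds)).exists
  refine ⟨a, δ / 2, θ, by linarith, by linarith, hθ1, hθ2, ?_, ?_, fun s hs => (hθ3 s hs).le⟩
  · intro s hs
    have h1 := hC (mem_image_of_mem _ hs)
    have h2 := le_max_left C 1
    nlinarith
  · intro s hs
    have h1 : δ ≤ (Z s - κ ^ k * Z (κ ^ 2 * s)) / exp (a * s) := hmin hs
    rw [le_div_iff₀ (exp_pos _)] at h1
    nlinarith [exp_pos (a * s)]

/-- The `m`-th power of the self-similar solution with parameter `ν`, in terms of the radial
function `Z` of the profile with parameter `1`. -/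
noncomputable def selfSimilarPow {n : ℕ} (m β α T : ℝ) (Z : ℝ → ℝ) (ν : ℝ)
    (x : EuclideanSpace ℝ (Fin n)) (t : ℝ) : ℝ :=
  (ν ^ (2 / (1 - m)) * (T - t) ^ α) ^ m *
    Z ((ν ^ (2 / (1 - m))) ^ (1 - m) * (T - t) ^ (2 * β) * ‖x‖ ^ 2)

lemma rpow_rpow_one_sub {m ν : ℝ} (hm1 : m < 1) (hν : 0 ≤ ν) :
    (ν ^ (2 / (1 - m))) ^ (1 - m) = ν ^ 2 := by
  rw [← Real.rpow_mul hν, div_mul_cancel₀ _ (sub_pos.2 hm1).ne']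
  norm_cast

lemma selfSimilarPow_mul {n : ℕ} {m β α T : ℝ} (hm1 : m < 1) (Z : ℝ → ℝ) {c μ : ℝ} (hc : 0 ≤ c)
    (hμ : 0 ≤ μ) (x : EuclideanSpace ℝ (Fin n)) {t : ℝ} (ht : t < T) :
    selfSimilarPow m β α T Z (c * μ) x t = (μ ^ (2 / (1 - m)) * (T - t) ^ α) ^ m *
      (c ^ (2 * m / (1 - m)) *
        Z (c ^ 2 * ((μ ^ (2 / (1 - m))) ^ (1 - m) * (T - t) ^ (2 * β) * ‖x‖ ^ 2))) := by
  have hT : 0 ≤ (T - t) ^ α := Real.rpow_nonneg (sub_pos.2 ht).le _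
  have hμ' : 0 ≤ μ ^ (2 / (1 - m)) := Real.rpow_nonneg hμ _
  have hc' : 0 ≤ c ^ (2 / (1 - m)) := Real.rpow_nonneg hc _
  unfold selfSimilarPow
  rw [rpow_rpow_one_sub hm1 (mul_nonneg hc hμ), rpow_rpow_one_sub hm1 hμ, Real.mul_rpow hc hμ,
    mul_assoc (c ^ (2 / (1 - m))), Real.mul_rpow hc' (mul_nonneg hμ' hT), ← Real.rpow_mul hc,
    div_mul_eq_mul_div, mul_pow, show c ^ 2 * μ ^ 2 * (T - t) ^ (2 * β) * ‖x‖ ^ 2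
      = c ^ 2 * (μ ^ 2 * (T - t) ^ (2 * β) * ‖x‖ ^ 2) by ring]
  ring

lemma Uself_rpow {n : ℕ} {m β α T ν : ℝ} (hm1 : m < 1) {f : ℝ → ℝ → ℝ}
    (hpos : ∀ r, 0 ≤ r → 0 < f 1 r) (hscale : ∀ r, 0 ≤ r → f ν r = ν ^ (2 / (1 - m)) * f 1 (ν * r))
    {Z : ℝ → ℝ} (hZf : ∀ r, 0 ≤ r → Z (r ^ 2) = f 1 r ^ m) (hν : 0 < ν)
    (x : EuclideanSpace ℝ (Fin n)) {t : ℝ} (ht : t < T) :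
    Uself n β α T (f ν) x t ^ m = selfSimilarPow m β α T Z ν x t := by
  have hT : 0 < T - t := sub_pos.2 ht
  have hTβ : 0 < (T - t) ^ β := Real.rpow_pos_of_pos hT β
  have h1 : (T - t) ^ (2 * β) = ((T - t) ^ β) ^ 2 := by
    rw [mul_comm, Real.rpow_mul hT.le]; norm_cast
  have h2 : 0 ≤ ν * ((T - t) ^ β * ‖x‖) := by positivity
  unfold Uself selfSimilarPow
  rw [hscale _ (by positivity), rpow_rpow_one_sub hm1 hν.le, h1,
    show ν ^ 2 * ((T - t) ^ β) ^ 2 * ‖x‖ ^ 2 = (ν * ((T - t) ^ β * ‖x‖)) ^ 2 by ring, hZf _ h2,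
    ← Real.mul_rpow (by positivity) (hpos _ h2).le]
  ring_nf

/-- A solution below `U_μ` and `U_Λ`, `μ < Λ`, is below `U_{θ ^ j μ}` close to the extinction
time. -/
lemma le_selfSimilarPow_shrink {n : ℕ} {m β α T k S lam1 lam2 : ℝ} (hn : 0 < n) (hm0 : 0 < m)
    (hm1 : m < 1) (hα : α * (1 - m) = 2 * β + 1) (hβ : 0 < β) (hT : 0 < T)
    (hk : k = 2 * m / (1 - m)) {Z Z1 Z2 : ℝ → ℝ} (hZpos : ∀ σ, 0 ≤ σ → 0 < Z σ)
    (hZ : ∀ σ, 0 ≤ σ → HasDerivAt Z (Z1 σ) σ) (hZ1c : Continuous Z1)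
    (hZ1 : ∀ σ, 0 < σ → HasDerivAt Z1 (Z2 σ) σ)
    (hode : ∀ σ, 0 ≤ σ → 4 * σ * Z2 σ + 2 * n * Z1 σ + α * Z σ ^ (1 / m)
        + 2 * β * σ * (1 / m * Z σ ^ (1 / m - 1) * Z1 σ) = 0)
    (hS : 0 < S) (hJ : StrictAntiOn (fun r : ℝ => r ^ k * Z (r ^ 2)) (Ici S))
    (hlam1 : 0 < lam1) (h12 : lam1 < lam2)
    {u0 : EuclideanSpace ℝ (Fin n) → ℝ} {u : EuclideanSpace ℝ (Fin n) → ℝ → ℝ}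
    (hu : IsCauchySolution n m T u0 u)
    (hle1 : ∀ x, ∀ t ∈ Ioo 0 T, u x t ^ m ≤ selfSimilarPow m β α T Z lam1 x t)
    (hle2 : ∀ x, ∀ t ∈ Ioo 0 T, u x t ^ m ≤ selfSimilarPow m β α T Z lam2 x t) :
    ∃ θ : ℝ, 0 < θ ∧ θ < 1 ∧ ∀ j : ℕ, ∃ ρ, 0 < ρ ∧ ρ < T ∧ ∀ x, ∀ t ∈ Ico (T - ρ) T,
      u x t ^ m ≤ selfSimilarPow m β α T Z (θ ^ j * lam1) x t := by
  obtain ⟨a, ε, θ, ha, hε, hθ, hθ1, hbig, hgap, hshrink⟩ :=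
    exists_barrier_constants (q := 1 / m - 1) (β := β) hn hS ((one_lt_div hlam1).2 h12) hZpos hZ
      hZ1c hJ
  simp only [sub_add_cancel] at hbig
  have hθ0 : 0 < θ := by linarith
  refine ⟨θ, hθ0, hθ1, fun j => ?_⟩
  induction j with
  | zero =>
    refine ⟨T / 2, by linarith, by linarith, fun x t ht => ?_⟩
    rw [pow_zero, one_mul]
    exact hle1 x t ⟨by linarith [ht.1], ht.2⟩
  | succ j ih =>
    obtain ⟨ρ, hρ, hρT, hj⟩ := ih
    set μ := θ ^ j * lam1 with hμ
    have hμ0 : 0 < μ := by positivity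
    have hμ1 : μ ≤ lam1 := mul_le_of_le_one_left hlam1.le (pow_le_one₀ hθ0.le hθ1.le)
    set K := exp (a * S ^ 2) with hK
    have hK1 : 1 ≤ K := Real.one_le_exp (by positivity)
    have hK0 : 0 < K := by linarith
    have hρK : ρ / (2 * K) ≤ ρ := div_le_self hρ.le (by linarith)
    refine ⟨ρ / (2 * K), by positivity, hρK.trans_lt hρT, fun x t ht => ?_⟩
    have htT : 0 < T - t := sub_pos.2 ht.2
    set ρ₀ := 2 * K * (T - t) with hρ₀
    have hρ₀0 : 0 < ρ₀ := by positivity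
    have hρ₀ρ : ρ₀ ≤ ρ := by
      have h1 : T - t ≤ ρ / (2 * K) := by linarith [ht.1]
      rw [le_div_iff₀ (by positivity)] at h1
      linarith
    have htρ₀ : t ∈ Ico (T - ρ₀) T := ⟨by nlinarith, ht.2⟩
    have hIoo : ∀ t' ∈ Ico (T - ρ₀) T, t' ∈ Ioo 0 T := fun t' ht' =>
      ⟨by linarith [ht'.1], ht'.2⟩
    set A := μ ^ (2 / (1 - m)) with hA
    have hA0 : 0 < A := Real.rpow_pos_of_pos hμ0 _
    have hA' : 0 < A ^ (1 - m) := Real.rpow_pos_of_pos hA0 _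
    have hc : ∀ t', t' < T → 0 < (A * (T - t') ^ α) ^ m := fun t' ht' =>
      Real.rpow_pos_of_pos (mul_pos hA0 (Real.rpow_pos_of_pos (sub_pos.2 ht') _)) _
    -- the outer solution is below every smaller one far out
    have houter : ∀ c, c ≤ lam2 / lam1 → ∀ y, ∀ t' ∈ Ico (T - ρ₀) T,
        S ≤ c * √(A ^ (1 - m) * (T - t') ^ (2 * β) * ‖y‖ ^ 2) →
        u y t' ^ m ≤ (A * (T - t') ^ α) ^ m *
          (c ^ k * Z (c ^ 2 * (A ^ (1 - m) * (T - t') ^ (2 * β) * ‖y‖ ^ 2))) := by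
      intro c hc1 y t' ht' hcS
      have hσ : 0 ≤ A ^ (1 - m) * (T - t') ^ (2 * β) * ‖y‖ ^ 2 := by
        have := Real.rpow_pos_of_pos (sub_pos.2 ht'.2) (2 * β)
        positivity
      have hr : 0 < √(A ^ (1 - m) * (T - t') ^ (2 * β) * ‖y‖ ^ 2) := by
        refine lt_of_le_of_ne (Real.sqrt_nonneg _) fun h => ?_
        rw [← h, mul_zero] at hcS
        linarith
      have hcμ : c ≤ lam2 / μ :=
        hc1.trans (div_le_div_of_nonneg_left (hlam1.trans h12).le hμ0 hμ1)
      have h1 := hle2 y t' (hIoo t' ht')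
      have h2 := scaling_le_of_strictAntiOn hJ hS hr hcμ hcS
      rw [← div_mul_cancel₀ lam2 hμ0.ne', selfSimilarPow_mul hm1 Z
        (div_nonneg (hlam1.trans h12).le hμ0.le) hμ0.le y ht'.2, ← hk] at h1
      rw [Real.sq_sqrt hσ] at h2
      exact h1.trans (mul_le_mul_of_nonneg_left h2 (hc t' ht'.2).le)
    rw [pow_succ', mul_assoc, selfSimilarPow_mul hm1 Z hθ0.le hμ0.le x ht.2, ← hk, ← hA]
    set σ := A ^ (1 - m) * (T - t) ^ (2 * β) * ‖x‖ ^ 2 with hσ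
    have hσ0 : 0 ≤ σ := by
      have := Real.rpow_pos_of_pos htT (2 * β)
      positivity
    rcases le_or_gt σ (4 * S ^ 2) with hσS | hσS
    · have hbar := le_perturbed_barrier (ρ₀ := ρ₀) (s₁ := S ^ 2) (s₂ := 4 * S ^ 2) hm0 hm1 hα hβ hA0
        ha hε hZ hZ1c hZ1 hode (by nlinarith) hK hρ₀0 (by linarith) hbig hu
        (fun y t' ht' => hj y t' ⟨by linarith [ht'.1], ht'.2⟩)
        (fun y t' ht' hy => by
          refine (houter _ le_rfl y t' ht' ?_).trans_lt
            (mul_lt_mul_of_pos_left (hgap _ hy) (hc t' ht'.2))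
          have h1 := Real.le_sqrt_of_sq_le hy.1
          have h2 := (one_lt_div hlam1).2 h12
          nlinarith)
        x htρ₀ hσS
      refine hbar.trans (mul_le_mul_of_nonneg_left ?_ (hc t ht.2).le)
      refine le_trans ?_ (hshrink σ ⟨hσ0, hσS⟩)
      have h1 : K / ρ₀ * (T - t) = 1 / 2 := by
        rw [hρ₀]; field_simp
      rw [← hσ, h1]
      have h2 := Real.one_le_exp (mul_nonneg ha.le hσ0)
      nlinarith
    · refine houter θ (hθ1.le.trans ((one_lt_div hlam1).2 h12).le) x t htρ₀ ?_
      have h1 : 2 * S ≤ √σ := Real.le_sqrt_of_sq_le (by nlinarith)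
      rw [← hσ]
      nlinarith

lemma exists_profile_strictAnti {n : ℕ} {m β α : ℝ} (hn : 3 ≤ n) (hm0 : 0 < m)
    (hm1 : m < ((n : ℝ) - 2) / n) (hα : α = (2 * β + 1) / (1 - m)) (hC2 : CondC2 n m β)
    {g : ℝ → ℝ} (hg : IsProfile n m β α 1 g) {Z Z1 Z2 : ℝ → ℝ}
    (hZg : ∀ r, 0 ≤ r → Z (r ^ 2) = g r ^ m)
    (hZpos : ∀ σ, 0 ≤ σ → 0 < Z σ) (hZ : ∀ σ, 0 ≤ σ → HasDerivAt Z (Z1 σ) σ)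
    (hZ1c : Continuous Z1) (hZ1 : ∀ σ, 0 < σ → HasDerivAt Z1 (Z2 σ) σ)
    (hode : ∀ σ, 0 ≤ σ → 4 * σ * Z2 σ + 2 * n * Z1 σ + α * Z σ ^ (1 / m)
        + 2 * β * σ * (1 / m * Z σ ^ (1 / m - 1) * Z1 σ) = 0) :
    ∃ S, 0 < S ∧ StrictAntiOn (fun r : ℝ => r ^ (2 * m / (1 - m)) * Z (r ^ 2)) (Ici S) := by
  have hn' : (3 : ℝ) ≤ n := by exact_mod_cast hn
  have hD : 0 < (n : ℝ) - 2 - n * m := by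
    rw [lt_div_iff₀ (by linarith)] at hm1
    linarith
  have hm : 0 < 1 - m := by nlinarith
  obtain ⟨hβ0, hβ1, hor⟩ := hC2
  have hβ2 := (le_max_left (beta2 n m) (betaE n m)).trans_lt hβ0
  have hβe := (le_max_right (beta2 n m) (betaE n m)).trans_lt hβ0
  have hβ : 0 < β := lt_trans (div_pos hm0 hD) hβe
  have hd2' : (n : ℝ) - 4 < (n - 2) * m := by
    rcases hor with h | ⟨h, h4, -⟩
    · have : (n : ℝ) ≤ 4 := by exact_mod_cast h
      nlinarith
    · rw [div_lt_iff₀ (by linarith)] at h4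
      linarith
  set k := 2 * m / (1 - m) with hk
  set d := ((n : ℝ) - 2 - n * m) / (1 - m) with hd
  have hk0 : 0 < k := by positivity
  have hd0 : 0 < d := div_pos hD hm
  have hd2 : d < 2 := by rw [hd, div_lt_iff₀ hm]; linarith
  have hB : 2 * d * √(2 / d) < d - k + 2 * d * β := by
    have h1 : 2 / d = 2 * (1 - m) / ((n : ℝ) - 2 - n * m) := by rw [hd]; field_simp
    have h2 := mul_lt_mul_of_pos_left hβ2 (show 0 < 2 * d by positivity)
    have h3 : 2 * d * ((((n : ℝ) + 2) * m - ((n : ℝ) - 2)) / (2 * ((n : ℝ) - 2 - n * m)))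
        = -(d - k) := by
      rw [hd, hk]; field_simp; ring
    unfold beta2 at h2
    rw [← h1, mul_add, h3] at h2
    linarith
  obtain ⟨hdisc, hprod⟩ := params_discriminant hd0 hd2 hk0 hβ hB
  have h1k : 1 + k / 2 = 1 / (1 - m) := by rw [hk]; field_simp; ring
  have hC : 0 < Cstar n m := by unfold Cstar; positivity
  have hQ : 1 / m = 1 + 2 / k := by rw [hk]; field_simp; ring
  refine radial_eventually_strictAnti (d := d) (k := k) (β := β) (α := α) (N := n)
    (xs := Cstar n m ^ (m / (1 - m))) hd0 hd2 hk0 hQ ?_ ?_ ?_ hdisc hprod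
    (Real.rpow_pos_of_pos hC _) ?_ hZpos hZ hZ1c hZ1 hode ?_
  · refine hβ1.trans_le (le_of_eq ?_)
    rw [h1k, hd, beta1]; field_simp
  · rw [hd, hk]; field_simp; ring
  · rw [h1k, hα]; ring
  · rw [← Real.rpow_mul hC.le, show m / (1 - m) * (1 / m - 1) = 1 by field_simp, Real.rpow_one, h1k,
      hk, hd, Cstar]
    field_simp
  · refine (hg.asymp.rpow_const (p := m / (1 - m)) (Or.inl hC.ne')).congr' ?_
    filter_upwards [eventually_gt_atTop 0] with r hr
    have hgr := hg.pos r hr.le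
    rw [hZg r hr.le, Real.mul_rpow (by positivity) (by positivity), ← Real.rpow_natCast,
      ← Real.rpow_mul hr.le, ← Real.rpow_mul hgr.le, hk]
    congr 2
    · push_cast; ring
    · field_simp

/-- A solution that eventually lies below arbitrarily small self-similar solutions has a rescaling
that vanishes locally uniformly. -/
lemma tendstoUniformlyOn_resc_zero {n : ℕ} {m β α T θ lam1 : ℝ} (hm1 : m < 1) (hT : 0 < T)
    (hθ0 : 0 < θ) (hθ1 : θ < 1) (hlam1 : 0 < lam1) {f : ℝ → ℝ → ℝ}
    (hf : ContinuousOn (f 1) (Ici 0))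
    (hscale : ∀ lam, 0 < lam → ∀ r, 0 ≤ r → f lam r = lam ^ (2 / (1 - m)) * f 1 (lam * r))
    {u : EuclideanSpace ℝ (Fin n) → ℝ → ℝ} (hpos : ∀ x, ∀ t ∈ Ioo 0 T, 0 < u x t)
    (hle : ∀ j : ℕ, ∃ ρ, 0 < ρ ∧ ρ < T ∧ ∀ x, ∀ t ∈ Ico (T - ρ) T,
      u x t ≤ Uself n β α T (f (θ ^ j * lam1)) x t)
    {K : Set (EuclideanSpace ℝ (Fin n))} (hK : IsCompact K) :
    TendstoUniformlyOn (fun τ y => resc n β α T u y τ) (fun _ => (0 : ℝ)) atTop K := by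
  obtain ⟨M, hM⟩ := hK.isBounded.exists_norm_le
  obtain ⟨G, hG⟩ := (isCompact_Icc (a := (0 : ℝ)) (b := lam1 * M)).bddAbove_image
    (hf.mono Icc_subset_Ici_self)
  rw [Metric.tendstoUniformlyOn_iff]
  intro ε hε
  have hexp : 0 < 2 / (1 - m) := div_pos two_pos (sub_pos.2 hm1)
  have hlim : Tendsto (fun j : ℕ => (θ ^ j * lam1) ^ (2 / (1 - m)) * G) atTop (𝓝 0) := by
    have h1 := (tendsto_pow_atTop_nhds_zero_of_lt_one hθ0.le hθ1).mul_const lam1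
    have h2 := (h1.rpow_const (p := 2 / (1 - m)) (Or.inr hexp.le)).mul_const G
    simpa [Real.zero_rpow hexp.ne'] using h2
  obtain ⟨j, hj⟩ := (hlim.eventually (gt_mem_nhds hε)).exists
  obtain ⟨ρ, hρ, hρT, hu⟩ := hle j
  set ν := θ ^ j * lam1 with hν
  have hν0 : 0 < ν := by positivity
  have hν1 : ν ≤ lam1 := mul_le_of_le_one_left hlam1.le (pow_le_one₀ hθ0.le hθ1.le)
  have hρlim : Tendsto (fun τ : ℝ => T * exp (-τ)) atTop (𝓝 0) := by
    simpa using Real.tendsto_exp_neg_atTop_nhds_zero.const_mul T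
  filter_upwards [hρlim.eventually (gt_mem_nhds hρ)] with τ hτ y hy
  have hr0 : 0 < T * exp (-τ) := by positivity
  have ht : T * (1 - exp (-τ)) = T - T * exp (-τ) := by ring
  unfold resc
  rw [ht]
  set r := T * exp (-τ) with hr
  have h1 : 0 < r ^ (-α) := Real.rpow_pos_of_pos hr0 _
  have h2 := hu (r ^ (-β) • y) (T - r) ⟨by linarith, by linarith⟩
  have h3 := hpos (r ^ (-β) • y) (T - r) ⟨by linarith, by linarith⟩
  have hrβ : 0 < r ^ (-β) := Real.rpow_pos_of_pos hr0 _
  have h4 : r ^ β * ‖r ^ (-β) • y‖ = ‖y‖ := by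
    rw [norm_smul, Real.norm_of_nonneg hrβ.le, ← mul_assoc, ← Real.rpow_add hr0]
    simp
  unfold Uself at h2
  rw [sub_sub_cancel, h4, hscale ν hν0 _ (norm_nonneg _)] at h2
  have h5 := mul_le_mul_of_nonneg_left h2 h1.le
  rw [← mul_assoc, ← Real.rpow_add hr0, neg_add_cancel, Real.rpow_zero, one_mul] at h5
  have h6 : f 1 (ν * ‖y‖) ≤ G := by
    refine hG (mem_image_of_mem _ ⟨by positivity, ?_⟩)
    exact mul_le_mul hν1 (hM y hy) (norm_nonneg _) hlam1.le
  have h7 := mul_le_mul_of_nonneg_left h6 (Real.rpow_pos_of_pos hν0 (2 / (1 - m))).le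
  rw [dist_zero_left, Real.norm_of_nonneg (mul_pos h1 h3).le]
  linarith

/-- Convergence of the rescaled solution to zero in the non-monotone case (C2), uniformly on
compact subsets of `ℝ^n`. -/
theorem convergence_to_zero_C2 (n : ℕ) (m β α T : ℝ) (hn : 3 ≤ n) (hm0 : 0 < m)
    (hm1 : m < ((n : ℝ) - 2) / n) (hα : α = (2 * β + 1) / (1 - m)) (hC2 : CondC2 n m β)
    (hT : 0 < T) (f : ℝ → ℝ → ℝ) (hf : ∀ lam, 0 < lam → IsProfile n m β α lam (f lam))
    (hscale : ∀ lam, 0 < lam → ∀ r, 0 ≤ r → f lam r = lam ^ (2 / (1 - m)) * f 1 (lam * r))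
    (lam1 lam2 lam0 : ℝ) (hlam1 : 0 < lam1) (h12 : lam1 < lam2) (hlam0 : 0 < lam0)
    (u0 : EuclideanSpace ℝ (Fin n) → ℝ)
    (hu0nonneg : ∀ x, 0 ≤ u0 x)
    (hu0upper : ∀ x, u0 x ≤ min (Uself n β α T (f lam1) x 0) (Uself n β α T (f lam2) x 0))
    (hu0L1 : Integrable (fun x => u0 x - Uself n β α T (f lam0) x 0))
    (u : EuclideanSpace ℝ (Fin n) → ℝ → ℝ)
    (hu : IsCauchySolution n m T u0 u)
    (hAB : ∀ x, ∀ t ∈ Set.Ioo 0 T, deriv (u x) t ≤ u x t / ((1 - m) * t))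
    (hsand : ∀ x, ∀ t ∈ Set.Ioo 0 T,
      0 < u x t ∧ u x t ≤ min (Uself n β α T (f lam1) x t) (Uself n β α T (f lam2) x t)) :
    ∀ K : Set (EuclideanSpace ℝ (Fin n)), IsCompact K →
      TendstoUniformlyOn (fun τ y => resc n β α T u y τ) (fun _ => (0 : ℝ)) atTop K := by
  have hn' : (3 : ℝ) ≤ n := by exact_mod_cast hn
  have hm : m < 1 := hm1.trans ((div_lt_one (by linarith)).2 (by linarith))
  have hβ : 0 < β := by
    refine lt_of_le_of_lt ?_ ((le_max_right (beta2 n m) (betaE n m)).trans_lt hC2.1)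
    rw [lt_div_iff₀ (by linarith)] at hm1
    exact div_nonneg hm0.le (by linarith)
  have hα' : α * (1 - m) = 2 * β + 1 := by
    rw [hα, div_mul_cancel₀ _ (sub_pos.2 hm).ne']
  have hg := hf 1 one_pos
  obtain ⟨Z, Z1, Z2, hZf, hZ, hZ1c, hZ1, hode⟩ := hg.exists_radial (by omega) hm0
  have hZpos : ∀ σ, 0 ≤ σ → 0 < Z σ := fun σ hσ => by
    rw [← Real.sq_sqrt hσ, hZf _ (Real.sqrt_nonneg σ)]
    exact Real.rpow_pos_of_pos (hg.pos _ (Real.sqrt_nonneg σ)) m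
  obtain ⟨S, hS, hJ⟩ :=
    exists_profile_strictAnti hn hm0 hm1 hα hC2 hg hZf hZpos hZ hZ1c hZ1 hode
  have hpow : ∀ ν, 0 < ν → ∀ x, ∀ t < T,
      Uself n β α T (f ν) x t ^ m = selfSimilarPow m β α T Z ν x t :=
    fun ν hν x t ht => Uself_rpow hm hg.pos (hscale ν hν) hZf hν x ht
  have hupper : ∀ ν, 0 < ν → ∀ x, ∀ t ∈ Ioo 0 T, u x t ≤ Uself n β α T (f ν) x t →
      u x t ^ m ≤ selfSimilarPow m β α T Z ν x t := fun ν hν x t ht hle => by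
    rw [← hpow ν hν x t ht.2]
    exact Real.rpow_le_rpow (hu.pos x t ht).le hle hm0.le
  obtain ⟨θ, hθ0, hθ1, hle⟩ := le_selfSimilarPow_shrink (by omega) hm0 hm hα' hβ hT rfl hZpos hZ
    hZ1c hZ1 hode hS hJ hlam1 h12 hu
    (fun x t ht => hupper lam1 hlam1 x t ht ((hsand x t ht).2.trans (min_le_left _ _)))
    (fun x t ht => hupper lam2 (hlam1.trans h12) x t ht
      ((hsand x t ht).2.trans (min_le_right _ _)))
  intro K hK
  refine tendstoUniformlyOn_resc_zero hm hT hθ0 hθ1 hlam1 hg.smooth.continuousOn hscale hu.pos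
    (fun j => ?_) hK
  obtain ⟨ρ, hρ, hρT, h⟩ := hle j
  refine ⟨ρ, hρ, hρT, fun x t ht => ?_⟩
  have hν : 0 < θ ^ j * lam1 := by positivity
  have hU : 0 ≤ Uself n β α T (f (θ ^ j * lam1)) x t :=
    mul_nonneg (Real.rpow_nonneg (sub_pos.2 ht.2).le _)
      ((hf _ hν).pos _ (mul_nonneg (Real.rpow_nonneg (sub_pos.2 ht.2).le _) (norm_nonneg _))).le
  have h1 := h x t ht
  rw [← hpow _ hν x t ht.2] at h1
  exact (Real.rpow_le_rpow_iff (hu.pos x t ⟨by linarith [ht.1], ht.2⟩).le hU hm0).1 h1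
end

section
/- For every integer n ≥ 3 and every 0 < m < (n-2)/n one has β_1(m) ≥ β_0(m), and equality β_1(m) = β_0(m) holds if and only if n > 4 and m = (n-4)/(n-2). -/
open Real Filter MeasureTheory Set Topology

theorem beta2_eq_beta1_sub_sq (n : ℕ) (m : ℝ) (hm : m ≤ 1) (hD : 0 < (n : ℝ) - 2 - n * m) :
    beta2 n m = beta1 n m - (1 - Real.sqrt (2 * (1 - m) / ((n : ℝ) - 2 - n * m))) ^ 2 / 2 := by
  have hs := Real.sq_sqrt (show 0 ≤ 2 * (1 - m) / ((n : ℝ) - 2 - n * m) from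
    div_nonneg (by linarith) hD.le)
  have hsum : (((n : ℝ) + 2) * m - ((n : ℝ) - 2)) / (2 * ((n : ℝ) - 2 - n * m)) =
      1 / ((n : ℝ) - 2 - n * m) - 1 / 2 - 2 * (1 - m) / ((n : ℝ) - 2 - n * m) / 2 := by
    have := hD.ne'
    field_simp
    ring
  rw [beta2, beta1, hsum]
  linear_combination hs / 2

theorem betaE_lt_beta1 (n : ℕ) (m : ℝ) (hm : m < 1) (hD : 0 < (n : ℝ) - 2 - n * m) :
    betaE n m < beta1 n m :=
  div_lt_div_of_pos_right hm hD

/-- `β₁(m) ≥ β₀(m)`, with equality iff `n > 4` and `m = (n-4)/(n-2)`. -/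
theorem beta1_ge_beta0 (n : ℕ) (m : ℝ) (hn : 3 ≤ n) (hm0 : 0 < m)
    (hm1 : m < ((n : ℝ) - 2) / n) :
    beta0 n m ≤ beta1 n m ∧
      (beta1 n m = beta0 n m ↔ 4 < n ∧ m = ((n : ℝ) - 4) / ((n : ℝ) - 2)) := by
  have hn3 : (3 : ℝ) ≤ n := by exact_mod_cast hn
  have hD : 0 < (n : ℝ) - 2 - n * m := by
    rw [lt_div_iff₀ (by linarith)] at hm1
    linarith
  have hm : m < 1 := by nlinarith
  have h2 := beta2_eq_beta1_sub_sq n m hm.le hD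
  have hE := betaE_lt_beta1 n m hm hD
  have hle : beta2 n m ≤ beta1 n m := by
    rw [h2]
    linarith [sq_nonneg (1 - Real.sqrt (2 * (1 - m) / ((n : ℝ) - 2 - n * m)))]
  refine ⟨max_le hle hE.le, ?_⟩
  have h0 : beta1 n m = beta0 n m ↔ beta1 n m = beta2 n m := by
    constructor
    · intro h
      rcases max_choice (beta2 n m) (betaE n m) with hmax | hmax
      · exact h.trans hmax
      · exact absurd (h.trans hmax) hE.ne'
    · intro h
      exact h.trans (max_eq_left (h ▸ hE.le)).symm
  have hsqrt : beta1 n m = beta2 n m ↔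
      Real.sqrt (2 * (1 - m) / ((n : ℝ) - 2 - n * m)) = 1 := by
    rw [h2]
    constructor
    · intro h
      have hsq : (1 - Real.sqrt (2 * (1 - m) / ((n : ℝ) - 2 - n * m))) ^ 2 = 0 := by linarith
      linarith [pow_eq_zero_iff (two_ne_zero) |>.mp hsq]
    · intro h
      rw [h]
      ring
  rw [h0, hsqrt, Real.sqrt_eq_one, div_eq_one_iff_eq hD.ne',
    eq_div_iff (show (n : ℝ) - 2 ≠ 0 by linarith)]
  constructor
  · intro h
    refine ⟨?_, by linarith⟩
    have : (4 : ℝ) < n := by nlinarith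
    exact_mod_cast this
  · rintro ⟨-, h⟩
    linarith
end
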